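/- arXiv:1808.04141 — 4 statements merged into one kernel-verified Lean document; each statement's English description precedes it below -/
import Mathlib

section
/- Let 0 ≤ k, ℓ ≤ d be integers with k + ℓ ≥ d, and let p = E_k^d + E_ℓ^d. Then R_d(p) ≺ p (so p ∈ A_d), and moreover E_0^{d−1} ≺ R_d(p) − p ≺ E_{d−1}^{d−1}. -/
open Polynomial
open scoped Classical

noncomputable section

/-- The complexification of a real polynomial. -/
def toC (p : ℝ[X]) : ℂ[X] := p.map (algebraMap ℝ ℂ)

/-- A complex polynomial is *stable* if it is identically zero or has no zero with
positive imaginary part. -/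
def StableC (f : ℂ[X]) : Prop := f = 0 ∨ ∀ z : ℂ, 0 < z.im → f.eval z ≠ 0

/-- `Interlaces p q` means `p ≺ q`, i.e. `q + i·p` is stable. -/
def Interlaces (p q : ℝ[X]) : Prop :=
  StableC (toC q + Polynomial.C Complex.I * toC p)

/-- A real polynomial is real-rooted if it is identically zero or all of its complex
zeros are real. -/
def RealRooted (p : ℝ[X]) : Prop :=
  p = 0 ∨ ∀ z : ℂ, (toC p).eval z = 0 → z.im = 0

/-- `Rflip d p = (-1)^d · p(-1-x)`. -/
def Rflip (d : ℕ) (p : ℝ[X]) : ℝ[X] := (-1 : ℝ) ^ d • p.comp (-1 - X)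

/-- The f-polynomial of `h` with respect to `d`:
`f(h;x) = Σ_{k=0}^d h_k x^k (1+x)^{d-k} = (1+x)^d h(x/(1+x))`. -/
def fPoly (d : ℕ) (h : ℝ[X]) : ℝ[X] :=
  ∑ k ∈ Finset.range (d + 1), Polynomial.C (h.coeff k) * X ^ k * (1 + X) ^ (d - k)

/-- The subdivision operator `E`, the unique linear map with `E(binom(x,k)) = x^k`;
here computed via Newton's forward-difference formula
`p = Σ_k (Δ^k p)(0) binom(x,k)` where `Δq = q(x+1) - q(x)`. -/
def subdivE (p : ℝ[X]) : ℝ[X] :=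
  ∑ k ∈ Finset.range (p.natDegree + 1),
    Polynomial.C (((fun q : ℝ[X] => q.comp (X + 1) - q)^[k] p).eval 0) * X ^ k

/-- `Ekd d k = E_k^d = E(x^k (x+1)^(d-k))`. -/
def Ekd (d k : ℕ) : ℝ[X] := subdivE (X ^ k * (X + 1) ^ (d - k))

/-- The cone `𝓔_d` of nonnegative combinations of the `E_k^d`, `0 ≤ k ≤ d`. -/
def coneE (d : ℕ) : Set ℝ[X] :=
  { p | ∃ c : ℕ → ℝ, (∀ i, 0 ≤ c i) ∧ p = ∑ i ∈ Finset.range (d + 1), c i • Ekd d i }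

/-- `𝓐_d = {p ∈ 𝓔_d : R_d(p) ≺ p}`. -/
def Ad (d : ℕ) : Set ℝ[X] := { p | p ∈ coneE d ∧ Interlaces (Rflip d p) p }

/-- `p` is alternatingly increasing with respect to `n`:
`0 ≤ p_0 ≤ p_n ≤ p_1 ≤ p_{n-1} ≤ ⋯ ≤ p_{⌊(n+1)/2⌋}`. -/
def AltInc (n : ℕ) (p : ℝ[X]) : Prop :=
  0 ≤ p.coeff 0 ∧ (∀ k, 2 * k ≤ n → p.coeff k ≤ p.coeff (n - k)) ∧
    (∀ k, 2 * k + 1 ≤ n → p.coeff (n - k) ≤ p.coeff (k + 1))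

/-- The number of excedances of an `r`-colored permutation `(σ, z)`:
indices `k` with `σ k > k`, or `σ k = k` and `z k > 0`. -/
def excC {n r : ℕ} (σ : Equiv.Perm (Fin n)) (z : Fin n → Fin r) : ℕ :=
  (Finset.univ.filter fun k : Fin n => k < σ k ∨ (σ k = k ∧ 0 < (z k : ℕ))).card

/-- The colored Eulerian polynomial `A_{n,r}`. -/
def coloredEulerian (n r : ℕ) : ℝ[X] :=
  ∑ σ : Equiv.Perm (Fin n), ∑ z : Fin n → Fin r, X ^ excC σ z

/-- The colored derangement polynomial `d_{n,r}`: the sum of `x^{exc(σ,z)}` over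
colored permutations with no fixed point of color `0`. -/
def coloredDerangement (n r : ℕ) : ℝ[X] :=
  ∑ σ : Equiv.Perm (Fin n),
    ∑ z ∈ Finset.univ.filter (fun z : Fin n → Fin r => ∀ k, ¬(σ k = k ∧ (z k : ℕ) = 0)),
      X ^ excC σ z

/-- The number of excedances of a permutation. -/
def excP {n : ℕ} (σ : Equiv.Perm (Fin n)) : ℕ :=
  (Finset.univ.filter fun k : Fin n => k < σ k).card

/-- The Eulerian polynomial `A_n`. -/
def eulerianPoly (n : ℕ) : ℝ[X] := ∑ σ : Equiv.Perm (Fin n), X ^ excP σ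

/-- The derangement polynomial `d_n`. -/
def derangePoly (n : ℕ) : ℝ[X] :=
  ∑ σ ∈ Finset.univ.filter (fun σ : Equiv.Perm (Fin n) => ∀ k, σ k ≠ k), X ^ excP σ

/-- The linear map `D` with `D(x^k) = d_k`. -/
def Dmap (p : ℝ[X]) : ℝ[X] :=
  ∑ k ∈ Finset.range (p.natDegree + 1), p.coeff k • derangePoly k

/-- Stability for multivariate complex polynomials: identically zero or nonvanishing
whenever all coordinates have positive imaginary part. -/
def MvStable {n : ℕ} (P : MvPolynomial (Fin n) ℂ) : Prop :=
  P = 0 ∨ ∀ z : Fin n → ℂ, (∀ j, 0 < (z j).im) → MvPolynomial.eval z P ≠ 0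

/-- The operator `T_k(f)(x) = Σ_{i=0}^k (-1)^{k-i} binom(k,i) f((i+1)x)`. -/
def Tk (k : ℕ) (f : ℝ[X]) : ℝ[X] :=
  ∑ i ∈ Finset.range (k + 1),
    ((-1 : ℝ) ^ (k - i) * (k.choose i : ℝ)) • f.comp (Polynomial.C ((i : ℝ) + 1) * X)

/-- The cone `B_{d,γ}` of nonnegative combinations of the polynomials
`x^i (x+1)^{d-i} + x^j (x+1)^{d-j}` with `i + j ≥ γ`. -/
def coneBsum (d γ : ℕ) : Set ℝ[X] :=
  { p | ∃ c : ℕ × ℕ → ℝ, (∀ ij, 0 ≤ c ij) ∧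
      p = ∑ ij ∈ (Finset.range (d + 1) ×ˢ Finset.range (d + 1)).filter
            (fun ij => γ ≤ ij.1 + ij.2),
          c ij • (X ^ ij.1 * (X + 1) ^ (d - ij.1) + X ^ ij.2 * (X + 1) ^ (d - ij.2)) }

/-- The cone `B_{d,m}` of nonnegative combinations of the polynomials
`x^j (mx+1)^{d-j}`, `0 ≤ j ≤ d`. -/
def coneBm (d m : ℕ) : Set ℝ[X] :=
  { p | ∃ c : ℕ → ℝ, (∀ j, 0 ≤ c j) ∧
      p = ∑ j ∈ Finset.range (d + 1), c j • (X ^ j * (Polynomial.C (m : ℝ) * X + 1) ^ (d - j)) }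

end

/-- The real bilinear form `Im (g * conj f)`. -/
def br (f g : ℂ) : ℝ := f.re * g.im - f.im * g.re

lemma br_add_left (a b c : ℂ) : br (a + b) c = br a c + br b c := by simp [br]; ring
lemma br_add_right (a b c : ℂ) : br a (b + c) = br a b + br a c := by simp [br]; ring
lemma br_sub_left (a b c : ℂ) : br (a - b) c = br a c - br b c := by simp [br]; ring
lemma br_sub_right (a b c : ℂ) : br a (b - c) = br a b - br a c := by simp [br]; ring
lemma br_zero_left (c : ℂ) : br 0 c = 0 := by simp [br]
lemma br_zero_right (c : ℂ) : br c 0 = 0 := by simp [br]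
lemma br_self (c : ℂ) : br c c = 0 := by simp [br]; ring
lemma br_anti (a b : ℂ) : br a b = - br b a := by simp [br]; ring
lemma br_mul_mul (w a b : ℂ) : br (w * a) (w * b) = Complex.normSq w * br a b := by
  simp [br, Complex.normSq_apply]; ring
lemma br_self_mul (w a : ℂ) : br a (w * a) = Complex.normSq a * w.im := by
  simp [br, Complex.normSq_apply]; ring
lemma br_real_mul (c d : ℝ) (a b : ℂ) : br ((c : ℂ) * a) ((d : ℂ) * b) = c * d * br a b := by
  simp [br]; ring
lemma br_self_mul_nonneg {w : ℂ} (hw : 0 ≤ w.im) (a : ℂ) : 0 ≤ br a (w * a) := by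
  rw [br_self_mul]; exact mul_nonneg (Complex.normSq_nonneg _) hw
lemma br_self_mul_pos {w a : ℂ} (hw : 0 < w.im) (ha : a ≠ 0) : 0 < br a (w * a) := by
  rw [br_self_mul]; exact mul_pos (Complex.normSq_pos.2 ha) hw
lemma br_mul_mul_nonneg (w : ℂ) {a b : ℂ} (h : 0 ≤ br a b) : 0 ≤ br (w * a) (w * b) := by
  rw [br_mul_mul]; exact mul_nonneg (Complex.normSq_nonneg _) h

lemma br_sum_left {ι : Type*} (s : Finset ι) (f : ι → ℂ) (c : ℂ) :
    br (∑ i ∈ s, f i) c = ∑ i ∈ s, br (f i) c := by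
  induction s using Finset.induction_on with
  | empty => simp [br]
  | insert a s ha ih => rw [Finset.sum_insert ha, Finset.sum_insert ha, br_add_left, ih]

lemma br_sum_right {ι : Type*} (s : Finset ι) (f : ι → ℂ) (c : ℂ) :
    br c (∑ i ∈ s, f i) = ∑ i ∈ s, br c (f i) := by
  induction s using Finset.induction_on with
  | empty => simp [br]
  | insert a s ha ih => rw [Finset.sum_insert ha, Finset.sum_insert ha, br_add_right, ih]

/-- Sum over an interval. -/
def sm (f : ℕ → ℂ) (a b : ℕ) : ℂ := ∑ i ∈ Finset.Ico a b, f i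

lemma sm_split (f : ℕ → ℂ) {a b c : ℕ} (h : a ≤ b) (h' : b ≤ c) :
    sm f a c = sm f a b + sm f b c := (Finset.sum_Ico_consecutive f h h').symm

lemma sm_self (f : ℕ → ℂ) (a : ℕ) : sm f a a = 0 := by simp [sm]

lemma sm_succ (f : ℕ → ℂ) {a b : ℕ} (h : a ≤ b) : sm f a (b + 1) = sm f a b + f b :=
  Finset.sum_Ico_succ_top h f

lemma sm_sub (f g : ℕ → ℂ) (a b : ℕ) : sm (fun i => f i - g i) a b = sm f a b - sm g a b := by
  simp [sm]

lemma sm_mul (f : ℕ → ℂ) (w : ℂ) (a b : ℕ) : sm (fun i => w * f i) a b = w * sm f a b := by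
  simp [sm, Finset.mul_sum]

lemma sm_add (f g : ℕ → ℂ) (a b : ℕ) : sm (fun i => f i + g i) a b = sm f a b + sm g a b := by
  simp [sm, Finset.sum_add_distrib]

lemma br_sm {f g : ℕ → ℂ} {a b c d : ℕ}
    (h : ∀ i j, a ≤ i → i < b → c ≤ j → j < d → 0 ≤ br (f i) (g j)) :
    0 ≤ br (sm f a b) (sm g c d) := by
  unfold sm
  rw [br_sum_left]
  refine Finset.sum_nonneg fun i hi => ?_
  rw [br_sum_right]
  refine Finset.sum_nonneg fun j hj => ?_
  rw [Finset.mem_Ico] at hi hj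
  exact h i j hi.1 hi.2 hj.1 hj.2

lemma br_sm_pos {f g : ℕ → ℂ} {a b c d : ℕ} (i₀ j₀ : ℕ) (hi1 : a ≤ i₀) (hi2 : i₀ < b)
    (hj1 : c ≤ j₀) (hj2 : j₀ < d)
    (h : ∀ i j, a ≤ i → i < b → c ≤ j → j < d → 0 ≤ br (f i) (g j))
    (h0 : 0 < br (f i₀) (g j₀)) :
    0 < br (sm f a b) (sm g c d) := by
  unfold sm
  rw [br_sum_left]
  refine Finset.sum_pos' (fun i hi => ?_) ⟨i₀, by simp [hi1, hi2], ?_⟩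
  · rw [br_sum_right]
    refine Finset.sum_nonneg fun j hj => ?_
    rw [Finset.mem_Ico] at hi hj
    exact h i j hi.1 hi.2 hj.1 hj.2
  · rw [br_sum_right]
    refine Finset.sum_pos' (fun j hj => ?_) ⟨j₀, by simp [hj1, hj2], h0⟩
    rw [Finset.mem_Ico] at hj
    exact h i₀ j hi1 hi2 hj.1 hj.2

lemma br_sm_sym {f g : ℕ → ℂ} {a b : ℕ}
    (h : ∀ i j, a ≤ i → i < b → a ≤ j → j < b → 0 ≤ br (f i) (g j) + br (f j) (g i)) :
    0 ≤ br (sm f a b) (sm g a b) := by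
  have e : br (sm f a b) (sm g a b)
      = ∑ i ∈ Finset.Ico a b, ∑ j ∈ Finset.Ico a b, br (f i) (g j) := by
    unfold sm
    rw [br_sum_left]
    exact Finset.sum_congr rfl fun i _ => br_sum_right _ _ _
  have e2 : br (sm f a b) (sm g a b)
      = ∑ i ∈ Finset.Ico a b, ∑ j ∈ Finset.Ico a b, br (f j) (g i) := by
    rw [e, Finset.sum_comm]
  have : 0 ≤ 2 * br (sm f a b) (sm g a b) := by
    rw [two_mul]
    nth_rewrite 1 [e]
    rw [e2, ← Finset.sum_add_distrib]
    refine Finset.sum_nonneg fun i hi => ?_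
    rw [← Finset.sum_add_distrib]
    refine Finset.sum_nonneg fun j hj => ?_
    rw [Finset.mem_Ico] at hi hj
    exact h i j hi.1 hi.2 hj.1 hj.2
  linarith

/-- Plücker relation. -/
lemma br_pluck (a b c d : ℂ) :
    br a c * br b d = br a b * br c d + br a d * br b c := by
  simp only [br]; ring

lemma amgm_aux {a b t U V c : ℝ} (ha : 0 ≤ a) (hb : 0 ≤ b) (ht : 0 ≤ t) (hab : t ^ 2 ≤ a * b)
    (hU : 0 ≤ U) (hV : 0 ≤ V) (hc : c ^ 2 ≤ U * V) : 0 ≤ a * U + b * V + 2 * (t * c) := by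
  have h1 : (2 * (t * c)) ^ 2 ≤ (a * U + b * V) ^ 2 := by
    have : t ^ 2 * c ^ 2 ≤ (a * b) * (U * V) :=
      mul_le_mul hab hc (sq_nonneg _) (mul_nonneg ha hb)
    nlinarith [sq_nonneg (a * U - b * V)]
  have h2 : 0 ≤ a * U + b * V := by positivity
  have := abs_le_of_sq_le_sq' h1 h2
  linarith [this.1]

lemma arc_coeff {u G f : ℂ} (hu : 0 < u.im) (hG : G ≠ 0) (h1 : 0 ≤ br (u * G) f)
    (h2 : 0 ≤ br f ((u - 1) * G)) :
    ∃ α β : ℝ, 0 ≤ α ∧ 0 ≤ β ∧ f = ((α : ℂ) * u + (β : ℂ) * (u - 1)) * G := by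
  have hd : 0 < Complex.normSq G * u.im := mul_pos (Complex.normSq_pos.2 hG) hu
  refine ⟨br f ((u - 1) * G) / (Complex.normSq G * u.im),
    br (u * G) f / (Complex.normSq G * u.im), div_nonneg h2 hd.le, div_nonneg h1 hd.le, ?_⟩
  have hd' : ((Complex.normSq G * u.im : ℝ) : ℂ) ≠ 0 := by exact_mod_cast hd.ne'
  have key : ((Complex.normSq G * u.im : ℝ) : ℂ) * f =
      (((br f ((u - 1) * G) : ℝ) : ℂ) * u + ((br (u * G) f : ℝ) : ℂ) * (u - 1)) * G := by
    apply Complex.ext <;> simp [br, Complex.normSq_apply] <;> ring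
  rw [Complex.ofReal_div, Complex.ofReal_div]
  field_simp
  rw [mul_comm, key]; ring
  

lemma arc_lemma {u G f h : ℂ} (hu : 0 < u.im) (hG : G ≠ 0) (h1 : 0 ≤ br (u * G) f)
    (h2 : 0 ≤ br f ((u - 1) * G)) (h3 : 0 ≤ br (u * G) h)
    (h4 : 0 ≤ br h ((u - 1) * G)) (h5 : 0 ≤ br h f) :
    0 ≤ br f ((u - 1) * h) ∧ 0 ≤ br h (u * f) ∧ 0 ≤ br (u * f) ((u - 1) * h) := by
  obtain ⟨α, β, ha, hb, rfl⟩ := arc_coeff hu hG h1 h2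
  obtain ⟨α', β', ha', hb', rfl⟩ := arc_coeff hu hG h3 h4
  have hGp : 0 < Complex.normSq G := Complex.normSq_pos.2 hG
  set N := Complex.normSq G with hN
  have e5 : br (((α' : ℂ) * u + (β' : ℂ) * (u - 1)) * G) (((α : ℂ) * u + (β : ℂ) * (u - 1)) * G)
      = N * u.im * (α' * β - α * β') := by
    simp [br, hN, Complex.normSq_apply]; ring
  rw [e5] at h5
  have hk : 0 ≤ α' * β - α * β' := by
    by_contra hcon
    push Not at hcon
    have := mul_neg_of_pos_of_neg (mul_pos hGp hu) hcon
    linarith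
  have ht : 0 ≤ α * β' := mul_nonneg ha hb'
  have hab : (α * β') ^ 2 ≤ (α * α') * (β * β') := by nlinarith
  set U := u.re ^ 2 + u.im ^ 2 with hU
  set V := (u.re - 1) ^ 2 + u.im ^ 2 with hV
  set c := u.re * (u.re - 1) + u.im ^ 2 with hc
  have hUn : 0 ≤ U := by positivity
  have hVn : 0 ≤ V := by positivity
  have hcc : c ^ 2 ≤ U * V := by
    have : U * V - c ^ 2 = u.im ^ 2 := by rw [hU, hV, hc]; ring
    nlinarith [sq_nonneg u.im]
  have am := amgm_aux (mul_nonneg ha ha') (mul_nonneg hb hb') ht hab hUn hVn hcc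
  refine ⟨?_, ?_, ?_⟩
  · have : br (((α : ℂ) * u + (β : ℂ) * (u - 1)) * G)
        ((u - 1) * (((α' : ℂ) * u + (β' : ℂ) * (u - 1)) * G))
        = N * u.im * ((α * α' * U + β * β' * V + 2 * (α * β' * c)) + (α' * β - α * β') * V) := by
      simp [br, hN, Complex.normSq_apply, hU, hV, hc]; ring
    rw [this]; positivity
  · have : br (((α' : ℂ) * u + (β' : ℂ) * (u - 1)) * G)
        (u * (((α : ℂ) * u + (β : ℂ) * (u - 1)) * G))
        = N * u.im * ((α * α' * U + β * β' * V + 2 * (α * β' * c)) + (α' * β - α * β') * U) := by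
      simp [br, hN, Complex.normSq_apply, hU, hV, hc]; ring
    rw [this]; positivity
  · have : br (u * (((α : ℂ) * u + (β : ℂ) * (u - 1)) * G))
        ((u - 1) * (((α' : ℂ) * u + (β' : ℂ) * (u - 1)) * G))
        = N * u.im * (α * α' * U + β * β' * V + 2 * (α * β' * c)) := by
      simp [br, hN, Complex.normSq_apply, hU, hV, hc]; ring
    rw [this]; positivity


/-- Invariants at odd levels. -/
structure OddInv (u : ℂ) (m : ℕ) (A K : ℕ → ℂ) : Prop where
  K0 : K 0 = 0
  O1 : ∀ i j, i < j → j ≤ m → 0 ≤ br (A i) (A j)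
  O2 : ∀ i j, i ≤ m → j ≤ m → 0 ≤ br (A i) (K j)
  O2s : ∀ i j, i < m → 1 ≤ j → j ≤ m → 0 < br (A i) (K j)
  O3 : ∀ i j, i < j → j ≤ m → 0 ≤ br (K j) (K i)
  O4 : ∀ i j, i ≤ m → j ≤ m → 0 ≤ br (A i - K i) (K j)
  O5 : ∀ i l, l < i → i ≤ m → 0 ≤ br (A i) ((u - 1) * A l)
  O6 : ∀ i l, i ≤ m → l ≤ m → 0 ≤ br (K i) ((u - 1) * A l)
  O9 : ∀ i l, l < i → i ≤ m → 0 ≤ br (A i - K i) ((u - 1) * A l + K l)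
  O10 : ∀ i l, i < l → l ≤ m → 0 ≤ br (A i - K i) (u * A l)
  O10s : ∀ i j, i ≤ m → j ≤ m → 0 ≤ br (A i - K i) (u * A j) + br (A j - K j) (u * A i)
  O14 : ∀ i l, l < i → i ≤ m → 0 ≤ br (u * A i) ((u - 1) * A l + K l)
  O15 : ∀ i l, i < l → l ≤ m → 0 ≤ br (A i) (u * A l)
  Onz : ∀ a, a ≤ m → sm A a (m + 1) ≠ 0

/-- Invariants at even levels. -/
structure EvenInv (u : ℂ) (m : ℕ) (A K : ℕ → ℂ) : Prop where
  hG : ∃ G : ℂ, G ≠ 0 ∧ A 0 = u * G ∧ K 0 = (u - 1) * G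
  E1 : ∀ i j, i < j → j ≤ m → 0 ≤ br (A i) (A j)
  E2 : ∀ i j, i ≤ m → j ≤ m → 0 ≤ br (A i) (K j)
  E3 : ∀ i j, i < j → j ≤ m → 0 ≤ br (K j) (K i)
  E4 : ∀ i j, i ≤ m → j ≤ m → 0 ≤ br (A i - K i) (K j)
  E2s : ∀ i, i < m → 0 < br (A i) (K 0)
  E4s : ∀ i, i < m → 0 < br (A i - K i) (K 0)
  E5 : ∀ i j, i ≤ m → j ≤ m → 0 ≤ br (K i) ((u - 1) * (A j - K j))
  E6 : ∀ i l, l < i → i ≤ m → 0 ≤ br (A i) ((u - 1) * (A l - K l))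
  E12 : ∀ i j, i ≤ m → j ≤ m → 0 ≤ br (u * (A i - K i)) (A j) + br (u * (A j - K j)) (A i)

namespace OddInv
variable {u : ℂ} {m : ℕ} {A K : ℕ → ℂ} {a b c d : ℕ}

lemma s1 (H : OddInv u m A K) (hbc : b ≤ c) (hd : d ≤ m + 1) : 0 ≤ br (sm A a b) (sm A c d) :=
  br_sm fun i j _ _ _ _ => H.O1 i j (by omega) (by omega)
lemma s2 (H : OddInv u m A K) (hb : b ≤ m + 1) (hd : d ≤ m + 1) : 0 ≤ br (sm A a b) (sm K c d) :=
  br_sm fun i j _ _ _ _ => H.O2 i j (by omega) (by omega)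
lemma s3 (H : OddInv u m A K) (hda : d ≤ a) (hb : b ≤ m + 1) : 0 ≤ br (sm K a b) (sm K c d) :=
  br_sm fun i j _ _ _ _ => H.O3 j i (by omega) (by omega)
lemma s5 (H : OddInv u m A K) (hda : d ≤ a) (hb : b ≤ m + 1) : 0 ≤ br (sm A a b) ((u - 1) * sm A c d) := by
  rw [← sm_mul]
  exact br_sm fun i j _ _ _ _ => H.O5 i j (by omega) (by omega)
lemma s6 (H : OddInv u m A K) (hb : b ≤ m + 1) (hd : d ≤ m + 1) : 0 ≤ br (sm K a b) ((u - 1) * sm A c d) := by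
  rw [← sm_mul]
  exact br_sm fun i j _ _ _ _ => H.O6 i j (by omega) (by omega)
lemma s9 (H : OddInv u m A K) (hda : d ≤ a) (hb : b ≤ m + 1) :
    0 ≤ br (sm A a b - sm K a b) ((u - 1) * sm A c d + sm K c d) := by
  rw [← sm_mul, ← sm_sub, ← sm_add]
  exact br_sm fun i j _ _ _ _ => H.O9 i j (by omega) (by omega)
lemma s10 (H : OddInv u m A K) (hbc : b ≤ c) (hd : d ≤ m + 1) :
    0 ≤ br (sm A a b - sm K a b) (u * sm A c d) := by
  rw [← sm_mul, ← sm_sub]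
  exact br_sm fun i j _ _ _ _ => H.O10 i j (by omega) (by omega)
lemma s10s (H : OddInv u m A K) (hb : b ≤ m + 1) : 0 ≤ br (sm A a b - sm K a b) (u * sm A a b) := by
  rw [← sm_mul, ← sm_sub]
  exact br_sm_sym fun i j _ _ _ _ => H.O10s i j (by omega) (by omega)
lemma s14 (H : OddInv u m A K) (hda : d ≤ a) (hb : b ≤ m + 1) :
    0 ≤ br (u * sm A a b) ((u - 1) * sm A c d + sm K c d) := by
  rw [← sm_mul, ← sm_mul, ← sm_add]
  exact br_sm fun i j _ _ _ _ => H.O14 i j (by omega) (by omega)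
lemma s15 (H : OddInv u m A K) (hbc : b ≤ c) (hd : d ≤ m + 1) : 0 ≤ br (sm A a b) (u * sm A c d) := by
  rw [← sm_mul]
  exact br_sm fun i j _ _ _ _ => H.O15 i j (by omega) (by omega)

end OddInv

/-- The `K`-part of the odd to even step. -/
def KE (u : ℂ) (m : ℕ) (A K : ℕ → ℂ) (j : ℕ) : ℂ := (u - 1) * sm A 0 (m + 1) + sm K 0 j

/-- The `A`-part of the odd to even step. -/
def AE (u : ℂ) (m : ℕ) (A K : ℕ → ℂ) (j : ℕ) : ℂ := KE u m A K j + sm A j (m + 1)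

lemma im_sub_one (u : ℂ) : (u - 1).im = u.im := by simp

section
variable {u : ℂ} {m : ℕ} {A K : ℕ → ℂ}

lemma oe_E4 (hu : 0 < u.im) (H : OddInv u m A K) {a b : ℕ} (ha : a ≤ m + 1) (hb : b ≤ m + 1) :
    0 ≤ br (sm A a (m + 1)) (KE u m A K b) := by
  have key : ∀ L Y M : ℂ, br Y ((u - 1) * (L + Y) + M)
      = br Y ((u - 1) * L) + br Y ((u - 1) * Y) + br Y M := by
    intros; simp only [br, Complex.add_re, Complex.add_im, Complex.sub_re, Complex.sub_im,
      Complex.mul_re, Complex.mul_im]; ring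
  unfold KE
  rw [sm_split A (Nat.zero_le a) ha, key]
  have h1 := H.s5 (a := a) (b := m + 1) (c := 0) (d := a) le_rfl le_rfl
  have h2 := H.s2 (a := a) (b := m + 1) (c := 0) (d := b) le_rfl hb
  have h3 := br_self_mul_nonneg (w := u - 1) (by simpa using hu.le) (sm A a (m + 1))
  linarith

lemma oe_E4s (hu : 0 < u.im) (H : OddInv u m A K) {a : ℕ} (ha : a ≤ m) : 0 < br (sm A a (m + 1)) (KE u m A K 0) := by
  have key : ∀ L Y : ℂ, br Y ((u - 1) * (L + Y))
      = br Y ((u - 1) * L) + br Y ((u - 1) * Y) := by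
    intros; simp only [br, Complex.add_re, Complex.add_im, Complex.sub_re, Complex.sub_im,
      Complex.mul_re, Complex.mul_im]; ring
  unfold KE
  rw [sm_self, add_zero, sm_split A (Nat.zero_le a) (by omega : a ≤ m + 1), key]
  have h1 := H.s5 (a := a) (b := m + 1) (c := 0) (d := a) le_rfl le_rfl
  have h3 := br_self_mul_pos (w := u - 1) (by simpa using hu) (H.Onz a ha)
  linarith

lemma oe_E3 (hu : 0 < u.im) (H : OddInv u m A K) {a b : ℕ} (hb : b ≤ m + 1) :
    0 ≤ br (sm K a b) (KE u m A K a) := by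
  unfold KE
  rw [br_add_right]
  exact add_nonneg (H.s6 hb le_rfl) (H.s3 le_rfl hb)

lemma oe_E2a (hu : 0 < u.im) (H : OddInv u m A K) {a b : ℕ} (hab : b ≤ a) (ha : a ≤ m + 1) :
    0 ≤ br (AE u m A K a) (KE u m A K b) := by
  have h1 := oe_E4 hu H ha (hab.trans ha)
  have h2 := oe_E3 hu H (a := b) ha
  have e : AE u m A K a = KE u m A K b + sm K b a + sm A a (m + 1) := by
    unfold AE KE; rw [sm_split K (Nat.zero_le b) hab]; ring
  rw [e, br_add_left, br_add_left, br_self]; linarith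

lemma oe_E2s (hu : 0 < u.im) (H : OddInv u m A K) {a : ℕ} (ha : a ≤ m) : 0 < br (AE u m A K a) (KE u m A K 0) := by
  have h1 := oe_E4s hu H ha
  have h2 := oe_E3 hu H (a := 0) (b := a) (by omega)
  have e : AE u m A K a = KE u m A K 0 + sm K 0 a + sm A a (m + 1) := by
    unfold AE KE; rw [sm_self]; ring
  rw [e, br_add_left, br_add_left, br_self]; linarith

lemma oe_E1 (hu : 0 < u.im) (H : OddInv u m A K) {a b : ℕ} (hab : a ≤ b) (hb : b ≤ m + 1) :
    0 ≤ br (AE u m A K a) (AE u m A K b) := by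
  have key : ∀ L M X Q Y : ℂ,
      br ((u - 1) * (L + (X + Y)) + M + (X + Y)) ((u - 1) * (L + (X + Y)) + (M + Q) + Y)
      = br (X - Q) ((u - 1) * L + M) + br (X - Q) (u * X) + br (X - Q) (u * Y) := by
    intros; simp only [br, Complex.add_re, Complex.add_im, Complex.sub_re, Complex.sub_im,
      Complex.mul_re, Complex.mul_im, Complex.one_re, Complex.one_im]; ring
  unfold AE KE
  rw [sm_split A (Nat.zero_le a) (hab.trans hb), sm_split A hab hb, sm_split K (Nat.zero_le a) hab,
    key]
  exact add_nonneg (add_nonneg (H.s9 le_rfl hb) (H.s10s hb)) (H.s10 le_rfl le_rfl)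

lemma oe_E2b (hu : 0 < u.im) (H : OddInv u m A K) {a b : ℕ} (hab : a < b) (hb : b ≤ m + 1) :
    0 ≤ br (AE u m A K a) (KE u m A K b) := by
  have key : ∀ L M X Q Y : ℂ,
      br ((u - 1) * (L + (X + Y)) + M + (X + Y)) ((u - 1) * (L + (X + Y)) + (M + Q))
      = br Y ((u - 1) * L) + br Y M + br (X - Q) ((u - 1) * L + M)
        + br ((X + Y) - Q) (u * (X + Y)) := by
    intros; simp only [br, Complex.add_re, Complex.add_im, Complex.sub_re, Complex.sub_im,
      Complex.mul_re, Complex.mul_im, Complex.one_re, Complex.one_im]; ring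
  unfold AE KE
  rw [sm_split A (Nat.zero_le a) (hab.le.trans hb), sm_split A hab.le hb,
    sm_split K (Nat.zero_le a) hab.le, key]
  have h1 := H.s5 (a := b) (b := m + 1) (c := 0) (d := a) hab.le le_rfl
  have h2 := H.s2 (a := b) (b := m + 1) (c := 0) (d := a) le_rfl (by omega)
  have h3 := H.s9 (a := a) (b := b) (c := 0) (d := a) le_rfl hb
  suffices 0 ≤ br (sm A a b + sm A b (m + 1) - sm K a b) (u * (sm A a b + sm A b (m + 1))) by
    linarith
  rw [← sm_split A hab.le hb]
  have h4 := br_self_mul_nonneg hu.le (sm A a (m + 1))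
  by_cases hc : br (sm K a b) (u * sm A a (m + 1)) ≤ 0
  · rw [br_sub_left]; linarith
  push Not at hc
  have h5 := H.s10s (a := a) (b := m + 1) le_rfl
  rw [sm_split K hab.le hb, br_sub_left, br_add_left] at h5
  suffices 0 ≤ br (sm K b (m + 1)) (u * sm A a (m + 1)) by
    rw [br_sub_left]; linarith
  rcases Nat.lt_or_ge m b with hb' | hb'
  · have : b = m + 1 := by omega
    subst this
    rw [sm_self, br_zero_left]
  have hb2 : 1 ≤ b - 1 := by
    by_contra hcon
    have hb1 : b = 0 + 1 := by omega
    have ha0 : a = 0 := by omega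
    subst ha0 hb1
    rw [sm_succ K le_rfl, sm_self, H.K0, add_zero, br_zero_left] at hc
    exact lt_irrefl _ hc
  have hpos : 0 < br (sm A a (m + 1)) (sm K a b) :=
    br_sm_pos a (b - 1) le_rfl (by omega) (by omega) (by omega)
      (fun i j _ _ _ _ => H.O2 i j (by omega) (by omega))
      (H.O2s a (b - 1) (by omega) hb2 (by omega))
  have hp := br_pluck (sm A a (m + 1)) (sm K b (m + 1)) (sm K a b) (u * sm A a (m + 1))
  have h6 := H.s2 (a := a) (b := m + 1) (c := b) (d := m + 1) le_rfl le_rfl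
  have h7 := H.s3 (a := b) (b := m + 1) (c := a) (d := b) le_rfl le_rfl
  have h8 : 0 ≤ br (sm A a (m + 1)) (sm K a b) * br (sm K b (m + 1)) (u * sm A a (m + 1)) := by
    rw [hp]; exact add_nonneg (mul_nonneg h6 hc.le) (mul_nonneg h4 h7)
  exact nonneg_of_mul_nonneg_right h8 hpos

lemma oe_E5 (hu : 0 < u.im) (H : OddInv u m A K) {i j : ℕ} (hi : i ≤ m + 1) (hj : j ≤ m + 1) :
    0 ≤ br (KE u m A K i) ((u - 1) * sm A j (m + 1)) := by
  unfold KE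
  rw [br_add_left, br_mul_mul, sm_split A (Nat.zero_le j) hj, br_add_left, br_self, add_zero]
  exact add_nonneg (mul_nonneg (Complex.normSq_nonneg _) (H.s1 le_rfl le_rfl)) (H.s6 hi le_rfl)

lemma oe_E6 (hu : 0 < u.im) (H : OddInv u m A K) {i l : ℕ} (hl : l < i) (hi : i ≤ m + 1) :
    0 ≤ br (AE u m A K i) ((u - 1) * sm A l (m + 1)) := by
  have h1 := oe_E5 hu H (i := i) (j := l) hi (by omega)
  unfold AE
  rw [br_add_left]
  refine add_nonneg h1 ?_
  rw [sm_split A hl.le hi, mul_add, br_add_right]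
  exact add_nonneg (H.s5 le_rfl le_rfl) (br_self_mul_nonneg (by simpa using hu.le) _)

lemma oe_E12 (hu : 0 < u.im) (H : OddInv u m A K) {i j : ℕ} (hij : i ≤ j) (hj : j ≤ m + 1) :
    0 ≤ br (u * sm A i (m + 1)) (AE u m A K j) + br (u * sm A j (m + 1)) (AE u m A K i) := by
  have key : ∀ L M X Q Y : ℂ,
      br (u * (X + Y)) ((u - 1) * (L + (X + Y)) + (M + Q) + Y)
      + br (u * Y) ((u - 1) * (L + (X + Y)) + M + (X + Y))
      = br (u * X) ((u - 1) * L + M) + 2 * br (u * Y) ((u - 1) * L + M)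
        + br (X - Q) (u * X) + br (u * Y) ((u - 1) * X + Q) := by
    intros; simp only [br, Complex.add_re, Complex.add_im, Complex.sub_re, Complex.sub_im,
      Complex.mul_re, Complex.mul_im, Complex.one_re, Complex.one_im]; ring
  unfold AE KE
  rw [sm_split A (Nat.zero_le i) (hij.trans hj), sm_split A hij hj, sm_split K (Nat.zero_le i) hij,
    key]
  have h1 := H.s14 (a := i) (b := j) (c := 0) (d := i) le_rfl hj
  have h2 := H.s14 (a := j) (b := m + 1) (c := 0) (d := i) hij le_rfl
  have h3 := H.s10s (a := i) (b := j) hj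
  have h4 := H.s14 (a := j) (b := m + 1) (c := i) (d := j) le_rfl le_rfl
  linarith

lemma oe_step (hu : 0 < u.im) (H : OddInv u m A K) : EvenInv u (m + 1) (AE u m A K) (KE u m A K) where
  hG := by
    refine ⟨sm A 0 (m + 1), H.Onz 0 (by omega), ?_, ?_⟩
    · unfold AE KE; rw [sm_self]; ring
    · unfold KE; rw [sm_self]; ring
  E1 i j h h' := oe_E1 hu H h.le h'
  E2 i j h h' := by
    rcases Nat.lt_or_ge i j with hc | hc
    · exact oe_E2b hu H hc h'
    · exact oe_E2a hu H hc h
  E3 i j h h' := by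
    have : KE u m A K j = KE u m A K i + sm K i j := by
      unfold KE; rw [sm_split K (Nat.zero_le i) h.le]; ring
    rw [this, br_add_left, br_self, zero_add]
    exact oe_E3 hu H h'
  E4 i j h h' := by
    rw [AE, add_sub_cancel_left]; exact oe_E4 hu H h h'
  E2s i h := oe_E2s hu H (by omega)
  E4s i h := by
    rw [AE, add_sub_cancel_left]; exact oe_E4s hu H (by omega)
  E5 i j h h' := by
    have e : AE u m A K j - KE u m A K j = sm A j (m + 1) := by rw [AE, add_sub_cancel_left]
    rw [e]; exact oe_E5 hu H h h'
  E6 i l h h' := by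
    have e : AE u m A K l - KE u m A K l = sm A l (m + 1) := by rw [AE, add_sub_cancel_left]
    rw [e]; exact oe_E6 hu H h h'
  E12 i j h h' := by
    have e : ∀ l, AE u m A K l - KE u m A K l = sm A l (m + 1) := by
      intro l; rw [AE, add_sub_cancel_left]
    rw [e, e]
    rcases le_total i j with hc | hc
    · exact oe_E12 hu H hc h'
    · rw [add_comm]; exact oe_E12 hu H hc h

lemma oe_FE (hu : 0 < u.im) (H : OddInv u m A K) {a b : ℕ} (hab : a ≤ b) (hb : b ≤ m + 1) :
    0 ≤ br (sm A a (m + 1) - sm A b (m + 1)) (AE u m A K a + AE u m A K b) ∧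
    0 ≤ br (u * (sm A a (m + 1) - sm A b (m + 1))) (AE u m A K a + AE u m A K b) ∧
    0 ≤ br (sm A a (m + 1) + sm A b (m + 1)) (AE u m A K a + AE u m A K b) ∧
    0 ≤ br (u * (sm A a (m + 1) + sm A b (m + 1))) (AE u m A K a + AE u m A K b) := by
  unfold AE KE
  rw [sm_split A (Nat.zero_le a) (hab.trans hb), sm_split A hab hb, sm_split K (Nat.zero_le a) hab]
  have hv : 0 ≤ (u - 1).im := by simpa using hu.le
  have x5 := H.s5 (a := a) (b := b) (c := 0) (d := a) le_rfl hb
  have x2 := H.s2 (a := a) (b := b) (c := 0) (d := a) hb (by omega)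
  have x2' := H.s2 (a := a) (b := b) (c := a) (d := b) hb hb
  have xu := br_self_mul_nonneg hu.le (sm A a b)
  have xv := br_self_mul_nonneg hv (sm A a b)
  have x15 := H.s15 (a := a) (b := b) (c := b) (d := m + 1) le_rfl le_rfl
  have x1 := H.s1 (a := a) (b := b) (c := b) (d := m + 1) le_rfl le_rfl
  have x14 := H.s14 (a := a) (b := b) (c := 0) (d := a) le_rfl hb
  have x10 := H.s10s (a := a) (b := b) hb
  have y5 := H.s5 (a := b) (b := m + 1) (c := 0) (d := a) hab le_rfl
  have y5' := H.s5 (a := b) (b := m + 1) (c := a) (d := b) le_rfl le_rfl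
  have y2 := H.s2 (a := b) (b := m + 1) (c := 0) (d := a) le_rfl (by omega)
  have y2' := H.s2 (a := b) (b := m + 1) (c := a) (d := b) le_rfl hb
  have y14 := H.s14 (a := b) (b := m + 1) (c := 0) (d := a) hab le_rfl
  have y14' := H.s14 (a := b) (b := m + 1) (c := a) (d := b) le_rfl le_rfl
  have yv := br_self_mul_nonneg hv (sm A b (m + 1))
  have xyv := br_self_mul_nonneg hv (sm A a b + sm A b (m + 1))
  have xu1 := br_mul_mul_nonneg u x1
  generalize sm A 0 a = L at *
  generalize sm A a b = X at *
  generalize sm A b (m + 1) = Y at *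
  generalize sm K 0 a = M at *
  generalize sm K a b = Q at *
  refine ⟨?_, ?_, ?_, ?_⟩
  · have key : br (X + Y - Y) ((u - 1) * (L + (X + Y)) + M + (X + Y) +
        ((u - 1) * (L + (X + Y)) + (M + Q) + Y)) = 2 * br X ((u - 1) * L) + 2 * br X M
        + br X (u * X) + br X ((u - 1) * X) + 2 * br X (u * Y) + br X Q := by
      simp only [br, Complex.add_re, Complex.add_im, Complex.sub_re, Complex.sub_im,
        Complex.mul_re, Complex.mul_im, Complex.one_re, Complex.one_im]; ring
    rw [key]; linarith
  · have key : br (u * (X + Y - Y)) ((u - 1) * (L + (X + Y)) + M + (X + Y) +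
        ((u - 1) * (L + (X + Y)) + (M + Q) + Y)) = 2 * br (u * X) ((u - 1) * L + M)
        + 2 * br (u * X) (u * Y) + br (X - Q) (u * X) := by
      simp only [br, Complex.add_re, Complex.add_im, Complex.sub_re, Complex.sub_im,
        Complex.mul_re, Complex.mul_im, Complex.one_re, Complex.one_im]; ring
    rw [key]; linarith
  · have key : br (X + Y + Y) ((u - 1) * (L + (X + Y)) + M + (X + Y) +
        ((u - 1) * (L + (X + Y)) + (M + Q) + Y)) = 2 * br X ((u - 1) * L) + 2 * br X M
        + br X Q + 4 * br Y ((u - 1) * L) + 4 * br Y M + 2 * br Y Q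
        + 2 * br (X + Y) ((u - 1) * (X + Y)) + 2 * br Y ((u - 1) * X) + 2 * br Y ((u - 1) * Y) := by
      simp only [br, Complex.add_re, Complex.add_im, Complex.sub_re, Complex.sub_im,
        Complex.mul_re, Complex.mul_im, Complex.one_re, Complex.one_im]; ring
    rw [key]; linarith
  · have key : br (u * (X + Y + Y)) ((u - 1) * (L + (X + Y)) + M + (X + Y) +
        ((u - 1) * (L + (X + Y)) + (M + Q) + Y)) = 2 * br (u * X) ((u - 1) * L + M)
        + 4 * br (u * Y) ((u - 1) * L + M) + br (X - Q) (u * X)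
        + 2 * br (u * Y) ((u - 1) * X + Q) := by
      simp only [br, Complex.add_re, Complex.add_im, Complex.sub_re, Complex.sub_im,
        Complex.mul_re, Complex.mul_im, Complex.one_re, Complex.one_im]; ring
    rw [key]; linarith

end


namespace EvenInv
variable {u : ℂ} {m : ℕ} {A K : ℕ → ℂ} {a b c d : ℕ}

lemma t1 (H : EvenInv u m A K) (hbc : b ≤ c) (hd : d ≤ m + 1) : 0 ≤ br (sm A a b) (sm A c d) :=
  br_sm fun i j _ _ _ _ => H.E1 i j (by omega) (by omega)
lemma t2 (H : EvenInv u m A K) (hb : b ≤ m + 1) (hd : d ≤ m + 1) :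
    0 ≤ br (sm A a b) (sm K c d) :=
  br_sm fun i j _ _ _ _ => H.E2 i j (by omega) (by omega)
lemma t3 (H : EvenInv u m A K) (hda : d ≤ a) (hb : b ≤ m + 1) : 0 ≤ br (sm K a b) (sm K c d) :=
  br_sm fun i j _ _ _ _ => H.E3 j i (by omega) (by omega)
lemma t4 (H : EvenInv u m A K) (hb : b ≤ m + 1) (hd : d ≤ m + 1) :
    0 ≤ br (sm A a b - sm K a b) (sm K c d) := by
  rw [← sm_sub]
  exact br_sm fun i j _ _ _ _ => H.E4 i j (by omega) (by omega)
lemma t5 (H : EvenInv u m A K) (hb : b ≤ m + 1) (hd : d ≤ m + 1) :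
    0 ≤ br (sm K a b) ((u - 1) * (sm A c d - sm K c d)) := by
  rw [← sm_sub, ← sm_mul]
  exact br_sm fun i j _ _ _ _ => H.E5 i j (by omega) (by omega)
lemma t6 (H : EvenInv u m A K) (hda : d ≤ a) (hb : b ≤ m + 1) :
    0 ≤ br (sm A a b) ((u - 1) * (sm A c d - sm K c d)) := by
  rw [← sm_sub, ← sm_mul]
  exact br_sm fun i j _ _ _ _ => H.E6 i j (by omega) (by omega)
lemma t12 (H : EvenInv u m A K) (hb : b ≤ m + 1) :
    0 ≤ br (u * (sm A a b - sm K a b)) (sm A a b) := by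
  rw [← sm_sub, ← sm_mul]
  exact br_sm_sym fun i j _ _ _ _ => H.E12 i j (by omega) (by omega)

lemma A0A (H : EvenInv u m A K) {j : ℕ} (hj : j ≤ m) : 0 ≤ br (A 0) (A j) := by
  rcases Nat.eq_zero_or_pos j with rfl | h
  · rw [br_self]
  · exact H.E1 0 j h hj
lemma KK0 (H : EvenInv u m A K) {j : ℕ} (hj : j ≤ m) : 0 ≤ br (K j) (K 0) := by
  rcases Nat.eq_zero_or_pos j with rfl | h
  · rw [br_self]
  · exact H.E3 0 j h hj

lemma arcAA (H : EvenInv u m A K) (hu : 0 < u.im) {i j : ℕ} (h : i < j) (hj : j ≤ m) :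
    0 ≤ br (A j) ((u - 1) * A i) ∧ 0 ≤ br (A i) (u * A j) ∧
      0 ≤ br (u * A j) ((u - 1) * A i) := by
  obtain ⟨G, hG, e1, e2⟩ := H.hG
  apply arc_lemma hu hG
  · rw [← e1]; exact H.A0A hj
  · rw [← e2]; exact H.E2 _ _ hj (Nat.zero_le _)
  · rw [← e1]; exact H.A0A (by omega)
  · rw [← e2]; exact H.E2 _ _ (by omega) (Nat.zero_le _)
  · exact H.E1 _ _ h hj

lemma arcAK (H : EvenInv u m A K) (hu : 0 < u.im) {i j : ℕ} (hi : i ≤ m) (hj : j ≤ m) :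
    0 ≤ br (K j) ((u - 1) * A i) ∧ 0 ≤ br (A i) (u * K j) ∧
      0 ≤ br (u * K j) ((u - 1) * A i) := by
  obtain ⟨G, hG, e1, e2⟩ := H.hG
  apply arc_lemma hu hG
  · rw [← e1]; exact H.E2 _ _ (Nat.zero_le _) hj
  · rw [← e2]; exact H.KK0 hj
  · rw [← e1]; exact H.A0A hi
  · rw [← e2]; exact H.E2 _ _ hi (Nat.zero_le _)
  · exact H.E2 _ _ hi hj

lemma arcKK (H : EvenInv u m A K) (hu : 0 < u.im) {i j : ℕ} (h : i < j) (hj : j ≤ m) :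
    0 ≤ br (K i) ((u - 1) * K j) ∧ 0 ≤ br (K j) (u * K i) ∧
      0 ≤ br (u * K i) ((u - 1) * K j) := by
  obtain ⟨G, hG, e1, e2⟩ := H.hG
  apply arc_lemma hu hG
  · rw [← e1]; exact H.E2 _ _ (Nat.zero_le _) (by omega)
  · rw [← e2]; exact H.KK0 (by omega)
  · rw [← e1]; exact H.E2 _ _ (Nat.zero_le _) hj
  · rw [← e2]; exact H.KK0 hj
  · exact H.E3 _ _ h hj

lemma lAA1 (H : EvenInv u m A K) (hu : 0 < u.im) (hda : d ≤ a) (hb : b ≤ m + 1) :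
    0 ≤ br (sm A a b) ((u - 1) * sm A c d) := by
  rw [← sm_mul]
  exact br_sm fun i j _ _ _ _ => (H.arcAA hu (by omega) (by omega)).1
lemma lAA2 (H : EvenInv u m A K) (hu : 0 < u.im) (hbc : b ≤ c) (hd : d ≤ m + 1) :
    0 ≤ br (sm A a b) (u * sm A c d) := by
  rw [← sm_mul]
  exact br_sm fun i j _ _ _ _ => (H.arcAA hu (by omega) (by omega)).2.1
lemma lAA3 (H : EvenInv u m A K) (hu : 0 < u.im) (hda : d ≤ a) (hb : b ≤ m + 1) :
    0 ≤ br (u * sm A a b) ((u - 1) * sm A c d) := by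
  rw [← sm_mul, ← sm_mul]
  exact br_sm fun i j _ _ _ _ => (H.arcAA hu (by omega) (by omega)).2.2
lemma lAK1 (H : EvenInv u m A K) (hu : 0 < u.im) (hb : b ≤ m + 1) (hd : d ≤ m + 1) :
    0 ≤ br (sm K a b) ((u - 1) * sm A c d) := by
  rw [← sm_mul]
  exact br_sm fun i j _ _ _ _ => (H.arcAK hu (by omega) (by omega)).1
lemma lAK2 (H : EvenInv u m A K) (hu : 0 < u.im) (hb : b ≤ m + 1) (hd : d ≤ m + 1) :
    0 ≤ br (sm A a b) (u * sm K c d) := by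
  rw [← sm_mul]
  exact br_sm fun i j _ _ _ _ => (H.arcAK hu (by omega) (by omega)).2.1
lemma lAK3 (H : EvenInv u m A K) (hu : 0 < u.im) (hb : b ≤ m + 1) (hd : d ≤ m + 1) :
    0 ≤ br (u * sm K a b) ((u - 1) * sm A c d) := by
  rw [← sm_mul, ← sm_mul]
  exact br_sm fun i j _ _ _ _ => (H.arcAK hu (by omega) (by omega)).2.2
lemma lKK1 (H : EvenInv u m A K) (hu : 0 < u.im) (hbc : b ≤ c) (hd : d ≤ m + 1) :
    0 ≤ br (sm K a b) ((u - 1) * sm K c d) := by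
  rw [← sm_mul]
  exact br_sm fun i j _ _ _ _ => (H.arcKK hu (by omega) (by omega)).1

end EvenInv

/-- The `K`-part of the even to odd step. -/
def KO (K : ℕ → ℂ) (j : ℕ) : ℂ := sm K 0 j

/-- The `A`-part of the even to odd step. -/
def AO (m : ℕ) (A K : ℕ → ℂ) (j : ℕ) : ℂ := sm A j (m + 1) + sm K 0 j

lemma AO_sub_KO (m : ℕ) (A K : ℕ → ℂ) (j : ℕ) : AO m A K j - KO K j = sm A j (m + 1) := by
  unfold AO KO; ring

section
variable {u : ℂ} {m : ℕ} {A K : ℕ → ℂ}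

lemma eo_O1 (H : EvenInv u m A K) {a b : ℕ} (hab : a ≤ b) (hb : b ≤ m) :
    0 ≤ br (AO m A K a) (AO m A K b) := by
  have key : ∀ P Q R T : ℂ, br (P + Q + T) (Q + (T + R))
      = br P Q + br P R + br Q R + br (P - R) T := by
    intros; simp only [br, Complex.add_re, Complex.add_im, Complex.sub_re, Complex.sub_im]; ring
  unfold AO
  rw [sm_split A hab (by omega : b ≤ m + 1), sm_split K (Nat.zero_le a) hab, key]
  have h1 := H.t1 (a := a) (b := b) (c := b) (d := m + 1) le_rfl le_rfl
  have h2 := H.t2 (a := a) (b := b) (c := a) (d := b) (by omega) (by omega)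
  have h3 := H.t2 (a := b) (b := m + 1) (c := a) (d := b) (by omega) (by omega)
  have h4 := H.t4 (a := a) (b := b) (c := 0) (d := a) (by omega) (by omega)
  linarith

lemma eo_key2a (P R T : ℂ) : br (P + (T + R)) T = br P T + br R T := by
  simp only [br, Complex.add_re, Complex.add_im]; ring

lemma eo_key2b (P Q R T : ℂ) : br (P + Q + T) (T + R)
    = br P R + br Q T + br Q R + br (P - R) T := by
  simp only [br, Complex.add_re, Complex.add_im, Complex.sub_re, Complex.sub_im]; ring

lemma eo_O2 (H : EvenInv u m A K) {a b : ℕ} (ha : a ≤ m) (hb : b ≤ m) :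
    0 ≤ br (AO m A K a) (KO K b) := by
  unfold AO KO
  rcases le_total b a with hab | hab
  · rw [sm_split K (Nat.zero_le b) hab, eo_key2a]
    exact add_nonneg (H.t2 (by omega) (by omega)) (H.t3 le_rfl (by omega))
  · rw [sm_split A hab (by omega : b ≤ m + 1), sm_split K (Nat.zero_le a) hab, eo_key2b]
    exact add_nonneg (add_nonneg (add_nonneg (H.t2 (by omega) (by omega))
      (H.t2 (by omega) (by omega))) (H.t2 (by omega) (by omega))) (H.t4 (by omega) (by omega))

lemma eo_O2s (H : EvenInv u m A K) {a b : ℕ} (ha : a < m) (hb1 : 1 ≤ b) (hb : b ≤ m) :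
    0 < br (AO m A K a) (KO K b) := by
  unfold AO KO
  rcases Nat.lt_or_ge a b with hab | hab
  · rw [sm_split A hab.le (by omega : b ≤ m + 1), sm_split K (Nat.zero_le a) hab.le, eo_key2b]
    have h1 := H.t2 (a := a) (b := b) (c := a) (d := b) (by omega) (by omega)
    have h2 := H.t2 (a := b) (b := m + 1) (c := 0) (d := a) (by omega) (by omega)
    have h3 := H.t2 (a := b) (b := m + 1) (c := a) (d := b) (by omega) (by omega)
    have h4 := H.t4 (a := a) (b := b) (c := 0) (d := a) (by omega) (by omega)
    rcases Nat.eq_zero_or_pos a with rfl | ha0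
    · have : 0 < br (sm A 0 b) (sm K 0 b) :=
        br_sm_pos 0 0 le_rfl hab le_rfl hab
          (fun i j _ _ _ _ => H.E2 i j (by omega) (by omega)) (H.E2s 0 ha)
      linarith
    · have : 0 < br (sm A a b - sm K a b) (sm K 0 a) := by
        rw [← sm_sub]
        exact br_sm_pos a 0 le_rfl hab le_rfl ha0
          (fun i j _ _ _ _ => H.E4 i j (by omega) (by omega)) (H.E4s a ha)
      linarith
  · rw [sm_split K (Nat.zero_le b) hab, eo_key2a]
    refine add_pos_of_pos_of_nonneg ?_ (H.t3 le_rfl (by omega))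
    exact br_sm_pos a 0 le_rfl (by omega) le_rfl (by omega)
      (fun i j _ _ _ _ => H.E2 i j (by omega) (by omega)) (H.E2s a ha)

lemma eo_O5' (H : EvenInv u m A K) {i l : ℕ} (hl : l ≤ i) (hi : i ≤ m) :
    br (AO m A K i) ((u - 1) * AO m A K i) ≤ br (AO m A K i) ((u - 1) * AO m A K l) := by
  have e : AO m A K l = AO m A K i + (sm A l i - sm K l i) := by
    unfold AO
    rw [sm_split A hl (by omega : i ≤ m + 1), sm_split K (Nat.zero_le l) hl]; ring
  rw [e, mul_add, br_add_right]
  have h1 := H.t6 (a := i) (b := m + 1) (c := l) (d := i) le_rfl le_rfl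
  have h2 := H.t5 (a := 0) (b := i) (c := l) (d := i) (by omega) (by omega)
  have h3 : br (AO m A K i) ((u - 1) * (sm A l i - sm K l i))
      = br (sm A i (m + 1)) ((u - 1) * (sm A l i - sm K l i))
        + br (sm K 0 i) ((u - 1) * (sm A l i - sm K l i)) := by
    rw [AO, br_add_left]
  linarith

lemma eo_O5 (H : EvenInv u m A K) (hu : 0 < u.im) {i l : ℕ} (hl : l ≤ i) (hi : i ≤ m) :
    0 ≤ br (AO m A K i) ((u - 1) * AO m A K l) :=
  (br_self_mul_nonneg (by simpa using hu.le) _).trans (eo_O5' H hl hi)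

lemma eo_A0 (H : EvenInv u m A K) (hm : 1 ≤ m) {j : ℕ} (hj : j ≤ m) :
    0 ≤ br (A 0) (AO m A K j) ∧ (1 ≤ j → 0 < br (A 0) (AO m A K j)) := by
  have h1 := H.t1 (a := 0) (b := 1) (c := max 1 j) (d := m + 1) (by omega) le_rfl
  have e1 : sm A 0 1 = A 0 := by simp [sm]
  have hA : 0 ≤ br (A 0) (sm A j (m + 1)) := by
    rcases Nat.eq_zero_or_pos j with rfl | h
    · rw [sm_split A (Nat.zero_le 1) (by omega), br_add_right, e1, br_self, zero_add]
      simpa [e1] using h1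
    · rw [max_eq_right h, e1] at h1; exact h1
  have hK := H.t2 (a := 0) (b := 1) (c := 0) (d := j) (by omega) (by omega)
  rw [e1] at hK
  unfold AO
  rw [br_add_right]
  refine ⟨by linarith, fun h => ?_⟩
  have hKp : 0 < br (sm A 0 1) (sm K 0 j) :=
    br_sm_pos 0 0 le_rfl (by omega) le_rfl (by omega)
      (fun i j _ _ _ _ => H.E2 i j (by omega) (by omega)) (H.E2s 0 hm)
  rw [e1] at hKp
  linarith

lemma eo_O6 (H : EvenInv u m A K) (hu : 0 < u.im) {i l : ℕ} (hi : i ≤ m) (hl : l ≤ m) :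
    0 ≤ br (KO K i) ((u - 1) * AO m A K l) := by
  have hv : 0 ≤ (u - 1).im := by simpa using hu.le
  unfold AO KO
  rcases le_total i l with h | h
  · rw [sm_split K (Nat.zero_le i) h, mul_add, mul_add, br_add_right, br_add_right]
    exact add_nonneg (H.lAK1 hu (by omega) (by omega))
      (add_nonneg (br_self_mul_nonneg hv _) (H.lKK1 hu le_rfl (by omega)))
  · have e : (u - 1) * (sm A l (m + 1) + sm K 0 l)
        = (u - 1) * (sm A l i - sm K l i) + (u - 1) * sm K 0 i + (u - 1) * sm A i (m + 1) := by
      rw [sm_split A h (by omega : i ≤ m + 1), sm_split K (Nat.zero_le l) h]; ring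
    rw [e, br_add_right, br_add_right]
    exact add_nonneg (add_nonneg (H.t5 (by omega) (by omega)) (br_self_mul_nonneg hv _))
      (H.lAK1 hu (by omega) (by omega))

lemma eo_O9 (H : EvenInv u m A K) (hu : 0 < u.im) {i l : ℕ} (hl : l ≤ i) (hi : i ≤ m) :
    0 ≤ br (sm A i (m + 1)) ((u - 1) * AO m A K l + KO K l) := by
  have hv : 0 ≤ (u - 1).im := by simpa using hu.le
  have e : (u - 1) * AO m A K l + KO K l
      = (u - 1) * sm A l i + (u - 1) * sm A i (m + 1) + u * sm K 0 l := by
    unfold AO KO; rw [sm_split A hl (by omega : i ≤ m + 1)]; ring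
  rw [e, br_add_right, br_add_right]
  exact add_nonneg (add_nonneg (H.lAA1 hu le_rfl le_rfl) (br_self_mul_nonneg hv _))
    (H.lAK2 hu le_rfl (by omega))

lemma eo_O10 (H : EvenInv u m A K) (hu : 0 < u.im) {i l : ℕ} (hl : i ≤ l) (hi : l ≤ m) :
    0 ≤ br (sm A i (m + 1)) (u * AO m A K l) := by
  have h0 := H.lAK2 hu (a := i) (b := m + 1) (c := 0) (d := l) le_rfl (by omega)
  unfold AO
  rw [mul_add, br_add_right]
  refine add_nonneg ?_ h0
  rw [sm_split A hl (by omega : l ≤ m + 1), br_add_left]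
  exact add_nonneg (H.lAA2 hu le_rfl le_rfl) (br_self_mul_nonneg hu.le _)

lemma eo_O10s (H : EvenInv u m A K) (hu : 0 < u.im) {i j : ℕ} (hij : i ≤ j) (hj : j ≤ m) :
    0 ≤ br (sm A i (m + 1)) (u * AO m A K j) + br (sm A j (m + 1)) (u * AO m A K i) := by
  have key : ∀ X Y T R : ℂ, br (X + Y) (u * (Y + (T + R))) + br Y (u * (X + Y + T))
      = br (X + Y) (u * (X + Y)) + br Y (u * Y) + br (u * (X - R)) X + br Y (u * R)
        + br X (u * T) + 2 * br Y (u * T) := by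
    intros; simp only [br, Complex.add_re, Complex.add_im, Complex.sub_re, Complex.sub_im,
      Complex.mul_re, Complex.mul_im]; ring
  unfold AO
  rw [sm_split A hij (by omega : j ≤ m + 1), sm_split K (Nat.zero_le i) hij, key]
  have h1 := br_self_mul_nonneg hu.le (sm A i j + sm A j (m + 1))
  have h2 := br_self_mul_nonneg hu.le (sm A j (m + 1))
  have h3 := H.t12 (a := i) (b := j) (by omega)
  have h4 := H.lAK2 hu (a := j) (b := m + 1) (c := i) (d := j) le_rfl (by omega)
  have h5 := H.lAK2 hu (a := i) (b := j) (c := 0) (d := i) (by omega) (by omega)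
  have h6 := H.lAK2 hu (a := j) (b := m + 1) (c := 0) (d := i) le_rfl (by omega)
  linarith

lemma eo_O14 (H : EvenInv u m A K) (hu : 0 < u.im) {i l : ℕ} (hl : l ≤ i) (hi : i ≤ m) :
    0 ≤ br (u * AO m A K i) ((u - 1) * AO m A K l + KO K l) := by
  have key : ∀ X Y T R : ℂ, br (u * (Y + (T + R))) ((u - 1) * (X + Y + T) + T)
      = br (u * Y) ((u - 1) * X) + Complex.normSq Y * u.im + br (u * Y) (u * T)
        + br (u * T) ((u - 1) * X) + br (u * T) ((u - 1) * Y)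
        + br (u * R) ((u - 1) * X) + br (u * R) ((u - 1) * Y) + br (u * R) (u * T) := by
    intros; simp only [br, Complex.add_re, Complex.add_im, Complex.sub_re, Complex.sub_im,
      Complex.mul_re, Complex.mul_im, Complex.one_re, Complex.one_im, Complex.normSq_apply]; ring
  unfold AO KO
  rw [sm_split A hl (by omega : i ≤ m + 1), sm_split K (Nat.zero_le l) hl, key]
  have h1 := H.lAA3 hu (a := i) (b := m + 1) (c := l) (d := i) le_rfl le_rfl
  have h2 := mul_nonneg (Complex.normSq_nonneg (sm A i (m + 1))) hu.le
  have h3 := br_mul_mul_nonneg u (H.t2 (a := i) (b := m + 1) (c := 0) (d := l) le_rfl (by omega))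
  have h4 := H.lAK3 hu (a := 0) (b := l) (c := l) (d := i) (by omega) (by omega)
  have h5 := H.lAK3 hu (a := 0) (b := l) (c := i) (d := m + 1) (by omega) (by omega)
  have h6 := H.lAK3 hu (a := l) (b := i) (c := l) (d := i) (by omega) (by omega)
  have h7 := H.lAK3 hu (a := l) (b := i) (c := i) (d := m + 1) (by omega) (by omega)
  have h8 := br_mul_mul_nonneg u (H.t3 (a := l) (b := i) (c := 0) (d := l) le_rfl (by omega))
  linarith

lemma eo_O15 (H : EvenInv u m A K) (hu : 0 < u.im) (hm : 1 ≤ m) {i l : ℕ} (hl : i < l)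
    (hi : l ≤ m) : 0 ≤ br (AO m A K i) (u * AO m A K l) := by
  have hp := br_pluck (AO m A K i) (AO m A K l) (u * AO m A K l) ((u - 1) * AO m A K 0)
  have h1 := eo_O1 H hl.le hi
  have h2 := eo_O14 H hu (Nat.zero_le l) hi
  have hK0 : KO K 0 = 0 := by unfold KO; exact sm_self _ _
  rw [hK0, add_zero] at h2
  have h3 := eo_O5 H hu (Nat.zero_le i) (by omega)
  have h4 := br_self_mul_nonneg hu.le (AO m A K l)
  have hne : AO m A K l ≠ 0 := by
    intro h0
    have := (eo_A0 H hm hi).2 (by omega)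
    rw [h0, br_zero_right] at this
    exact lt_irrefl _ this
  have h5 : 0 < br (AO m A K l) ((u - 1) * AO m A K 0) :=
    lt_of_lt_of_le (br_self_mul_pos (by simpa using hu) hne) (eo_O5' H (Nat.zero_le l) hi)
  have h6 : 0 ≤ br (AO m A K i) (u * AO m A K l) * br (AO m A K l) ((u - 1) * AO m A K 0) := by
    rw [hp]; exact add_nonneg (mul_nonneg h1 h2) (mul_nonneg h3 h4)
  exact nonneg_of_mul_nonneg_left h6 h5

lemma eo_step (H : EvenInv u m A K) (hu : 0 < u.im) (hm : 1 ≤ m) :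
    OddInv u m (AO m A K) (KO K) where
  K0 := by unfold KO; exact sm_self _ _
  O1 i j h h' := eo_O1 H h.le h'
  O2 i j h h' := eo_O2 H h h'
  O2s i j h h1 h' := eo_O2s H h h1 h'
  O3 i j h h' := by
    unfold KO
    rw [sm_split K (Nat.zero_le i) h.le, br_add_left, br_self, zero_add]
    exact H.t3 le_rfl (by omega)
  O4 i j h h' := by
    rw [AO_sub_KO]; exact H.t2 le_rfl (by omega)
  O5 i l h h' := eo_O5 H hu h.le h'
  O6 i l h h' := eo_O6 H hu h h'
  O9 i l h h' := by rw [AO_sub_KO]; exact eo_O9 H hu h.le h'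
  O10 i l h h' := by rw [AO_sub_KO]; exact eo_O10 H hu h.le h'
  O10s i j h h' := by
    rw [AO_sub_KO, AO_sub_KO]
    rcases le_total i j with hc | hc
    · exact eo_O10s H hu hc h'
    · rw [add_comm]; exact eo_O10s H hu hc h
  O14 i l h h' := eo_O14 H hu h.le h'
  O15 i l h h' := eo_O15 H hu hm h h'
  Onz a h := by
    intro h0
    have : 0 < br (sm A 0 1) (sm (AO m A K) a (m + 1)) := by
      refine br_sm_pos 0 m le_rfl (by omega) h (by omega) (fun i j _ _ _ _ => ?_) ?_
      · have : i = 0 := by omega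
        subst this
        exact (eo_A0 H hm (by omega)).1
      · exact (eo_A0 H hm le_rfl).2 hm
    rw [h0, br_zero_right] at this
    exact lt_irrefl _ this

lemma eo_FO (H : EvenInv u m A K) (hu : 0 < u.im) {a b : ℕ} (hab : a ≤ b) (hb : b ≤ m) :
    0 ≤ br (sm A a (m + 1) - sm A b (m + 1)) (AO m A K a + AO m A K b) ∧
    0 ≤ br (sm A a (m + 1) - sm A b (m + 1)) (u * (AO m A K a + AO m A K b)) ∧
    0 ≤ br (sm A a (m + 1) + sm A b (m + 1)) (AO m A K a + AO m A K b) ∧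
    0 ≤ br (sm A a (m + 1) + sm A b (m + 1)) (u * (AO m A K a + AO m A K b)) := by
  unfold AO
  rw [sm_split A hab (by omega : b ≤ m + 1), sm_split K (Nat.zero_le a) hab]
  have x1 := H.t1 (a := a) (b := b) (c := b) (d := m + 1) le_rfl le_rfl
  have x2 := H.t2 (a := a) (b := b) (c := 0) (d := a) (by omega) (by omega)
  have x3 := H.t2 (a := a) (b := b) (c := a) (d := b) (by omega) (by omega)
  have x4 := br_self_mul_nonneg hu.le (sm A a b)
  have x5 := H.lAA2 hu (a := a) (b := b) (c := b) (d := m + 1) le_rfl le_rfl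
  have x6 := H.lAK2 hu (a := a) (b := b) (c := 0) (d := a) (by omega) (by omega)
  have x7 := H.lAK2 hu (a := a) (b := b) (c := a) (d := b) (by omega) (by omega)
  have y2 := H.t2 (a := b) (b := m + 1) (c := 0) (d := a) (by omega) (by omega)
  have y3 := H.t2 (a := b) (b := m + 1) (c := a) (d := b) (by omega) (by omega)
  have y4 := br_self_mul_nonneg hu.le (sm A a b + sm A b (m + 1) + sm A b (m + 1))
  have y6 := H.lAK2 hu (a := b) (b := m + 1) (c := 0) (d := a) (by omega) (by omega)
  have y7 := H.lAK2 hu (a := b) (b := m + 1) (c := a) (d := b) (by omega) (by omega)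
  generalize sm A a b = X at *
  generalize sm A b (m + 1) = Y at *
  generalize sm K 0 a = T at *
  generalize sm K a b = R at *
  refine ⟨?_, ?_, ?_, ?_⟩
  · have key : br (X + Y - Y) (X + Y + T + (Y + (T + R)))
        = 2 * br X Y + 2 * br X T + br X R := by
      simp only [br, Complex.add_re, Complex.add_im, Complex.sub_re, Complex.sub_im]; ring
    rw [key]; linarith
  · have key : br (X + Y - Y) (u * (X + Y + T + (Y + (T + R))))
        = br X (u * X) + 2 * br X (u * Y) + 2 * br X (u * T) + br X (u * R) := by
      simp only [br, Complex.add_re, Complex.add_im, Complex.sub_re, Complex.sub_im,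
        Complex.mul_re, Complex.mul_im]; ring
    rw [key]; linarith
  · have key : br (X + Y + Y) (X + Y + T + (Y + (T + R)))
        = 2 * br X T + br X R + 4 * br Y T + 2 * br Y R := by
      simp only [br, Complex.add_re, Complex.add_im]; ring
    rw [key]; linarith
  · have key : br (X + Y + Y) (u * (X + Y + T + (Y + (T + R))))
        = br (X + Y + Y) (u * (X + Y + Y)) + 2 * br X (u * T) + br X (u * R)
          + 4 * br Y (u * T) + 2 * br Y (u * R) := by
      simp only [br, Complex.add_re, Complex.add_im,
        Complex.mul_re, Complex.mul_im]; ring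
    rw [key]; linarith

/-- Positive rescaling of the even invariants. -/
lemma even_scale (H : EvenInv u m A K) (c : ℕ → ℝ) (hc : ∀ i, 0 < c i)
    (hc0 : c 0 = 1) :
    EvenInv u m (fun i => (c i : ℂ) * A i) (fun i => (c i : ℂ) * K i) := by
  have e2 : ∀ i j (w x y : ℂ), br ((c i : ℂ) * x) (w * ((c j : ℂ) * y))
      = c i * c j * br x (w * y) := by
    intro i j w x y
    rw [← br_real_mul]; congr 1; ring
  have e3 : ∀ i j (w x y : ℂ), br (w * ((c i : ℂ) * x)) ((c j : ℂ) * y)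
      = c i * c j * br (w * x) y := by
    intro i j w x y
    rw [← br_real_mul]; congr 1; ring
  have p : ∀ i j, 0 ≤ c i * c j := fun i j => (mul_pos (hc i) (hc j)).le
  have p' : ∀ i j, 0 < c i * c j := fun i j => mul_pos (hc i) (hc j)
  constructor
  · obtain ⟨G, h1, h2, h3⟩ := H.hG
    exact ⟨G, h1, by simp [hc0, h2], by simp [hc0, h3]⟩
  · intro i j h h'
    simp only [br_real_mul]
    exact mul_nonneg (p _ _) (H.E1 i j h h')
  · intro i j h h'
    simp only [br_real_mul]
    exact mul_nonneg (p _ _) (H.E2 i j h h')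
  · intro i j h h'
    simp only [br_real_mul]
    exact mul_nonneg (p _ _) (H.E3 i j h h')
  · intro i j h h'
    simp only [← mul_sub, br_real_mul]
    exact mul_nonneg (p _ _) (H.E4 i j h h')
  · intro i h
    simp only [br_real_mul]
    exact mul_pos (p' _ _) (H.E2s i h)
  · intro i h
    simp only [← mul_sub, br_real_mul]
    exact mul_pos (p' _ _) (H.E4s i h)
  · intro i j h h'
    simp only [← mul_sub, e2]
    exact mul_nonneg (p _ _) (H.E5 i j h h')
  · intro i j h h'
    simp only [← mul_sub, e2]
    exact mul_nonneg (p _ _) (H.E6 i j h h')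
  · intro i j h h'
    simp only [← mul_sub, e3]
    rw [mul_comm (c j) (c i), ← mul_add]
    exact mul_nonneg (p _ _) (H.E12 i j h h')

end

/-- Base case of the odd invariants. -/
lemma odd_base {u : ℂ} (hu : 0 < u.im) : OddInv u 0 (fun _ => 1) (fun _ => 0) := by
  constructor
  · rfl
  all_goals first
    | (intro i j h h'; omega)
    | (intro i j h h'; simp [br]; done)
    | skip
  · intro i j h h'
    simp [br]; exact hu.le
  · intro a h
    have : a = 0 := by omega
    subst this
    simp [sm]


/-- Values of the polynomials `E_j^n` at `x`, by recursion. -/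
noncomputable def ev (x : ℂ) : ℕ → ℕ → ℂ
  | 0, _ => 1
  | n + 1, j => x * sm (ev x n) 0 (n + 1) + sm (ev x n) j (n + 1)

lemma ev_succ (x : ℂ) (n j : ℕ) :
    ev x (n + 1) j = x * sm (ev x n) 0 (n + 1) + sm (ev x n) j (n + 1) := rfl

/-- The basic interlacing invariants. -/
structure PInv (x : ℂ) (n : ℕ) (e : ℕ → ℂ) : Prop where
  h0 : e 0 ≠ 0
  h1 : ∀ i j, i < j → j ≤ n → 0 < br (e i) (e j)
  h2 : ∀ i j, i < j → j ≤ n → 0 ≤ br (e j) (x * e i)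
  h3 : ∀ i j, i < j → j ≤ n → 0 ≤ br (e i) ((x + 1) * e j)

lemma PInv.sm_ne {x : ℂ} {n : ℕ} {e : ℕ → ℂ} (H : PInv x n e) {a b : ℕ} (hab : a < b)
    (hb : b ≤ n + 1) : sm e a b ≠ 0 := by
  have e1 : sm e 0 1 = e 0 := by simp [sm]
  by_cases hc : a = 0 ∧ b = 1
  · obtain ⟨rfl, rfl⟩ := hc
    rw [e1]; exact H.h0
  · intro h0
    have : 0 < br (sm e 0 1) (sm e a b) := by
      refine br_sm_pos 0 (b - 1) le_rfl (by omega) (by omega) (by omega) (fun i j _ _ _ _ => ?_)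
        (H.h1 0 (b - 1) (by omega) (by omega))
      have : i = 0 := by omega
      subst this
      rcases Nat.eq_zero_or_pos j with rfl | h
      · rw [br_self]
      · exact (H.h1 0 j h (by omega)).le
    rw [h0, br_zero_right] at this
    exact lt_irrefl _ this

lemma pinv (x : ℂ) (hx : 0 < x.im) (n : ℕ) : PInv x n (ev x n) := by
  induction n with
  | zero =>
    refine ⟨by simp [ev], ?_, ?_, ?_⟩ <;> · intro i j h h'; omega
  | succ n H =>
    have hG : sm (ev x n) 0 (n + 1) ≠ 0 := H.sm_ne (by omega) le_rfl
    have key : ∀ a b c : ℂ, br (x * (a + (b + c)) + (b + c)) (x * (a + (b + c)) + c)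
        = br b (x * a) + br b (x * b) + br b ((x + 1) * c) := by
      intros; simp only [br, Complex.add_re, Complex.add_im,
        Complex.mul_re, Complex.mul_im, Complex.one_re, Complex.one_im]; ring
    have h1 : ∀ i j, i < j → j ≤ n + 1 → 0 < br (ev x (n + 1) i) (ev x (n + 1) j) := by
      intro i j hij hj
      rw [ev_succ, ev_succ, sm_split _ (Nat.zero_le i) (hij.le.trans hj), sm_split _ hij.le hj, key]
      have a1 : 0 ≤ br (sm (ev x n) i j) (x * sm (ev x n) 0 i) := by
        rw [← sm_mul]
        exact br_sm fun i' j' _ _ _ _ => H.h2 j' i' (by omega) (by omega)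
      have a2 : 0 < br (sm (ev x n) i j) (x * sm (ev x n) i j) :=
        br_self_mul_pos hx (H.sm_ne hij hj)
      have a3 : 0 ≤ br (sm (ev x n) i j) ((x + 1) * sm (ev x n) j (n + 1)) := by
        rw [← sm_mul]
        exact br_sm fun i' j' _ _ _ _ => H.h3 i' j' (by omega) (by omega)
      linarith
    have e0 : ev x (n + 1) 0 = (x + 1) * sm (ev x n) 0 (n + 1) := by rw [ev_succ]; ring
    have en : ev x (n + 1) (n + 1) = (x + 1 - 1) * sm (ev x n) 0 (n + 1) := by
      rw [ev_succ, sm_self]; ring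
    have hux : 0 < (x + 1).im := by simpa using hx
    have c0 : ∀ j, j ≤ n + 1 → 0 ≤ br (ev x (n + 1) 0) (ev x (n + 1) j) := by
      intro j hj
      rcases Nat.eq_zero_or_pos j with rfl | h
      · rw [br_self]
      · exact (h1 0 j h hj).le
    have cn : ∀ j, j ≤ n + 1 → 0 ≤ br (ev x (n + 1) j) (ev x (n + 1) (n + 1)) := by
      intro j hj
      rcases Nat.lt_or_ge j (n + 1) with h | h
      · exact (h1 j (n + 1) h le_rfl).le
      · have : j = n + 1 := by omega
        subst this; rw [br_self]
    have arc : ∀ i j, i < j → j ≤ n + 1 → 0 ≤ br (ev x (n + 1) j) ((x + 1 - 1) * ev x (n + 1) i) ∧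
        0 ≤ br (ev x (n + 1) i) ((x + 1) * ev x (n + 1) j) ∧
        0 ≤ br ((x + 1) * ev x (n + 1) j) ((x + 1 - 1) * ev x (n + 1) i) := by
      intro i j hij hj
      refine arc_lemma hux hG ?_ ?_ ?_ ?_ (h1 i j hij hj).le
      · rw [← e0]; exact c0 j hj
      · rw [← en]; exact cn j hj
      · rw [← e0]; exact c0 i (by omega)
      · rw [← en]; exact cn i (by omega)
    refine ⟨?_, h1, ?_, ?_⟩
    · rw [e0]
      refine mul_ne_zero ?_ hG
      intro h
      rw [h] at hux
      simp at hux
    · intro i j hij hj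
      have := (arc i j hij hj).1
      rwa [add_sub_cancel_right] at this
    · intro i j hij hj
      exact (arc i j hij hj).2.1

lemma ev_ne (x : ℂ) (hx : 0 < x.im) {n j : ℕ} (hj : j ≤ n) : ev x n j ≠ 0 := by
  have := (pinv x hx n).sm_ne (a := j) (b := j + 1) (by omega) (by omega)
  rwa [sm_succ _ le_rfl, sm_self, zero_add] at this

lemma ev_br_nonneg (x : ℂ) (hx : 0 < x.im) {n i j : ℕ} (hij : i ≤ j) (hj : j ≤ n) :
    0 ≤ br (ev x n i) (ev x n j) := by
  rcases Nat.lt_or_ge i j with h | h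
  · exact ((pinv x hx n).h1 i j h hj).le
  · have : i = j := by omega
    subst this; rw [br_self]

lemma ev_add_ne (x : ℂ) (hx : 0 < x.im) {n i j : ℕ} (hi : i ≤ n) (hj : j ≤ n) :
    ev x n i + ev x n j ≠ 0 := by
  rcases Nat.lt_trichotomy i j with h | h | h
  · intro h0
    have := (pinv x hx n).h1 i j h hj
    rw [eq_neg_of_add_eq_zero_right h0] at this
    simp [br] at this
    linarith
  · subst h
    intro h0
    exact ev_ne x hx hi (by linear_combination h0 / 2)
  · intro h0
    have := (pinv x hx n).h1 j i h hi
    rw [eq_neg_of_add_eq_zero_left h0] at this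
    simp [br] at this
    linarith

/-- Symmetric part. -/
noncomputable def eS (x : ℂ) (n j : ℕ) : ℂ := ev x n j + ev x n (n - j)
/-- Antisymmetric part. -/
noncomputable def eD (x : ℂ) (n j : ℕ) : ℂ := ev x n j - ev x n (n - j)

lemma ev_sub (x : ℂ) (n : ℕ) {i j : ℕ} (hij : i ≤ j) (hj : j ≤ n + 1) :
    ev x (n + 1) i - ev x (n + 1) j = sm (ev x n) i j := by
  rw [ev_succ, ev_succ, sm_split (ev x n) hij hj]; ring

lemma sm_reflect (f : ℕ → ℂ) {n a b : ℕ} (h : b ≤ n + 1) :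
    sm (fun i => f (n - i)) a b = sm f (n + 1 - b) (n + 1 - a) := by
  unfold sm
  exact Finset.sum_Ico_reflect f a h

lemma eD_succ (x : ℂ) (n j : ℕ) (h : 2 * j ≤ n + 1) :
    eD x (n + 1) j = sm (ev x n) j (n + 1 - j) := by
  unfold eD
  exact ev_sub x n (by omega) (by omega)

lemma eS_succ (x : ℂ) (n j : ℕ) (h : 2 * j ≤ n + 1) :
    eS x (n + 1) j = (2 * x + 1) * sm (ev x n) 0 (n + 1) - sm (eD x n) 0 j := by
  have e1 : sm (eD x n) 0 j = sm (ev x n) 0 j - sm (ev x n) (n + 1 - j) (n + 1) := by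
    have := sm_reflect (ev x n) (n := n) (a := 0) (b := j) (by omega)
    rw [Nat.sub_zero] at this
    rw [← this, ← sm_sub]; rfl
  unfold eS
  rw [ev_succ, ev_succ, e1, sm_split (ev x n) (Nat.zero_le j) (by omega : j ≤ n + 1)]
  ring

lemma sm_congr {f g : ℕ → ℂ} {a b : ℕ} (h : ∀ i, a ≤ i → i < b → f i = g i) :
    sm f a b = sm g a b := by
  unfold sm
  refine Finset.sum_congr rfl fun i hi => ?_
  rw [Finset.mem_Ico] at hi
  exact h i hi.1 hi.2

lemma pair_odd (x : ℂ) (m j : ℕ) (hj : j ≤ m + 1) :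
    sm (eS x (2 * m + 1)) j (m + 1) = sm (ev x (2 * m + 1)) j (2 * m + 1 + 1 - j) := by
  have := sm_reflect (ev x (2 * m + 1)) (n := 2 * m + 1) (a := j) (b := m + 1) (by omega)
  rw [show 2 * m + 1 + 1 - (m + 1) = m + 1 by omega] at this
  rw [sm_split _ hj (by omega : m + 1 ≤ 2 * m + 1 + 1 - j), ← this, ← sm_add]
  rfl

lemma pair_even (x : ℂ) (m j : ℕ) (hj : j ≤ m) :
    sm (eS x (2 * m)) j m + ev x (2 * m) m = sm (ev x (2 * m)) j (2 * m + 1 - j) := by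
  have := sm_reflect (ev x (2 * m)) (n := 2 * m) (a := j) (b := m) (by omega)
  rw [show 2 * m + 1 - m = m + 1 by omega] at this
  rw [sm_split _ (by omega : j ≤ m + 1) (by omega : m + 1 ≤ 2 * m + 1 - j), ← this,
    sm_succ _ hj]
  have e : sm (eS x (2 * m)) j m
      = sm (ev x (2 * m)) j m + sm (fun i => ev x (2 * m) (2 * m - i)) j m := by
    rw [← sm_add]; rfl
  rw [e]; ring

/-- The bracket inequalities at level `n`. -/
def FinOK (x : ℂ) (n : ℕ) : Prop := ∀ a b, a ≤ b → 2 * b ≤ n →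
  0 ≤ br (eD x n a - eD x n b) (eS x n a + eS x n b) ∧
  0 ≤ br (eD x n a + eD x n b) (eS x n a + eS x n b)

/-- Existence of the odd data. -/
def OddOK (x : ℂ) (m : ℕ) : Prop := ∃ A K : ℕ → ℂ,
  OddInv ((2 * x + 1) ^ 2) m A K ∧
    ∀ j, j ≤ m → (2 * x + 1) * A j = eS x (2 * m + 1) j ∧ A j - K j = eD x (2 * m + 1) j

/-- Existence of the even data. -/
def EvenOK (x : ℂ) (m : ℕ) : Prop := ∃ A K : ℕ → ℂ,
  EvenInv ((2 * x + 1) ^ 2) m A K ∧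
    ∀ j, j ≤ m → A j = eS x (2 * m) j ∧ (2 * x + 1) * (A j - K j) = eD x (2 * m) j

lemma br_T1 {T B A : ℂ} (hT : 0 < T.re) (h1 : 0 ≤ br B A) (h2 : 0 ≤ br (T ^ 2 * B) A) :
    0 ≤ br (T * B) A := by
  have e : 2 * T.re * br (T * B) A = br (T ^ 2 * B) A + Complex.normSq T * br B A := by
    simp only [br, sq, Complex.mul_re, Complex.mul_im, Complex.normSq_apply]; ring
  have : 0 ≤ 2 * T.re * br (T * B) A := by
    rw [e]; exact add_nonneg h2 (mul_nonneg (Complex.normSq_nonneg _) h1)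
  exact nonneg_of_mul_nonneg_right this (by linarith)

lemma br_T2 {T B A : ℂ} (hT : 0 < T.re) (h1 : 0 ≤ br B A) (h2 : 0 ≤ br B (T ^ 2 * A)) :
    0 ≤ br B (T * A) := by
  have e : 2 * T.re * br B (T * A) = br B (T ^ 2 * A) + Complex.normSq T * br B A := by
    simp only [br, sq, Complex.mul_re, Complex.mul_im, Complex.normSq_apply]; ring
  have : 0 ≤ 2 * T.re * br B (T * A) := by
    rw [e]; exact add_nonneg h2 (mul_nonneg (Complex.normSq_nonneg _) h1)
  exact nonneg_of_mul_nonneg_right this (by linarith)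

section
variable {x : ℂ}

lemma odd_to_even (hT : 0 < (2 * x + 1).re) (hu : 0 < ((2 * x + 1) ^ 2).im) {m : ℕ}
    (h : OddOK x m) : EvenOK x (m + 1) ∧ FinOK x (2 * (m + 1)) := by
  obtain ⟨A, K, H, hAK⟩ := h
  have hS : ∀ j, j ≤ m + 1 → (2 * x + 1) * sm A j (m + 1) = sm (eS x (2 * m + 1)) j (m + 1) := by
    intro j hj
    rw [← sm_mul]
    exact sm_congr fun i _ _ => (hAK i (by omega)).1
  have hD : ∀ j, j ≤ m + 1 → (2 * x + 1) * sm A j (m + 1) = eD x (2 * (m + 1)) j := by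
    intro j hj
    rw [hS j hj, pair_odd x m j hj]
    exact (eD_succ x (2 * m + 1) j (by omega)).symm
  have hSS : ∀ j, j ≤ m + 1 → AE ((2 * x + 1) ^ 2) m A K j = eS x (2 * (m + 1)) j := by
    intro j hj
    have e1 := eS_succ x (2 * m + 1) j (by omega)
    have e2 := pair_odd x m 0 (by omega)
    rw [← hS 0 (by omega), Nat.sub_zero] at e2
    have e3 : sm (eD x (2 * m + 1)) 0 j = sm A 0 j - sm K 0 j := by
      rw [← sm_sub]
      exact sm_congr fun i _ _ => ((hAK i (by omega)).2).symm
    rw [← e2, e3] at e1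
    have e4 : eS x (2 * (m + 1)) j = eS x (2 * m + 1 + 1) j := rfl
    rw [e4, e1]
    unfold AE KE
    rw [sm_split A (Nat.zero_le j) hj]; ring
  refine ⟨⟨AE ((2 * x + 1) ^ 2) m A K, KE ((2 * x + 1) ^ 2) m A K, oe_step hu H, ?_⟩, ?_⟩
  · intro j hj
    refine ⟨hSS j hj, ?_⟩
    rw [AE, add_sub_cancel_left]; exact hD j hj
  · intro a b hab hb
    have hb' : b ≤ m + 1 := by omega
    obtain ⟨f1, f2, f3, f4⟩ := oe_FE hu H hab hb'
    rw [← hD a (by omega), ← hD b hb', ← hSS a (by omega), ← hSS b hb', ← mul_sub, ← mul_add]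
    exact ⟨br_T1 hT f1 f2, br_T1 hT f3 f4⟩

lemma even_to_odd (hT : 0 < (2 * x + 1).re) (hu : 0 < ((2 * x + 1) ^ 2).im) {m : ℕ} (hm : 1 ≤ m)
    (h : EvenOK x m) : OddOK x m ∧ FinOK x (2 * m + 1) := by
  obtain ⟨A, K, H, hAK⟩ := h
  set c : ℕ → ℝ := fun i => if i = m then 1 / 2 else 1 with hc
  have hcp : ∀ i, 0 < c i := by intro i; simp only [hc]; split_ifs <;> norm_num
  have hc0 : c 0 = 1 := by simp only [hc]; rw [if_neg (by omega)]
  have H' := even_scale H c hcp hc0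
  set A' : ℕ → ℂ := fun i => (c i : ℂ) * A i with hA'
  set K' : ℕ → ℂ := fun i => (c i : ℂ) * K i with hK'
  have cA : ∀ i, i < m → A' i = A i := by
    intro i hi; simp only [hA', hc]; rw [if_neg (by omega)]; simp
  have cK : ∀ i, i < m → K' i = K i := by
    intro i hi; simp only [hK', hc]; rw [if_neg (by omega)]; simp
  have cm : A' m = ev x (2 * m) m := by
    simp only [hA', hc]
    rw [if_pos trivial, (hAK m le_rfl).1, eS, show 2 * m - m = m by omega]
    push_cast; ring
  have hS : ∀ j, j ≤ m → sm A' j (m + 1) = eD x (2 * m + 1) j := by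
    intro j hj
    rw [eD_succ x (2 * m) j (by omega), ← pair_even x m j hj, sm_succ _ hj, cm]
    congr 1
    exact sm_congr fun i _ hi => by rw [cA i hi, (hAK i hi.le).1]
  have hSS : ∀ j, j ≤ m → (2 * x + 1) * AO m A' K' j = eS x (2 * m + 1) j := by
    intro j hj
    rw [eS_succ x (2 * m) j (by omega)]
    have e2 := hS 0 (by omega)
    rw [eD_succ x (2 * m) 0 (by omega), Nat.sub_zero] at e2
    have e3 : sm (eD x (2 * m)) 0 j = (2 * x + 1) * (sm A' 0 j - sm K' 0 j) := by
      rw [← sm_sub, ← sm_mul]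
      exact sm_congr fun i _ hi => by
        rw [cA i (by omega), cK i (by omega), (hAK i (by omega)).2]
    rw [← e2, e3, AO, sm_split A' (Nat.zero_le j) (by omega : j ≤ m + 1)]; ring
  refine ⟨⟨AO m A' K', KO K', eo_step H' hu hm, ?_⟩, ?_⟩
  · intro j hj
    refine ⟨hSS j hj, ?_⟩
    rw [AO_sub_KO]; exact hS j hj
  · intro a b hab hb
    have hb' : b ≤ m := by omega
    obtain ⟨f1, f2, f3, f4⟩ := eo_FO H' hu hab hb'
    rw [← hS a (by omega), ← hS b hb', ← hSS a (by omega), ← hSS b hb', ← mul_add]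
    exact ⟨br_T2 hT f1 f2, br_T2 hT f3 f4⟩

lemma odd_ok (hT : 0 < (2 * x + 1).re) (hu : 0 < ((2 * x + 1) ^ 2).im) (m : ℕ) : OddOK x m := by
  induction m with
  | zero =>
    refine ⟨_, _, odd_base hu, ?_⟩
    intro j hj
    have : j = 0 := by omega
    subst this
    constructor
    · simp [eS, ev, sm]; ring
    · simp [eD, ev, sm]
  | succ m ih =>
    exact (even_to_odd hT hu (by omega) (odd_to_even hT hu ih).1).1

lemma fin_ok_right (hT : 0 < (2 * x + 1).re) (hI : 0 < x.im) (n : ℕ) : FinOK x n := by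
  have hu : 0 < ((2 * x + 1) ^ 2).im := by
    have e : ((2 * x + 1) ^ 2).im = 2 * (2 * x + 1).re * (2 * x.im) := by
      simp [sq]; ring
    rw [e]; positivity
  rcases Nat.even_or_odd' n with ⟨m, rfl | rfl⟩
  · rcases m with _ | m
    · intro a b hab hb
      have h1 : b = 0 := by omega
      have h2 : a = 0 := by omega
      subst h1 h2
      simp [eD, br]
    · exact (odd_to_even hT hu (odd_ok hT hu m)).2
  · rcases m with _ | m
    · intro a b hab hb
      have h1 : b = 0 := by omega
      have h2 : a = 0 := by omega
      subst h1 h2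
      simp [eD, eS, ev, sm, br]
      nlinarith
    · exact (even_to_odd hT hu (by omega) (odd_to_even hT hu (odd_ok hT hu m)).1).2

end

lemma ev_continuous (n j : ℕ) : Continuous fun x => ev x n j := by
  induction n generalizing j with
  | zero => simp only [ev]; exact continuous_const
  | succ n ih =>
    simp only [ev_succ, sm]
    exact (continuous_id.mul (continuous_finsetSum _ fun i _ => ih i)).add
      (continuous_finsetSum _ fun i _ => ih i)

lemma ev_reflect (x : ℂ) (n j : ℕ) (hj : j ≤ n) :
    ev (-1 - x) n j = (-1) ^ n * ev x n (n - j) := by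
  induction n generalizing j with
  | zero => simp [ev]
  | succ n ih =>
    have h : ∀ a, a ≤ n + 1 → sm (ev (-1 - x) n) a (n + 1)
        = (-1) ^ n * sm (ev x n) 0 (n + 1 - a) := by
      intro a ha
      have := sm_reflect (ev x n) (n := n) (a := a) (b := n + 1) le_rfl
      rw [Nat.sub_self] at this
      rw [← this, ← sm_mul]
      exact sm_congr fun i _ _ => ih i (by omega)
    rw [ev_succ, ev_succ, h 0 (by omega), h j hj, Nat.sub_zero,
      sm_split (ev x n) (Nat.zero_le (n + 1 - j)) (by omega : n + 1 - j ≤ n + 1)]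
    ring

lemma ev_conj (x : ℂ) (n j : ℕ) :
    ev ((starRingEnd ℂ) x) n j = (starRingEnd ℂ) (ev x n j) := by
  induction n generalizing j with
  | zero => simp [ev]
  | succ n ih =>
    simp only [ev_succ, sm, map_add, map_mul, map_sum, ih]

lemma br_conj (a b : ℂ) : br ((starRingEnd ℂ) a) ((starRingEnd ℂ) b) = - br a b := by
  simp [br]; ring

lemma br_fin_reflect (x : ℂ) {n a b : ℕ} (ha : a ≤ n) (hb : b ≤ n) (s : ℝ) :
    br (eD (-1 - (starRingEnd ℂ) x) n a + s * eD (-1 - (starRingEnd ℂ) x) n b)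
      (eS (-1 - (starRingEnd ℂ) x) n a + eS (-1 - (starRingEnd ℂ) x) n b)
    = br (eD x n a + s * eD x n b) (eS x n a + eS x n b) := by
  have hs : ((-1 : ℂ) ^ n) = (((-1 : ℝ) ^ n : ℝ) : ℂ) := by push_cast; rfl
  have hD : ∀ j, j ≤ n → eD (-1 - (starRingEnd ℂ) x) n j
      = (((-1 : ℝ) ^ n : ℝ) : ℂ) * (-(starRingEnd ℂ) (eD x n j)) := by
    intro j hj
    unfold eD
    rw [ev_reflect _ _ _ hj, ev_reflect _ _ _ (Nat.sub_le n j), Nat.sub_sub_self hj, ev_conj,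
      ev_conj, hs, map_sub]
    ring
  have hS : ∀ j, j ≤ n → eS (-1 - (starRingEnd ℂ) x) n j
      = (((-1 : ℝ) ^ n : ℝ) : ℂ) * ((starRingEnd ℂ) (eS x n j)) := by
    intro j hj
    unfold eS
    rw [ev_reflect _ _ _ hj, ev_reflect _ _ _ (Nat.sub_le n j), Nat.sub_sub_self hj, ev_conj,
      ev_conj, hs, map_add]
    ring
  rw [hD a ha, hD b hb, hS a ha, hS b hb]
  have h2 : ((-1 : ℝ) ^ n) * ((-1 : ℝ) ^ n) = 1 := by rw [← mul_pow]; simp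
  have e1 : (((-1 : ℝ) ^ n : ℝ) : ℂ) * (-(starRingEnd ℂ) (eD x n a))
      + s * ((((-1 : ℝ) ^ n : ℝ) : ℂ) * (-(starRingEnd ℂ) (eD x n b)))
      = (((-1 : ℝ) ^ n : ℝ) : ℂ) * (-(starRingEnd ℂ) (eD x n a + s * eD x n b)) := by
    simp only [map_add, map_mul, Complex.conj_ofReal]; ring
  have e2 : ∀ a b : ℂ, br (-a) b = - br a b := by intro a b; simp [br]; ring
  rw [e1, ← mul_add, br_real_mul, h2, one_mul, e2, ← map_add, br_conj, neg_neg]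

lemma fin_main (x : ℂ) (hx : 0 < x.im) {n a b : ℕ} (hab : a ≤ b) (hb : 2 * b ≤ n) (s : ℝ)
    (hs : s = 1 ∨ s = -1) :
    0 ≤ br (eD x n a + s * eD x n b) (eS x n a + eS x n b) := by
  have right : ∀ y : ℂ, 0 < (2 * y + 1).re → 0 < y.im →
      0 ≤ br (eD y n a + s * eD y n b) (eS y n a + eS y n b) := by
    intro y h1 h2
    have := fin_ok_right h1 h2 n a b hab hb
    rcases hs with rfl | rfl
    · simpa using this.2
    · simpa [sub_eq_add_neg] using this.1
  rcases lt_trichotomy (2 * x + 1).re 0 with h | h | h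
  · rw [← br_fin_reflect x (by omega) (by omega) s]
    apply right
    · simp at h ⊢; linarith
    · simpa using hx
  · have hc : Continuous fun t : ℝ =>
        br (eD (x + t) n a + s * eD (x + t) n b) (eS (x + t) n a + eS (x + t) n b) := by
      have h1 : ∀ j, Continuous fun t : ℝ => ev (x + t) n j := fun j =>
        (ev_continuous n j).comp (by fun_prop)
      have hD : ∀ j, Continuous fun t : ℝ => eD (x + t) n j := fun j => (h1 _).sub (h1 _)
      have hS : ∀ j, Continuous fun t : ℝ => eS (x + t) n j := fun j => (h1 _).add (h1 _)
      have c1 := (hD a).add (continuous_const.mul (hD b) : Continuous fun t : ℝ =>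
        (s : ℂ) * eD (x + t) n b)
      have c2 := (hS a).add (hS b)
      unfold br
      exact ((Complex.continuous_re.comp c1).mul (Complex.continuous_im.comp c2)).sub
        ((Complex.continuous_im.comp c1).mul (Complex.continuous_re.comp c2))
    have ht : Filter.Tendsto (fun t : ℝ =>
        br (eD (x + t) n a + s * eD (x + t) n b) (eS (x + t) n a + eS (x + t) n b))
        (nhdsWithin 0 (Set.Ioi 0))
        (nhds (br (eD x n a + s * eD x n b) (eS x n a + eS x n b))) := by
      have := hc.tendsto 0
      simp only [Complex.ofReal_zero, add_zero] at this
      exact this.mono_left nhdsWithin_le_nhds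
    refine ge_of_tendsto ht ?_
    filter_upwards [self_mem_nhdsWithin] with t ht
    have ht' : (0 : ℝ) < t := ht
    apply right
    · simp at h ⊢; linarith
    · simpa using hx
  · exact right x h hx


/-- The forward difference as a linear map. -/
noncomputable def dl : ℝ[X] →ₗ[ℝ] ℝ[X] where
  toFun q := q.comp (X + 1) - q
  map_add' p q := by simp only [add_comp]; ring
  map_smul' c p := by simp only [smul_comp, RingHom.id_apply, smul_sub]

lemma dl_apply (q : ℝ[X]) : dl q = q.comp (X + 1) - q := rfl

lemma dl_iter (k : ℕ) (p : ℝ[X]) :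
    (fun q : ℝ[X] => q.comp (X + 1) - q)^[k] p = (dl ^ k) p := by
  rw [Module.End.pow_apply]; rfl

lemma dl_eval (k : ℕ) (p : ℝ[X]) :
    (fun y : ℝ => ((dl ^ k) p).eval y) = (fwdDiff (1 : ℝ))^[k] (fun y => p.eval y) := by
  induction k generalizing p with
  | zero => rfl
  | succ k ih =>
    rw [pow_succ, Function.iterate_succ_apply]
    have : ((dl ^ k) * dl) p = (dl ^ k) (dl p) := rfl
    rw [this, ih]
    congr 1
    funext y
    simp [dl_apply, fwdDiff]

lemma dl_zero {k : ℕ} {p : ℝ[X]} (h : p.natDegree < k) : ((dl ^ k) p).eval 0 = 0 := by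
  have := congrFun (dl_eval k p) 0
  have h2 := congrFun (Polynomial.fwdDiff_iter_eq_zero_of_degree_lt h) (0 : ℝ)
  exact this.trans h2

lemma subdivE_eq {N : ℕ} {p : ℝ[X]} (h : p.natDegree < N) :
    subdivE p = ∑ k ∈ Finset.range N, Polynomial.C (((dl ^ k) p).eval 0) * X ^ k := by
  unfold subdivE
  simp only [dl_iter]
  refine Finset.sum_subset ?_ ?_
  · intro i hi; simp at hi ⊢; omega
  · intro i _ hi
    rw [dl_zero (by simpa using hi)]; simp

lemma subdivE_add (p q : ℝ[X]) : subdivE (p + q) = subdivE p + subdivE q := by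
  set N := max p.natDegree q.natDegree + 1 with hN
  have hp : p.natDegree < N := by omega
  have hq : q.natDegree < N := by omega
  have hpq : (p + q).natDegree < N := by
    have := natDegree_add_le p q
    omega
  rw [subdivE_eq hp, subdivE_eq hq, subdivE_eq hpq, ← Finset.sum_add_distrib]
  refine Finset.sum_congr rfl fun k _ => ?_
  rw [map_add, eval_add, C_add, add_mul]

lemma subdivE_zero : subdivE 0 = 0 := by
  have := subdivE_add 0 0
  simpa using this

lemma subdivE_sum {ι : Type*} (s : Finset ι) (f : ι → ℝ[X]) :
    subdivE (∑ i ∈ s, f i) = ∑ i ∈ s, subdivE (f i) := by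
  induction s using Finset.induction_on with
  | empty => simpa using subdivE_zero
  | insert a s ha ih => rw [Finset.sum_insert ha, Finset.sum_insert ha, subdivE_add, ih]

lemma subdivE_dl (p : ℝ[X]) : subdivE p = Polynomial.C (p.eval 0) + X * subdivE (dl p) := by
  set N := max p.natDegree (dl p).natDegree + 1 with hN
  rw [subdivE_eq (N := N + 1) (p := p) (by omega), subdivE_eq (N := N) (p := dl p) (by omega),
    Finset.sum_range_succ', Finset.mul_sum, add_comm]
  congr 1
  · simp
  · refine Finset.sum_congr rfl fun k _ => ?_
    have : (dl ^ (k + 1)) p = (dl ^ k) (dl p) := by rw [pow_succ]; rfl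
    rw [this]; ring

lemma Ekd_zero : Ekd 0 0 = 1 := by
  unfold Ekd subdivE
  simp

lemma Ekd_succ (n j : ℕ) (hj : j ≤ n) : Ekd (n + 1) j = Ekd (n + 1) (j + 1) + Ekd n j := by
  unfold Ekd
  rw [← subdivE_add]
  congr 1
  rw [show n + 1 - j = (n - j) + 1 by omega, show n + 1 - (j + 1) = n - j by omega]
  ring

lemma Ekd_top (n : ℕ) : Ekd (n + 1) (n + 1) = X * ∑ i ∈ Finset.range (n + 1), Ekd n i := by
  unfold Ekd
  rw [Nat.sub_self, pow_zero, mul_one, subdivE_dl, ← subdivE_sum]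
  have h1 : (X ^ (n + 1) : ℝ[X]).eval 0 = 0 := by simp
  have h2 : dl (X ^ (n + 1)) = ∑ i ∈ Finset.range (n + 1), (X : ℝ[X]) ^ i * (X + 1) ^ (n - i) := by
    rw [dl_apply, X_pow_comp]
    have := (Commute.all (X : ℝ[X]) (X + 1)).mul_geom_sum₂ (n + 1)
    simp only [Nat.add_sub_cancel] at this
    linear_combination (1 : ℝ[X]) * this
  rw [h1, h2]; simp

/-- Evaluation of a real polynomial at a complex point. -/
noncomputable def cv (p : ℝ[X]) (x : ℂ) : ℂ := (toC p).eval x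

lemma cv_add (p q : ℝ[X]) (x : ℂ) : cv (p + q) x = cv p x + cv q x := by simp [cv, toC]
lemma cv_sub (p q : ℝ[X]) (x : ℂ) : cv (p - q) x = cv p x - cv q x := by simp [cv, toC]

lemma cv_Ekd_top (n : ℕ) (x : ℂ) :
    cv (Ekd (n + 1) (n + 1)) x = x * sm (fun i => cv (Ekd n i) x) 0 (n + 1) := by
  rw [Ekd_top]
  simp [cv, toC, sm, Polynomial.map_sum, eval_finsetSum]

lemma cv_Ekd (x : ℂ) (n j : ℕ) (hj : j ≤ n) : cv (Ekd n j) x = ev x n j := by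
  induction n generalizing j with
  | zero =>
    have : j = 0 := by omega
    subst this
    rw [Ekd_zero]; simp [cv, toC, ev]
  | succ n ih =>
    have hs : sm (fun i => cv (Ekd n i) x) 0 (n + 1) = sm (ev x n) 0 (n + 1) :=
      sm_congr fun i _ _ => ih i (by omega)
    have down : ∀ t j, j + t = n + 1 → cv (Ekd (n + 1) j) x = ev x (n + 1) j := by
      intro t
      induction t with
      | zero =>
        intro j hjt
        have : j = n + 1 := by omega
        subst this
        rw [cv_Ekd_top, hs, ev_succ, sm_self, add_zero]
      | succ t iht =>
        intro j hjt
        rw [Ekd_succ n j (by omega), cv_add, iht (j + 1) (by omega), ih j (by omega), ev_succ,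
          ev_succ, sm_split (ev x n) (Nat.le_succ j) (by omega : j + 1 ≤ n + 1), sm_succ _ le_rfl,
          sm_self]
        ring
    exact down (n + 1 - j) j (by omega)

lemma cv_Rflip (d : ℕ) (p : ℝ[X]) (x : ℂ) : cv (Rflip d p) x = (-1) ^ d * cv p (-1 - x) := by
  unfold cv toC Rflip
  rw [Polynomial.map_smul, eval_smul, Polynomial.map_comp, eval_comp]
  simp

lemma interlaces_of (p q : ℝ[X])
    (h : ∀ x : ℂ, 0 < x.im → 0 ≤ br (cv p x) (cv q x) ∧ (cv p x = 0 → cv q x = 0 → False)) :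
    Interlaces p q := by
  right
  intro z hz h0
  obtain ⟨h1, h2⟩ := h z hz
  have e : cv q z + Complex.I * cv p z = 0 := by
    simpa [cv] using h0
  have eq : cv q z = -(Complex.I * cv p z) := eq_neg_of_add_eq_zero_left e
  have hp : cv p z = 0 := by
    rw [eq] at h1
    have : br (cv p z) (-(Complex.I * cv p z)) = - Complex.normSq (cv p z) := by
      simp [br, Complex.normSq_apply]; ring
    rw [this] at h1
    have h3 := Complex.normSq_nonneg (cv p z)
    exact Complex.normSq_eq_zero.1 (by linarith)
  exact h2 hp (by rw [eq, hp]; simp)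

lemma main_bracket (x : ℂ) (hx : 0 < x.im) {d k l : ℕ} (hl : l ≤ d) (hkl : d ≤ k + l)
    (h : k ≤ l) :
    0 ≤ br (ev x d (d - k) + ev x d (d - l)) (ev x d k + ev x d l) := by
  have half : ∀ p r : ℂ, br r p = br (r - p) (r + p) / 2 := by
    intro p r; simp only [br, Complex.add_re, Complex.add_im, Complex.sub_re, Complex.sub_im]; ring
  rw [half]
  have hll : d - (d - l) = l := by omega
  rcases le_total d (2 * k) with hc | hc
  · have := fin_main x hx (n := d) (a := d - l) (b := d - k) (by omega) (by omega) 1 (Or.inl rfl)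
    have hkk : d - (d - k) = k := by omega
    unfold eD eS at this
    rw [hll, hkk] at this
    have e1 : ev x d (d - k) + ev x d (d - l) - (ev x d k + ev x d l)
      = ev x d (d - l) - ev x d l + ((1 : ℝ) : ℂ) * (ev x d (d - k) - ev x d k) := by
        push_cast; ring
    have e2 : ev x d (d - k) + ev x d (d - l) + (ev x d k + ev x d l)
      = ev x d (d - l) + ev x d l + (ev x d (d - k) + ev x d k) := by ring
    rw [e1, e2]; linarith
  · have := fin_main x hx (n := d) (a := d - l) (b := k) (by omega) (by omega) (-1) (Or.inr rfl)
    unfold eD eS at this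
    rw [hll] at this
    have e1 : ev x d (d - k) + ev x d (d - l) - (ev x d k + ev x d l)
      = ev x d (d - l) - ev x d l + ((-1 : ℝ) : ℂ) * (ev x d k - ev x d (d - k)) := by
        push_cast; ring
    have e2 : ev x d (d - k) + ev x d (d - l) + (ev x d k + ev x d l)
      = ev x d (d - l) + ev x d l + (ev x d k + ev x d (d - k)) := by ring
    rw [e1, e2]; linarith

lemma diff_eq (x : ℂ) {n k l : ℕ} (hk : k ≤ n + 1) (hl : l ≤ n + 1) (hkl : n + 1 ≤ k + l) :
    ev x (n + 1) (n + 1 - k) + ev x (n + 1) (n + 1 - l) - (ev x (n + 1) k + ev x (n + 1) l)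
      = sm (ev x n) (n + 1 - l) k + sm (ev x n) (n + 1 - k) l := by
  rw [← ev_sub x n (by omega : n + 1 - l ≤ k) hk, ← ev_sub x n (by omega : n + 1 - k ≤ l) hl]
  ring

lemma sm_one (f : ℕ → ℂ) (a : ℕ) : sm f a (a + 1) = f a := by
  rw [sm_succ _ le_rfl, sm_self, zero_add]

lemma stmt7_aux (d k l : ℕ) (hk : k ≤ d) (hl : l ≤ d) (hkl : d ≤ k + l) (h : k ≤ l) :
    Interlaces (Rflip d (Ekd d k + Ekd d l)) (Ekd d k + Ekd d l) ∧
    (Ekd d k + Ekd d l) ∈ Ad d ∧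
    Interlaces (Ekd (d - 1) 0) (Rflip d (Ekd d k + Ekd d l) - (Ekd d k + Ekd d l)) ∧
    Interlaces (Rflip d (Ekd d k + Ekd d l) - (Ekd d k + Ekd d l)) (Ekd (d - 1) (d - 1)) := by
  have ep : ∀ x, cv (Ekd d k + Ekd d l) x = ev x d k + ev x d l := by
    intro x; rw [cv_add, cv_Ekd x d k hk, cv_Ekd x d l hl]
  have er : ∀ x, cv (Rflip d (Ekd d k + Ekd d l)) x = ev x d (d - k) + ev x d (d - l) := by
    intro x
    rw [cv_Rflip, ep, ev_reflect x d k hk, ev_reflect x d l hl]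
    have : ((-1 : ℂ) ^ d) * ((-1 : ℂ) ^ d) = 1 := by rw [← mul_pow]; simp
    linear_combination (ev x d (d - k) + ev x d (d - l)) * this
  have es : ∀ x, cv (Rflip d (Ekd d k + Ekd d l) - (Ekd d k + Ekd d l)) x
      = ev x d (d - k) + ev x d (d - l) - (ev x d k + ev x d l) := by
    intro x; rw [cv_sub, er, ep]
  have main : Interlaces (Rflip d (Ekd d k + Ekd d l)) (Ekd d k + Ekd d l) := by
    refine interlaces_of _ _ fun x hx => ⟨?_, fun _ h2 => ?_⟩
    · rw [er, ep]; exact main_bracket x hx hl hkl h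
    · rw [ep] at h2; exact ev_add_ne x hx hk hl h2
  refine ⟨main, ⟨⟨fun i => (if i = k then 1 else 0) + (if i = l then 1 else 0), ?_, ?_⟩, main⟩, ?_, ?_⟩
  · intro i
    show (0:ℝ) ≤ (if i = k then (1:ℝ) else 0) + (if i = l then (1:ℝ) else 0)
    split_ifs <;> norm_num
  · simp only [add_smul, Finset.sum_add_distrib, ite_smul, one_smul, zero_smul,
      Finset.sum_ite_eq', Finset.mem_range]
    rw [if_pos (by omega), if_pos (by omega)]
  · refine interlaces_of _ _ fun x hx => ⟨?_, fun h1 _ => ?_⟩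
    · rw [es, cv_Ekd x _ _ (Nat.zero_le _)]
      rcases d with _ | n
      · have h1 : k = 0 := by omega
        have h2 : l = 0 := by omega
        subst h1 h2
        simp [br]
      · rw [diff_eq x hk hl hkl, br_add_right]
        simp only [Nat.add_sub_cancel]
        rw [← sm_one (ev x n) 0]
        refine add_nonneg (br_sm fun i j _ _ _ _ => ?_) (br_sm fun i j _ _ _ _ => ?_) <;>
        · have : i = 0 := by omega
          subst this
          exact ev_br_nonneg x hx (Nat.zero_le _) (by omega)
    · rw [cv_Ekd x _ _ (Nat.zero_le _)] at h1
      exact ev_ne x hx (Nat.zero_le _) h1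
  · refine interlaces_of _ _ fun x hx => ⟨?_, fun _ h1 => ?_⟩
    · rw [es, cv_Ekd x _ _ le_rfl]
      rcases d with _ | n
      · have h1 : k = 0 := by omega
        have h2 : l = 0 := by omega
        subst h1 h2
        simp [br]
      · rw [diff_eq x hk hl hkl, br_add_left]
        simp only [Nat.add_sub_cancel]
        rw [← sm_one (ev x n) n]
        refine add_nonneg (br_sm fun i j _ _ _ _ => ?_) (br_sm fun i j _ _ _ _ => ?_) <;>
        · have : j = n := by omega
          subst this
          exact ev_br_nonneg x hx (by omega) le_rfl
    · rw [cv_Ekd x _ _ le_rfl] at h1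
      exact ev_ne x hx le_rfl h1

/-- if `k + ℓ ≥ d` then `p = E_k^d + E_ℓ^d` satisfies `R_d(p) ≺ p`
(so `p ∈ 𝓐_d`), and moreover `E_0^{d-1} ≺ R_d(p) - p ≺ E_{d-1}^{d-1}`. -/
theorem stmt7 (d k l : ℕ) (hk : k ≤ d) (hl : l ≤ d) (hkl : d ≤ k + l) :
    Interlaces (Rflip d (Ekd d k + Ekd d l)) (Ekd d k + Ekd d l) ∧
    (Ekd d k + Ekd d l) ∈ Ad d ∧
    Interlaces (Ekd (d - 1) 0) (Rflip d (Ekd d k + Ekd d l) - (Ekd d k + Ekd d l)) ∧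
    Interlaces (Rflip d (Ekd d k + Ekd d l) - (Ekd d k + Ekd d l)) (Ekd (d - 1) (d - 1)) := by
  rcases le_total k l with h | h
  · exact stmt7_aux d k l hk hl hkl h
  · rw [add_comm (Ekd d k)]
    exact stmt7_aux d l k hl hk (by omega) h
end

section
/- Let i = Σ_{j=0}^d c_j·x^j·(x+1)^{d−j}, where c_j ≥ 0 for all 0 ≤ j ≤ d, and let h ∈ ℝ[x] be the polynomial of degree at most d determined by the formal power series identity Σ_{m≥0} i(m)·x^m = h(x)/(1−x)^{d+1}. If c_0 + c_1 + ⋯ + c_j ≤ c_d + c_{d−1} + ⋯ + c_{d−j} for all 0 ≤ j ≤ d/2, then the I_d-decomposition (a, b) of h is real-rooted, i.e., both a and b are real-rooted polynomials. -/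
open Polynomial
open scoped Classical

namespace Stmt9Aux

/-- planar cross product -/
def cr (u v : ℂ) : ℝ := u.re * v.im - u.im * v.re

/-- the cone spanned by `s` and `z s` -/
def Kc (s z v : ℂ) : Prop := ∃ α β : ℝ, 0 ≤ α ∧ 0 ≤ β ∧ v = ((α : ℂ) + β * z) * s

lemma Kc.add {s z u v : ℂ} (hu : Kc s z u) (hv : Kc s z v) : Kc s z (u + v) := by
  obtain ⟨a, b, ha, hb, rfl⟩ := hu
  obtain ⟨a', b', ha', hb', rfl⟩ := hv
  exact ⟨a + a', b + b', by positivity, by positivity, by push_cast; ring⟩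

lemma Kc.zero (s z : ℂ) : Kc s z 0 := ⟨0, 0, le_rfl, le_rfl, by simp⟩

lemma Kc.smul {s z u : ℂ} (hu : Kc s z u) {r : ℝ} (hr : 0 ≤ r) : Kc s z (r * u) := by
  obtain ⟨a, b, ha, hb, rfl⟩ := hu
  exact ⟨r * a, r * b, by positivity, by positivity, by push_cast; ring⟩

lemma Kc.sum {s z : ℂ} {A : Finset ℕ} {w : ℕ → ℂ} (h : ∀ i ∈ A, Kc s z (w i)) :
    Kc s z (∑ i ∈ A, w i) :=
  Finset.sum_induction w (Kc s z) (fun _ _ => Kc.add) (Kc.zero s z) h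

lemma lin_zero {z : ℂ} (hz : 0 < z.im) {a b : ℝ} (h : (a : ℂ) + b * z = 0) : a = 0 ∧ b = 0 := by
  have h2 := congrArg Complex.im h
  have h1 := congrArg Complex.re h
  simp at h1 h2
  have hb : b = 0 := by
    rcases h2 with h2 | h2
    · exact h2
    · exact absurd h2 hz.ne'
  subst hb
  simp at h1
  exact ⟨h1, rfl⟩

lemma Kc.pointed {s z u v : ℂ} (hz : 0 < z.im) (hs : s ≠ 0) (hu : Kc s z u) (hv : Kc s z v)
    (h : u + v = 0) : u = 0 ∧ v = 0 := by
  obtain ⟨a, b, ha, hb, rfl⟩ := hu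
  obtain ⟨a', b', ha', hb', rfl⟩ := hv
  have h1 : (((a + a' : ℝ) : ℂ) + ((b + b' : ℝ) : ℂ) * z) * s = 0 := by
    rw [← h]; push_cast; ring
  have h2 := lin_zero hz ((mul_eq_zero.mp h1).resolve_right hs)
  obtain ⟨h3, h4⟩ := h2
  have e1 : a = 0 := by linarith
  have e2 : b = 0 := by linarith
  have e3 : a' = 0 := by linarith
  have e4 : b' = 0 := by linarith
  subst e1 e2 e3 e4
  simp

lemma Kc.sum_zero {s z : ℂ} (hz : 0 < z.im) (hs : s ≠ 0) {A : Finset ℕ} {w : ℕ → ℂ}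
    (h : ∀ i ∈ A, Kc s z (w i)) (h0 : ∑ i ∈ A, w i = 0) : ∀ i ∈ A, w i = 0 := by
  intro i hi
  rw [← Finset.add_sum_erase A w hi] at h0
  exact (Kc.pointed hz hs (h i hi) (Kc.sum fun j hj => h j (Finset.mem_of_mem_erase hj)) h0).1

lemma Kc.of_cr {s z v : ℂ} (hz : 0 < z.im) (hs : s ≠ 0) (h1 : 0 ≤ cr s v)
    (h2 : 0 ≤ cr v (z * s)) : Kc s z v := by
  have hN : 0 < s.re ^ 2 + s.im ^ 2 := by
    have := Complex.normSq_pos.mpr hs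
    rw [Complex.normSq_apply] at this
    nlinarith
  have hp : 0 < z.im * (s.re ^ 2 + s.im ^ 2) := by positivity
  refine ⟨cr v (z * s) / (z.im * (s.re ^ 2 + s.im ^ 2)), cr s v / (z.im * (s.re ^ 2 + s.im ^ 2)),
    by positivity, by positivity, ?_⟩
  have hz' := hz.ne'
  have hN' := hN.ne'
  apply Complex.ext
  · simp only [cr, Complex.add_re, Complex.mul_re, Complex.add_im, Complex.mul_im,
      Complex.ofReal_re, Complex.ofReal_im]
    field_simp
    ring
  · simp only [cr, Complex.add_re, Complex.mul_re, Complex.add_im, Complex.mul_im,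
      Complex.ofReal_re, Complex.ofReal_im]
    field_simp
    ring

lemma cr_turn {s z P Q : ℂ} (hz : 0 < z.im) (hs : s ≠ 0) (hP : Kc s z P) (hQ : Kc s z Q)
    (h : 0 ≤ cr P Q) : 0 ≤ cr Q (z * P) := by
  have hN : 0 < s.re ^ 2 + s.im ^ 2 := by
    have := Complex.normSq_pos.mpr hs
    rw [Complex.normSq_apply] at this
    nlinarith
  obtain ⟨g, e, hg, he, rfl⟩ := hP
  obtain ⟨a, b, ha, hb, rfl⟩ := hQ
  have e1 : cr (((g : ℂ) + e * z) * s) (((a : ℂ) + b * z) * s)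
      = (g * b - e * a) * (z.im * (s.re ^ 2 + s.im ^ 2)) := by
    simp [cr]; ring
  have e2 : cr (((a : ℂ) + b * z) * s) (z * (((g : ℂ) + e * z) * s))
      = (a * g + 2 * a * e * z.re + b * e * (z.re ^ 2 + z.im ^ 2))
        * (z.im * (s.re ^ 2 + s.im ^ 2)) := by
    simp [cr]; ring
  have hp : 0 < z.im * (s.re ^ 2 + s.im ^ 2) := by positivity
  rw [e1] at h
  have h' : 0 ≤ g * b - e * a := nonneg_of_mul_nonneg_left h hp
  rw [e2]
  refine mul_nonneg ?_ hp.le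
  rcases hg.eq_or_lt with hg0 | hg0
  · subst hg0
    have : e * a = 0 := le_antisymm (by linarith) (by positivity)
    have h3 : a * 0 + 2 * a * e * z.re + b * e * (z.re ^ 2 + z.im ^ 2)
      = 2 * (e * a) * z.re + b * e * (z.re ^ 2 + z.im ^ 2) := by ring
    rw [h3, this]
    have : 0 ≤ b * e * (z.re ^ 2 + z.im ^ 2) := by positivity
    linarith
  · refine nonneg_of_mul_nonneg_right (a := g) ?_ hg0
    have h3 : g * (a * g + 2 * a * e * z.re + b * e * (z.re ^ 2 + z.im ^ 2))
      = a * ((g + e * z.re) ^ 2 + (e * z.im) ^ 2)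
        + (g * b - e * a) * (e * (z.re ^ 2 + z.im ^ 2)) := by ring
    rw [h3]
    positivity

lemma cr_sum (A B : Finset ℕ) (w : ℕ → ℂ) :
    cr (∑ i ∈ A, w i) (∑ j ∈ B, w j) = ∑ i ∈ A, ∑ j ∈ B, cr (w i) (w j) := by
  simp only [cr, Complex.re_sum, Complex.im_sum, Finset.sum_mul_sum, Finset.sum_sub_distrib]

/-- the pointwise invariant -/
structure Inv (z : ℂ) (n : ℕ) (w : ℕ → ℂ) : Prop where
  ne : ∀ i ≤ n, w i ≠ 0
  cone : ∀ i ≤ n, Kc (w 0) z (w i)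
  mono : ∀ i j, i ≤ j → j ≤ n → 0 ≤ cr (w i) (w j)

/-- partial sums -/
def Bs (n k : ℕ) (w : ℕ → ℂ) : ℂ := ∑ i ∈ (Finset.range (n + 1)).filter (fun i => i < k), w i
/-- complementary partial sums -/
def Ts (n k : ℕ) (w : ℕ → ℂ) : ℂ := ∑ i ∈ (Finset.range (n + 1)).filter (fun i => ¬ i < k), w i
/-- total sum -/
def Ss (n : ℕ) (w : ℕ → ℂ) : ℂ := ∑ i ∈ (Finset.range (n + 1)), w i

lemma B_add_T (n k : ℕ) (w : ℕ → ℂ) : Bs n k w + Ts n k w = Ss n w :=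
  Finset.sum_filter_add_sum_filter_not _ _ _

lemma Inv.cr_nonneg {z : ℂ} {n : ℕ} {w : ℕ → ℂ} (H : Inv z n w) (A B : Finset ℕ)
    (hB : ∀ j ∈ B, j ≤ n) (hAB : ∀ i ∈ A, ∀ j ∈ B, i ≤ j) :
    0 ≤ cr (∑ i ∈ A, w i) (∑ j ∈ B, w j) := by
  rw [cr_sum]
  exact Finset.sum_nonneg fun i hi => Finset.sum_nonneg fun j hj =>
    H.mono i j (hAB i hi j hj) (hB j hj)

lemma Inv.Kc_sum {z : ℂ} {n : ℕ} {w : ℕ → ℂ} (H : Inv z n w) (A : Finset ℕ)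
    (hA : ∀ j ∈ A, j ≤ n) : Kc (w 0) z (∑ i ∈ A, w i) :=
  Kc.sum fun i hi => H.cone i (hA i hi)

lemma Inv.sum_ne {z : ℂ} (hz : 0 < z.im) {n : ℕ} {w : ℕ → ℂ} (H : Inv z n w) (A : Finset ℕ)
    (hA : ∀ j ∈ A, j ≤ n) (i : ℕ) (hi : i ∈ A) : ∑ i ∈ A, w i ≠ 0 := fun h =>
  H.ne i (hA i hi) (Kc.sum_zero hz (H.ne 0 (Nat.zero_le _)) (fun i hi => H.cone i (hA i hi)) h i hi)

lemma cr_add_left (a b c : ℂ) : cr (a + b) c = cr a c + cr b c := by simp [cr]; ring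
lemma cr_add_right (a b c : ℂ) : cr a (b + c) = cr a b + cr a c := by simp [cr]; ring
lemma cr_self (a : ℂ) : cr a a = 0 := by simp [cr]; ring
lemma cr_swap (a b : ℂ) : cr a b = - cr b a := by simp [cr]; ring
lemma cr_mul (z a b : ℂ) : cr (z * a) (z * b) = Complex.normSq z * cr a b := by
  simp [cr, Complex.normSq_apply]; ring
lemma cr_mul_self {z : ℂ} (hz : 0 < z.im) (a : ℂ) : 0 ≤ cr a (z * a) := by
  have : cr a (z * a) = z.im * (a.re ^ 2 + a.im ^ 2) := by simp [cr]; ring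
  rw [this]; positivity

lemma Inv.S_ne {z : ℂ} (hz : 0 < z.im) {n : ℕ} {w : ℕ → ℂ} (H : Inv z n w) : Ss n w ≠ 0 :=
  H.sum_ne hz _ (fun j hj => by simp at hj; omega) 0 (by simp)

lemma Inv.BT {z : ℂ} {n : ℕ} {w : ℕ → ℂ} (H : Inv z n w) (k : ℕ) :
    0 ≤ cr (Bs n k w) (Ts n k w) := by
  apply H.cr_nonneg
  · intro j hj; simp at hj; omega
  · intro i hi j hj; simp at hi hj; omega

lemma Inv.KS {z : ℂ} {n : ℕ} {w : ℕ → ℂ} (H : Inv z n w) : Kc (w 0) z (Ss n w) :=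
  H.Kc_sum _ (fun j hj => by simp at hj; omega)
lemma Inv.KB {z : ℂ} {n : ℕ} {w : ℕ → ℂ} (H : Inv z n w) (k : ℕ) : Kc (w 0) z (Bs n k w) :=
  H.Kc_sum _ (fun j hj => by simp at hj; omega)
lemma Inv.KT {z : ℂ} {n : ℕ} {w : ℕ → ℂ} (H : Inv z n w) (k : ℕ) : Kc (w 0) z (Ts n k w) :=
  H.Kc_sum _ (fun j hj => by simp at hj; omega)

lemma Inv.T_mem {z : ℂ} (hz : 0 < z.im) {n : ℕ} {w : ℕ → ℂ} (H : Inv z n w) (k : ℕ) :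
    Kc (Ss n w) z (Ts n k w) := by
  have h1 : 0 ≤ cr (Ss n w) (Ts n k w) := by
    rw [← B_add_T n k w, cr_add_left, cr_self, add_zero]
    exact H.BT k
  exact Kc.of_cr hz (H.S_ne hz) h1
    (cr_turn hz (H.ne 0 (Nat.zero_le _)) H.KS (H.KT k) h1)

lemma Inv.B_mem {z : ℂ} (hz : 0 < z.im) {n : ℕ} {w : ℕ → ℂ} (H : Inv z n w) (k : ℕ) :
    Kc (Ss n w) z (z * Bs n k w) := by
  have h1 : 0 ≤ cr (Bs n k w) (Ss n w) := by
    rw [← B_add_T n k w, cr_add_right, cr_self, zero_add]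
    exact H.BT k
  refine Kc.of_cr hz (H.S_ne hz) (cr_turn hz (H.ne 0 (Nat.zero_le _)) (H.KB k) H.KS h1) ?_
  rw [cr_mul]
  exact mul_nonneg (Complex.normSq_nonneg _) h1

/-- the next sequence -/
def nxt (z : ℂ) (n : ℕ) (w : ℕ → ℂ) (k : ℕ) : ℂ :=
  ∑ i ∈ Finset.range (n + 1), (if i < k then z else 1) * w i

lemma nxt_eq (z : ℂ) (n : ℕ) (w : ℕ → ℂ) (k : ℕ) :
    nxt z n w k = z * Bs n k w + Ts n k w := by
  unfold nxt Bs Ts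
  rw [← Finset.sum_filter_add_sum_filter_not (Finset.range (n + 1)) (fun i => i < k),
    Finset.mul_sum]
  congr 1
  · exact Finset.sum_congr rfl fun i hi => by rw [if_pos (Finset.mem_filter.mp hi).2]
  · exact Finset.sum_congr rfl fun i hi => by rw [if_neg (Finset.mem_filter.mp hi).2, one_mul]

lemma nxt_zero (z : ℂ) (n : ℕ) (w : ℕ → ℂ) : nxt z n w 0 = Ss n w := by
  simp [nxt, Ss]

lemma Inv.nxt {z : ℂ} (hz : 0 < z.im) {n : ℕ} {w : ℕ → ℂ} (H : Inv z n w) :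
    Inv z (n + 1) (nxt z n w) where
  ne k _ h := by
    rw [nxt_eq] at h
    obtain ⟨h1, h2⟩ := Kc.pointed hz (H.S_ne hz) (H.B_mem hz k) (H.T_mem hz k) h
    have hz0 : z ≠ 0 := by rintro rfl; simp at hz
    have h3 := (mul_eq_zero.mp h1).resolve_left hz0
    apply H.S_ne hz
    rw [← B_add_T n k w, h2, h3, add_zero]
  cone k _ := by
    rw [nxt_zero, nxt_eq]
    exact (H.B_mem hz k).add (H.T_mem hz k)
  mono k l hkl _ := by
    rw [nxt_eq, nxt_eq]
    set M : ℂ := ∑ i ∈ (Finset.range (n + 1)).filter (fun i => ¬ i < k ∧ i < l), w i with hM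
    have hB : Bs n l w = Bs n k w + M := by
      unfold Bs
      rw [hM, ← Finset.sum_union]
      · congr 1; ext i; simp; omega
      · rw [Finset.disjoint_left]; intro i; simp; omega
    have hT : Ts n k w = M + Ts n l w := by
      unfold Ts
      rw [hM, ← Finset.sum_union]
      · congr 1; ext i; simp; omega
      · rw [Finset.disjoint_left]; intro i; simp; omega
    have hKM : Kc (w 0) z M := H.Kc_sum _ (fun j hj => by simp at hj; omega)
    have hBM : 0 ≤ cr (Bs n k w) M := by
      apply H.cr_nonneg
      · intro j hj; simp at hj; omega
      · intro i hi j hj; simp at hi hj; omega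
    have hMT : 0 ≤ cr M (Ts n l w) := by
      apply H.cr_nonneg
      · intro j hj; simp at hj; omega
      · intro i hi j hj; simp at hi hj; omega
    have h0 := H.ne 0 (Nat.zero_le _)
    have h1 := cr_turn hz h0 (H.KB k) hKM hBM
    have h2 := cr_turn hz h0 hKM (H.KT l) hMT
    have h3 := cr_mul_self hz M
    have h4 : 0 ≤ cr (z * Bs n k w) (z * M) := by
      rw [cr_mul]
      exact mul_nonneg (Complex.normSq_nonneg _) hBM
    rw [hB, hT, mul_add]
    simp only [cr_add_left, cr_add_right, cr_self]
    rw [cr_swap (z * Bs n k w) (Ts n l w)]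
    linarith

/-- refined Eulerian polynomials -/
noncomputable def A : ℕ → ℕ → ℝ[X]
  | 0, _ => 1
  | n + 1, k => ∑ i ∈ Finset.range (n + 1), (if i < k then X else 1) * A n i

lemma A_succ (n k : ℕ) :
    A (n + 1) k = ∑ i ∈ Finset.range (n + 1), (if i < k then X else 1) * A n i := rfl

lemma inv_A {z : ℂ} (hz : 0 < z.im) (n : ℕ) : Inv z n (fun k => aeval z (A n k)) := by
  induction n with
  | zero =>
    refine ⟨fun i _ => by simp [A], fun i _ => ⟨1, 0, by simp, by simp, by simp [A]⟩, ?_⟩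
    intro i j _ _
    simp [A, cr]
  | succ n ih =>
    have h := ih.nxt hz
    convert h using 1
    ext k
    simp only [A_succ, nxt, map_sum, map_mul]
    refine Finset.sum_congr rfl fun i _ => ?_
    split_ifs <;> simp

lemma A_natDegree (n k : ℕ) : (A n k).natDegree ≤ n := by
  induction n generalizing k with
  | zero => simp [A]
  | succ n ih =>
    rw [A_succ]
    refine natDegree_sum_le_of_forall_le _ _ fun i _ => ?_
    refine natDegree_mul_le.trans ?_
    have := ih i
    have h2 : (if i < k then (X : ℝ[X]) else 1).natDegree ≤ 1 := by split_ifs <;> simp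
    omega

lemma reflect_sum' {ι : Type*} (N : ℕ) (s : Finset ι) (f : ι → ℝ[X]) :
    reflect N (∑ i ∈ s, f i) = ∑ i ∈ s, reflect N (f i) := by
  ext k
  simp [coeff_reflect]

lemma A_reflect (n k : ℕ) (hk : k ≤ n) : reflect n (A n k) = A n (n - k) := by
  induction n generalizing k with
  | zero => simp [A]
  | succ n ih =>
    rw [A_succ, A_succ, reflect_sum', ← Finset.sum_range_reflect]
    refine Finset.sum_congr rfl fun i hi => ?_
    have hi' : i ≤ n := by simp at hi; omega
    have e : n + 1 - 1 - i = n - i := by omega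
    rw [e, add_comm n 1, reflect_mul _ _ (by split_ifs <;> simp) (A_natDegree _ _),
      ih _ (by omega)]
    have e2 : n - (n - i) = i := by omega
    rw [e2]
    congr 1
    by_cases h : n - i < k
    · rw [if_pos h, if_neg (by omega)]; simp
    · rw [if_neg h, if_pos (by omega)]
      simpa using reflect_monomial 1 0 (R := ℝ)

/-- generating function of `m^k (m+1)^(n-k)` -/
noncomputable def F (n k : ℕ) : PowerSeries ℝ := PowerSeries.mk fun m => (m : ℝ) ^ k * ((m : ℝ) + 1) ^ (n - k)

lemma F_diff (n k : ℕ) (hk : k ≤ n) : F (n + 1) k - F (n + 1) (k + 1) = F n k := by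
  ext m
  simp only [F, map_sub, PowerSeries.coeff_mk]
  have e : n + 1 - k = (n - k) + 1 := by omega
  have e' : n + 1 - (k + 1) = n - k := by omega
  rw [e, e']
  ring

lemma F_last (n : ℕ) : F (n + 1) (n + 1) = PowerSeries.X * F (n + 1) 0 := by
  ext m
  cases m with
  | zero => simp [F]
  | succ m => simp [F, PowerSeries.coeff_succ_X_mul]

lemma A_diff (n k : ℕ) (hk : k ≤ n) : A (n + 1) k - A (n + 1) (k + 1) = (1 - X) * A n k := by
  rw [A_succ, A_succ, ← Finset.sum_sub_distrib, Finset.sum_eq_single k]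
  · simp; ring
  · intro i _ hik
    by_cases h : i < k
    · rw [if_pos h, if_pos (by omega)]; ring
    · rw [if_neg h, if_neg (by omega)]; ring
  · intro h; simp at h; omega

lemma A_eq_F (n k : ℕ) (hk : k ≤ n) :
    ((A n k : ℝ[X]) : PowerSeries ℝ) = (1 - PowerSeries.X) ^ (n + 1) * F n k := by
  induction n generalizing k with
  | zero =>
    obtain rfl : k = 0 := by omega
    have h := PowerSeries.mk_one_mul_one_sub_eq_one ℝ
    have : F 0 0 = PowerSeries.mk 1 := by ext m; simp [F]
    rw [this, pow_one, mul_comm, h]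
    simp [A]
  | succ n ih =>
    induction k with
    | zero =>
      have h1 : (1 - PowerSeries.X) * F (n + 1) 0 = ∑ i ∈ Finset.range (n + 1), F n i := by
        have : ∑ i ∈ Finset.range (n + 1), F n i
            = ∑ i ∈ Finset.range (n + 1), (F (n + 1) i - F (n + 1) (i + 1)) :=
          Finset.sum_congr rfl fun i hi => (F_diff n i (by simp at hi; omega)).symm
        rw [this, Finset.sum_range_sub', F_last]
        ring
      rw [pow_succ, mul_assoc, h1, A_succ, Finset.mul_sum]
      simp only [Nat.not_lt_zero, if_false, one_mul]
      rw [← Polynomial.coeToPowerSeries.ringHom_apply, map_sum]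
      refine Finset.sum_congr rfl fun i hi => ?_
      rw [Polynomial.coeToPowerSeries.ringHom_apply, ih i (by simp at hi; omega)]
    | succ k ihk =>
      have h1 := ihk (by omega)
      have h2 := A_diff n k (by omega)
      have h3 := F_diff n k (by omega)
      have h4 := ih k (by omega)
      have h5 : A (n + 1) (k + 1) = A (n + 1) k - (1 - X) * A n k := by rw [← h2]; ring
      have h6 : F (n + 1) (k + 1) = F (n + 1) k - F n k := by rw [← h3]; ring
      rw [h5, h6]
      push_cast
      rw [h1, h4]
      ring

lemma h_eq (d : ℕ) (c : ℕ → ℝ) (i h : ℝ[X])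
    (hi : i = ∑ j ∈ Finset.range (d + 1), Polynomial.C (c j) * X ^ j * (X + 1) ^ (d - j))
    (hdeg : h.degree ≤ (d : ℕ))
    (hser : ∀ m : ℕ,
      i.eval (m : ℝ) = ∑ k ∈ Finset.range (d + 1), h.coeff k * ((m + d - k).choose d : ℝ)) :
    h = ∑ j ∈ Finset.range (d + 1), Polynomial.C (c j) * A d j := by
  have hd : ∀ k, d < k → h.coeff k = 0 := fun k hk =>
    coeff_eq_zero_of_degree_lt (lt_of_le_of_lt hdeg (by exact_mod_cast hk))
  have h1 : (h : PowerSeries ℝ) * (PowerSeries.mk 1) ^ (d + 1)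
      = ∑ j ∈ Finset.range (d + 1), PowerSeries.C (c j) * F d j := by
    rw [PowerSeries.mk_one_pow_eq_mk_choose_add]
    ext m
    have h2 := hser m
    rw [hi, eval_finsetSum] at h2
    rw [map_sum, PowerSeries.coeff_mul]
    have h3 : ∑ j ∈ Finset.range (d + 1), (PowerSeries.coeff m) (PowerSeries.C (c j) * F d j)
        = ∑ k ∈ Finset.range (d + 1), h.coeff k * ((m + d - k).choose d : ℝ) := by
      rw [← h2]
      refine Finset.sum_congr rfl fun j _ => ?_
      rw [PowerSeries.coeff_C_mul]
      simp [F]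
      ring
    rw [h3, Finset.Nat.sum_antidiagonal_eq_sum_range_succ_mk]
    simp only [coeff_coe, PowerSeries.coeff_mk]
    have h4 : ∑ k ∈ Finset.range m.succ, h.coeff k * ((d + (m - k)).choose d : ℝ)
        = ∑ k ∈ Finset.range (m + 1), h.coeff k * ((m + d - k).choose d : ℝ) := by
      refine Finset.sum_congr rfl fun k hk => ?_
      have : d + (m - k) = m + d - k := by simp at hk; omega
      rw [this]
    rw [h4]
    rcases le_total m d with hmd | hmd
    · refine Finset.sum_subset (fun k hk => by simp at hk ⊢; omega) fun k hk hk' => ?_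
      simp at hk hk'
      rw [Nat.choose_eq_zero_of_lt (by omega)]
      simp
    · refine (Finset.sum_subset (fun k hk => by simp at hk ⊢; omega) fun k hk hk' => ?_).symm
      simp at hk hk'
      rw [hd k (by omega), zero_mul]
  apply Polynomial.coe_injective ℝ
  have h5 := PowerSeries.mk_one_mul_one_sub_eq_one ℝ
  have h6 : (h : PowerSeries ℝ)
      = (1 - PowerSeries.X) ^ (d + 1) * ((h : PowerSeries ℝ) * (PowerSeries.mk 1) ^ (d + 1)) := by
    have : (1 - PowerSeries.X) ^ (d + 1) * ((h : PowerSeries ℝ) * (PowerSeries.mk 1) ^ (d + 1))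
      = (h : PowerSeries ℝ) * ((PowerSeries.mk 1) * (1 - PowerSeries.X)) ^ (d + 1) := by
      rw [mul_pow]; ring
    rw [this, h5, one_pow, mul_one]
  rw [h6, h1, ← Polynomial.coeToPowerSeries.ringHom_apply, map_sum, Finset.mul_sum]
  refine Finset.sum_congr rfl fun j hj => ?_
  rw [Polynomial.coeToPowerSeries.ringHom_apply]
  push_cast
  rw [A_eq_F d j (by simp at hj; omega)]
  ring

lemma realRooted_of (p : ℝ[X]) (h : ∀ z : ℂ, 0 < z.im → aeval z p = 0 → p = 0) :
    RealRooted p := by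
  by_cases hp : p = 0
  · exact Or.inl hp
  right
  intro z hz
  rw [toC, eval_map_algebraMap] at hz
  by_contra hne
  rcases lt_or_gt_of_ne hne with h1 | h1
  · refine hp (h (starRingEnd ℂ z) (by simpa using h1) ?_)
    rw [Polynomial.aeval_conj, hz, map_zero]
  · exact hp (h z h1 hz)

lemma b_eq (n : ℕ) (c : ℕ → ℝ) (b : ℝ[X])
    (hb : (1 - X) * b = ∑ j ∈ Finset.range (n + 2), Polynomial.C (c (n + 1 - j) - c j) * A (n + 1) j) :
    b = ∑ i ∈ Finset.range (n + 1),
      Polynomial.C (∑ l ∈ Finset.range (n - i + 1), (c (n + 1 - l) - c l)) * A n i := by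
  have hne : (1 - X : ℝ[X]) ≠ 0 := by
    intro h
    have := congrArg (eval 0) h
    simp at this
  apply mul_left_cancel₀ hne
  rw [hb]
  simp only [A_succ, Finset.mul_sum]
  rw [Finset.sum_comm]
  refine Finset.sum_congr rfl fun i hi => ?_
  have hi' : i ≤ n := by simp at hi; omega
  have h0 : ∑ j ∈ Finset.range (n + 2), (c (n + 1 - j) - c j) = 0 := by
    rw [Finset.sum_sub_distrib, sub_eq_zero]
    exact Finset.sum_range_reflect c (n + 2)
  have h1 : ∑ l ∈ Finset.range (n - i + 1), (c (n + 1 - l) - c l)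
      = ∑ j ∈ Finset.range (n + 2), if i < j then (c j - c (n + 1 - j)) else 0 := by
    rw [← Finset.sum_range_reflect _ (n + 2), ← Finset.sum_filter]
    have : (Finset.range (n - i + 1)) = (Finset.range (n + 2)).filter (fun j => i < n + 2 - 1 - j) := by
      ext j; simp; omega
    rw [this]
    refine Finset.sum_congr rfl fun j hj => ?_
    simp at hj
    have e1 : n + 2 - 1 - j = n + 1 - j := by omega
    have e2 : n + 1 - (n + 1 - j) = j := by omega
    rw [e1, e2]
  have h2 : ∑ j ∈ Finset.range (n + 2),
      Polynomial.C (c (n + 1 - j) - c j) * ((if i < j then X else 1) : ℝ[X])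
      = (1 - X) * Polynomial.C (∑ j ∈ Finset.range (n + 2), if i < j then (c j - c (n + 1 - j)) else 0) := by
    have h3 : ∑ j ∈ Finset.range (n + 2), Polynomial.C (c (n + 1 - j) - c j) = 0 := by
      rw [← map_sum, h0, map_zero]
    rw [map_sum, Finset.mul_sum, ← sub_eq_zero, ← Finset.sum_sub_distrib, ← h3]
    refine Finset.sum_congr rfl fun j _ => ?_
    split_ifs
    · simp only [map_sub]; ring
    · simp
  rw [h1, ← mul_assoc, ← h2, Finset.sum_mul]
  exact Finset.sum_congr rfl fun j _ => by ring

lemma a_eq (n : ℕ) (c : ℕ → ℝ) (a : ℝ[X])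
    (ha : (1 - X) * a = ∑ j ∈ Finset.range (n + 2),
      Polynomial.C (c j) * (A (n + 1) j - X * A (n + 1) (n + 1 - j))) :
    a = ∑ j ∈ Finset.range (n + 2), Polynomial.C (c j) *
      (∑ i ∈ (Finset.range (n + 1)).filter (fun i => ¬ i < j), A n i +
       X * ∑ i ∈ (Finset.range (n + 1)).filter (fun i => i < n + 1 - j), A n i) := by
  have hne : (1 - X : ℝ[X]) ≠ 0 := by
    intro h
    have := congrArg (eval 0) h
    simp at this
  apply mul_left_cancel₀ hne
  rw [ha, Finset.mul_sum]
  refine Finset.sum_congr rfl fun j hj => ?_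
  rw [mul_left_comm]
  congr 1
  rw [A_succ, A_succ, Finset.sum_filter, Finset.sum_filter, Finset.mul_sum, Finset.mul_sum,
    ← Finset.sum_sub_distrib, ← Finset.sum_add_distrib, Finset.mul_sum]
  refine Finset.sum_congr rfl fun i hi => ?_
  split_ifs <;> ring

lemma b_rr (n : ℕ) (s : ℕ → ℝ) (hs : ∀ i ≤ n, 0 ≤ s i) :
    RealRooted (∑ i ∈ Finset.range (n + 1), Polynomial.C (s i) * A n i) := by
  apply realRooted_of
  intro z hz h0
  have H := inv_A hz n
  rw [map_sum] at h0
  have h1 := Kc.sum_zero hz (H.ne 0 (Nat.zero_le _)) (fun i hi => by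
    have hi' : i ≤ n := by simp at hi; omega
    have := (H.cone i hi').smul (hs i hi')
    simpa using this) h0
  refine Finset.sum_eq_zero fun i hi => ?_
  have h2 := h1 i hi
  have hi' : i ≤ n := by simp at hi; omega
  rw [map_mul] at h2
  have h3 := (mul_eq_zero.mp h2).resolve_right (H.ne i hi')
  simp at h3
  simp [h3]

lemma a_rr (n : ℕ) (c : ℕ → ℝ) (hc : ∀ i, 0 ≤ c i) :
    RealRooted (∑ j ∈ Finset.range (n + 2), Polynomial.C (c j) *
      (∑ i ∈ (Finset.range (n + 1)).filter (fun i => ¬ i < j), A n i +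
       X * ∑ i ∈ (Finset.range (n + 1)).filter (fun i => i < n + 1 - j), A n i)) := by
  apply realRooted_of
  intro z hz h0
  have H := inv_A hz n
  rw [map_sum] at h0
  have key : ∀ j, aeval z (Polynomial.C (c j) *
      (∑ i ∈ (Finset.range (n + 1)).filter (fun i => ¬ i < j), A n i +
       X * ∑ i ∈ (Finset.range (n + 1)).filter (fun i => i < n + 1 - j), A n i))
      = (c j : ℂ) * (Ts n j (fun k => aeval z (A n k))
        + z * Bs n (n + 1 - j) (fun k => aeval z (A n k))) := by
    intro j
    simp only [map_mul, map_add, map_sum, aeval_X, aeval_C, Ts, Bs]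
    rfl
  have h1 := Kc.sum_zero hz (H.S_ne hz) (fun j hj => by
    rw [key]
    exact ((H.T_mem hz j).add (H.B_mem hz _)).smul (hc j)) h0
  refine Finset.sum_eq_zero fun j hj => ?_
  have h2 := h1 j hj
  rw [key] at h2
  rcases mul_eq_zero.mp h2 with h3 | h3
  · have : c j = 0 := by exact_mod_cast h3
    simp [this]
  · have h4 := (Kc.pointed hz (H.S_ne hz) (H.T_mem hz j) (H.B_mem hz _) h3).1
    by_cases hjn : j ≤ n
    · exact absurd h4 (H.sum_ne hz _ (fun i hi => by simp at hi; omega) j (by simp; omega))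
    · have hj' : j = n + 1 := by simp at hj; omega
      subst hj'
      rw [Finset.filter_false_of_mem, Finset.filter_false_of_mem]
      · simp
      · intro i hi; simp
      · intro i hi; simp at hi ⊢; omega

lemma s_nonneg (n : ℕ) (c : ℕ → ℝ)
    (hineq : ∀ j, 2 * j ≤ n + 1 →
      ∑ l ∈ Finset.range (j + 1), c l ≤ ∑ l ∈ Finset.range (j + 1), c (n + 1 - l))
    (i : ℕ) (hi : i ≤ n) : 0 ≤ ∑ l ∈ Finset.range (n - i + 1), (c (n + 1 - l) - c l) := by
  by_cases h : 2 * (n - i) ≤ n + 1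
  · rw [Finset.sum_sub_distrib]
    linarith [hineq _ h]
  · have h1 := hineq i (by omega)
    have h0 : ∑ j ∈ Finset.range (n + 2), (c (n + 1 - j) - c j) = 0 := by
      rw [Finset.sum_sub_distrib, sub_eq_zero]
      exact Finset.sum_range_reflect c (n + 2)
    have e : n + 2 = (n - i + 1) + (i + 1) := by omega
    rw [e, Finset.sum_range_add] at h0
    have h2 : ∑ x ∈ Finset.range (i + 1), (c (n + 1 - (n - i + 1 + x)) - c (n - i + 1 + x))
        = ∑ l ∈ Finset.range (i + 1), (c l - c (n + 1 - l)) := by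
      rw [← Finset.sum_range_reflect]
      refine Finset.sum_congr rfl fun x hx => ?_
      simp at hx
      have e1 : n + 1 - (n - i + 1 + (i + 1 - 1 - x)) = x := by omega
      have e2 : n - i + 1 + (i + 1 - 1 - x) = n + 1 - x := by omega
      rw [e1, e2]
    rw [h2, Finset.sum_sub_distrib (s := Finset.range (i + 1))] at h0
    linarith

end Stmt9Aux

open Stmt9Aux in
/-- let `i = Σ_j c_j x^j (x+1)^{d-j}` with `c_j ≥ 0`, etc. -/
theorem stmt9 (d : ℕ) (c : ℕ → ℝ) (hc : ∀ j, 0 ≤ c j)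
    (hineq : ∀ j, 2 * j ≤ d →
      ∑ l ∈ Finset.range (j + 1), c l ≤ ∑ l ∈ Finset.range (j + 1), c (d - l))
    (i h a b : ℝ[X])
    (hi : i = ∑ j ∈ Finset.range (d + 1), Polynomial.C (c j) * X ^ j * (X + 1) ^ (d - j))
    (hdeg : h.degree ≤ (d : ℕ))
    (hser : ∀ m : ℕ,
      i.eval (m : ℝ) = ∑ k ∈ Finset.range (d + 1), h.coeff k * ((m + d - k).choose d : ℝ))
    (hab : h = a + X * b) (ha : a.degree ≤ (d : ℕ)) (hb : b.degree < (d : ℕ))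
    (hra : Polynomial.reflect d a = a) (hrb : Polynomial.reflect (d - 1) b = b) :
    RealRooted a ∧ RealRooted b := by
  have hh := h_eq d c i h hi hdeg hser
  cases d with
  | zero =>
    constructor
    · rw [eq_C_of_degree_le_zero ha]
      apply realRooted_of
      intro z _ h0
      simp at h0
      simp [h0]
    · left
      rw [← Polynomial.degree_eq_bot]
      exact Nat.WithBot.lt_zero_iff.mp (by exact_mod_cast hb)
  | succ n =>
    have hbn : b.natDegree ≤ n := by
      by_cases hb0 : b = 0
      · simp [hb0]
      · have := (natDegree_lt_iff_degree_lt hb0).mpr hb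
        omega
    have hrh : reflect (n + 1) h = a + b := by
      rw [hab, reflect_add, hra, add_comm n 1, reflect_mul _ _ (by simp) hbn]
      simp at hrb
      rw [hrb]
      simp
    have hrh2 : reflect (n + 1) h
        = ∑ j ∈ Finset.range (n + 2), Polynomial.C (c j) * A (n + 1) (n + 1 - j) := by
      rw [hh, reflect_sum']
      refine Finset.sum_congr rfl fun j hj => ?_
      rw [reflect_C_mul, A_reflect _ _ (by simp at hj; omega)]
    constructor
    · rw [a_eq n c a]
      · exact a_rr n c hc
      · have : (1 - X) * a = h - X * reflect (n + 1) h := by rw [hrh, hab]; ring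
        rw [this, hrh2, hh, Finset.mul_sum, ← Finset.sum_sub_distrib]
        exact Finset.sum_congr rfl fun j _ => by ring
    · rw [b_eq n c b]
      · exact b_rr n _ (s_nonneg n c hineq)
      · have : (1 - X) * b = reflect (n + 1) h - h := by rw [hrh, hab]; ring
        have e : ∑ j ∈ Finset.range (n + 2), Polynomial.C (c j) * A (n + 1) (n + 1 - j)
            = ∑ j ∈ Finset.range (n + 2), Polynomial.C (c (n + 1 - j)) * A (n + 1) j := by
          rw [← Finset.sum_range_reflect]
          refine Finset.sum_congr rfl fun j hj => ?_
          simp at hj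
          have e1 : n + 2 - 1 - j = n + 1 - j := by omega
          have e2 : n + 1 - (n + 1 - j) = j := by omega
          rw [e1, e2]
        rw [this, hrh2, e, hh, ← Finset.sum_sub_distrib]
        exact Finset.sum_congr rfl fun j _ => by rw [map_sub]; ring
end

section
/- Suppose p ∈ ℝ[x] is a polynomial of the form p = Σ_{r≥2} Σ_{k=0}^n c_{r,k}·A_{r,k}^n(x), where all c_{r,k} ≥ 0 and only finitely many are nonzero. Then I_n(p) ≺ p; in particular, p is real-rooted and alternatingly increasing. -/
open Polynomial
open scoped Classical

/-- The refined Eulerian polynomials. -/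
noncomputable def Bp : ℕ → ℕ → ℝ[X]
  | 0, _ => 1
  | n + 1, k => X * ∑ i ∈ Finset.range k, Bp n i + ∑ i ∈ Finset.Ico k (n + 1), Bp n i

/-- The generating series of `m^k (m+1)^(n-k)`. -/
noncomputable def Gs (n k : ℕ) : PowerSeries ℝ :=
  PowerSeries.mk fun m => (m : ℝ) ^ k * ((m : ℝ) + 1) ^ (n - k)

lemma Gs_step (n k : ℕ) (h : k ≤ n) : Gs (n + 1) k = Gs (n + 1) (k + 1) + Gs n k := by
  ext m
  simp only [Gs, PowerSeries.coeff_mk, map_add]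
  rw [show n + 1 - k = (n - k) + 1 by omega, show n + 1 - (k + 1) = n - k by omega]
  ring

lemma Gs_top (n : ℕ) : Gs (n + 1) (n + 1) = PowerSeries.X * Gs (n + 1) 0 := by
  ext m
  cases m with
  | zero => simp [Gs]
  | succ m =>
    rw [PowerSeries.coeff_succ_X_mul]
    simp [Gs]

lemma Gs_sum (n k : ℕ) (h : k ≤ n + 1) :
    Gs (n + 1) k + ∑ i ∈ Finset.range k, Gs n i = Gs (n + 1) 0 := by
  induction k with
  | zero => simp
  | succ k ih =>
    rw [Finset.sum_range_succ, ← ih (by omega), Gs_step n k (by omega)]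
    ring

lemma Bp_Gs (n : ℕ) : ∀ k, k ≤ n →
    ((Bp n k : ℝ[X]) : PowerSeries ℝ) = (1 - PowerSeries.X) ^ (n + 1) * Gs n k := by
  induction n with
  | zero =>
    intro k hk
    obtain rfl : k = 0 := by omega
    have := PowerSeries.mk_one_mul_one_sub_eq_one ℝ
    have h2 : Gs 0 0 = PowerSeries.mk 1 := by ext; simp [Gs]
    rw [h2, zero_add, pow_one, mul_comm, this]
    simp [Bp]
  | succ n ih =>
    intro k hk
    have e1 : ((∑ i ∈ Finset.range k, Bp n i : ℝ[X]) : PowerSeries ℝ)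
        = (1 - PowerSeries.X) ^ (n + 1) * ∑ i ∈ Finset.range k, Gs n i := by
      rw [Finset.mul_sum, ← Polynomial.coeToPowerSeries.ringHom_apply, map_sum]
      refine Finset.sum_congr rfl fun i hi => ?_
      rw [Polynomial.coeToPowerSeries.ringHom_apply]
      exact ih i (by have := Finset.mem_range.1 hi; omega)
    have e2 : ((∑ i ∈ Finset.Ico k (n + 1), Bp n i : ℝ[X]) : PowerSeries ℝ)
        = (1 - PowerSeries.X) ^ (n + 1) * ∑ i ∈ Finset.Ico k (n + 1), Gs n i := by
      rw [Finset.mul_sum, ← Polynomial.coeToPowerSeries.ringHom_apply, map_sum]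
      refine Finset.sum_congr rfl fun i hi => ?_
      rw [Polynomial.coeToPowerSeries.ringHom_apply]
      exact ih i (by have := Finset.mem_Ico.1 hi; omega)
    rw [Bp, Polynomial.coe_add, Polynomial.coe_mul, e1, e2, Polynomial.coe_X]
    have s1 := Gs_sum n k hk
    have s2 := Gs_sum n (n + 1) le_rfl
    rw [Gs_top] at s2
    have s3 := Finset.sum_range_add_sum_Ico (fun i => Gs n i) hk
    rw [pow_succ (1 - PowerSeries.X) (n + 1)]
    linear_combination (1 - PowerSeries.X) ^ (n + 1) * (s2 + s3 - (1 - PowerSeries.X) * s1)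

lemma A_series (n : ℕ) (A : ℝ[X]) (f : ℕ → ℝ) (hd : A.degree ≤ (n : ℕ))
    (h : ∀ m : ℕ, f m = ∑ j ∈ Finset.range (n + 1), A.coeff j * ((m + n - j).choose n : ℝ)) :
    (A : PowerSeries ℝ) = (1 - PowerSeries.X) ^ (n + 1) * PowerSeries.mk f := by
  have key : PowerSeries.mk f =
      (A : PowerSeries ℝ) * PowerSeries.mk fun m => ((n + m).choose n : ℝ) := by
    ext m
    rw [PowerSeries.coeff_mk, h, PowerSeries.coeff_mul,
      Finset.Nat.sum_antidiagonal_eq_sum_range_succ_mk]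
    simp only [PowerSeries.coeff_mk, Polynomial.coeff_coe]
    have g1 : ∑ j ∈ Finset.range (n + 1), A.coeff j * ((m + n - j).choose n : ℝ)
        = ∑ j ∈ Finset.range (n + m + 1), A.coeff j * ((m + n - j).choose n : ℝ) := by
      apply Finset.sum_subset
      · intro x; simp only [Finset.mem_range]; omega
      · intro x _ hx
        have : A.coeff x = 0 := Polynomial.coeff_eq_zero_of_degree_lt
          (lt_of_le_of_lt hd (by simp only [Finset.mem_range] at hx; exact_mod_cast (by omega)))
        simp [this]
    have g2 : ∑ j ∈ Finset.range (m + 1), A.coeff j * ((n + (m - j)).choose n : ℝ)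
        = ∑ j ∈ Finset.range (m + 1), A.coeff j * ((m + n - j).choose n : ℝ) := by
      refine Finset.sum_congr rfl fun j hj => ?_
      rw [show n + (m - j) = m + n - j by have := Finset.mem_range.1 hj; omega]
    rw [g1]
    erw [g2]
    symm
    apply Finset.sum_subset
    · intro x; simp only [Finset.mem_range]; omega
    · intro x hx hx'
      simp only [Finset.mem_range] at hx hx'
      rcases Nat.lt_or_ge n x with h1 | h1
      · have : A.coeff x = 0 := Polynomial.coeff_eq_zero_of_degree_lt
          (lt_of_le_of_lt hd (by exact_mod_cast h1))
        simp [this]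
      · rw [Nat.choose_eq_zero_of_lt (by omega)]; simp
  rw [key, mul_comm, mul_assoc, PowerSeries.mk_add_choose_mul_one_sub_pow_eq_one, mul_one]

lemma A_eq (n r k : ℕ) (hk : k ≤ n) (A : ℝ[X]) (hd : A.degree ≤ (n : ℕ))
    (h : ∀ m : ℕ, ((r * m : ℕ) ^ k * ((r * m : ℕ) + 1) ^ (n - k) : ℝ) =
        ∑ j ∈ Finset.range (n + 1), A.coeff j * ((m + n - j).choose n : ℝ)) :
    A = ∑ j ∈ Finset.range (n + 1),
      ((n.choose j : ℝ) * ((r : ℝ) ^ k * ((r : ℝ) - 1) ^ (j - k) * (j.choose k : ℝ)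
        / (n.choose k : ℝ))) • Bp n j := by
  apply Polynomial.coe_injective ℝ
  rw [A_series n A _ hd h, ← Polynomial.coeToPowerSeries.ringHom_apply, map_sum]
  have : ∀ j ∈ Finset.range (n + 1), Polynomial.coeToPowerSeries.ringHom
      (((n.choose j : ℝ) * ((r : ℝ) ^ k * ((r : ℝ) - 1) ^ (j - k) * (j.choose k : ℝ)
        / (n.choose k : ℝ))) • Bp n j) = (1 - PowerSeries.X) ^ (n + 1) *
      (((n.choose j : ℝ) * ((r : ℝ) ^ k * ((r : ℝ) - 1) ^ (j - k) * (j.choose k : ℝ)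
        / (n.choose k : ℝ))) • Gs n j) := by
    intro j hj
    rw [Polynomial.coeToPowerSeries.ringHom_apply, Polynomial.coe_smul,
      Bp_Gs n j (by have := Finset.mem_range.1 hj; omega), mul_smul_comm]
  rw [Finset.sum_congr rfl this, ← Finset.mul_sum]
  congr 1
  ext m
  rw [map_sum, PowerSeries.coeff_mk]
  simp only [PowerSeries.coeff_smul, Gs, PowerSeries.coeff_mk, smul_eq_mul]
  obtain ⟨d, rfl⟩ := Nat.exists_eq_add_of_le hk
  have hz : ∀ j ∈ Finset.range k, ((k + d).choose j : ℝ) *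
      ((r : ℝ) ^ k * ((r : ℝ) - 1) ^ (j - k) * (j.choose k : ℝ)
        / ((k + d).choose k : ℝ)) * ((m : ℝ) ^ j * ((m : ℝ) + 1) ^ (k + d - j)) = 0 := by
    intro j hj
    rw [Nat.choose_eq_zero_of_lt (Finset.mem_range.1 hj)]; simp
  rw [show k + d + 1 = k + (d + 1) by ring, Finset.sum_range_add, Finset.sum_eq_zero hz, zero_add]
  have hb := add_pow (((r : ℝ) - 1) * m) ((m : ℝ) + 1) d
  rw [show ((r : ℝ) - 1) * m + ((m : ℝ) + 1) = r * m + 1 by ring] at hb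
  push_cast
  rw [show k + d - k = d by omega, hb, Finset.mul_sum]
  refine Finset.sum_congr rfl fun i hi => ?_
  have hi' := Finset.mem_range.1 hi
  have hc : ((k + d).choose (k + i) : ℝ) * ((k + i).choose k : ℝ)
      = ((k + d).choose k : ℝ) * (d.choose i : ℝ) := by
    have := Nat.choose_mul (n := k + d) (k := k + i) (s := k) (by omega) 
    rw [show k + d - k = d by omega, show k + i - k = i by omega] at this
    exact_mod_cast this
  have hne : ((k + d).choose k : ℝ) ≠ 0 := by
    exact_mod_cast (Nat.choose_pos (by omega)).ne'
  rw [show k + i - k = i by omega, show k + d - (k + i) = d - i by omega]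
  have hc' : ((d.choose i : ℕ) : ℝ) = ((k + d).choose (k + i) : ℝ) * ((k + i).choose k : ℝ)
      / ((k + d).choose k : ℝ) := by
    rw [hc]; field_simp
  rw [hc', mul_pow, mul_pow, pow_add]
  ring

lemma Bp_natDegree (n : ℕ) : ∀ k, (Bp n k).natDegree ≤ n ∨ n < k := by
  induction n with
  | zero => intro k; left; simp [Bp]
  | succ n ih =>
    intro k
    rcases Nat.lt_or_ge (n + 1) k with h | h
    · exact Or.inr h
    left
    rw [Bp]
    refine (Polynomial.natDegree_add_le _ _).trans (max_le ?_ ?_)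
    · refine Polynomial.natDegree_mul_le.trans ?_
      rw [add_comm]
      refine add_le_add ?_ Polynomial.natDegree_X_le
      refine Polynomial.natDegree_sum_le_of_forall_le _ _ fun i hi => ?_
      have := Finset.mem_range.1 hi
      exact (ih i).resolve_right (by omega)
    · refine Polynomial.natDegree_sum_le_of_forall_le _ _ fun i hi => ?_
      have := Finset.mem_Ico.1 hi
      have := (ih i).resolve_right (by omega)
      omega

lemma Bp_deg (n k : ℕ) (h : k ≤ n) : (Bp n k).natDegree ≤ n :=
  (Bp_natDegree n k).resolve_right (by omega)

lemma reflect_sum' (n : ℕ) (s : Finset ℕ) (f : ℕ → ℝ[X]) :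
    Polynomial.reflect n (∑ i ∈ s, f i) = ∑ i ∈ s, Polynomial.reflect n (f i) := by
  induction s using Finset.induction_on with
  | empty => simp
  | insert a s ha ih => rw [Finset.sum_insert ha, Finset.sum_insert ha, Polynomial.reflect_add, ih]

lemma reflect_X_mul (n : ℕ) (f : ℝ[X]) (h : f.natDegree ≤ n) :
    Polynomial.reflect (n + 1) (X * f) = Polynomial.reflect n f := by
  rw [add_comm, Polynomial.reflect_mul X f (F := 1) (G := n) Polynomial.natDegree_X_le h]
  have : Polynomial.reflect 1 (X : ℝ[X]) = 1 := by
    have := Polynomial.reflect_one_X (R := ℝ)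
    simpa using this
  rw [this, one_mul]

lemma reflect_succ (n : ℕ) (f : ℝ[X]) (h : f.natDegree ≤ n) :
    Polynomial.reflect (n + 1) f = X * Polynomial.reflect n f := by
  have := Polynomial.reflect_mul 1 f (F := 1) (G := n) (by simp) h
  rw [one_mul, add_comm] at this
  rw [this, Polynomial.reflect_one, pow_one]

lemma Bp_reflect (n : ℕ) : ∀ k, k ≤ n → Polynomial.reflect n (Bp n k) = Bp n (n - k) := by
  induction n with
  | zero => intro k hk; simp [Bp]
  | succ n ih =>
    intro k hk
    have d1 : ∀ i ∈ Finset.range k, (Bp n i).natDegree ≤ n := fun i hi =>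
      Bp_deg n i (by have := Finset.mem_range.1 hi; omega)
    have d2 : ∀ i ∈ Finset.Ico k (n + 1), (Bp n i).natDegree ≤ n := fun i hi =>
      Bp_deg n i (by have := Finset.mem_Ico.1 hi; omega)
    rw [Bp, Bp, Polynomial.reflect_add,
      reflect_X_mul n _ (Polynomial.natDegree_sum_le_of_forall_le _ _ d1),
      reflect_succ n _ (Polynomial.natDegree_sum_le_of_forall_le _ _ d2),
      reflect_sum', reflect_sum']
    have r1 : ∑ i ∈ Finset.range k, Polynomial.reflect n (Bp n i)
        = ∑ i ∈ Finset.Ico (n + 1 - k) (n + 1), Bp n i := by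
      have := Finset.sum_Ico_reflect (fun i => Bp n i) 0 (m := k) (n := n) hk
      rw [Nat.sub_zero] at this
      rw [← this, Finset.range_eq_Ico]
      refine Finset.sum_congr rfl fun i hi => ih i ?_
      have := Finset.mem_Ico.1 hi; omega
    have r2 : ∑ i ∈ Finset.Ico k (n + 1), Polynomial.reflect n (Bp n i)
        = ∑ i ∈ Finset.range (n + 1 - k), Bp n i := by
      have := Finset.sum_Ico_reflect (fun i => Bp n i) k (m := n + 1) (n := n) le_rfl
      rw [Nat.sub_self] at this
      rw [Finset.range_eq_Ico, ← this]
      refine Finset.sum_congr rfl fun i hi => ih i ?_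
      have := Finset.mem_Ico.1 hi; omega
    rw [r1, r2, add_comm]

lemma Bp_coeff_symm (n k i : ℕ) (hk : k ≤ n) (hi : i ≤ n) :
    (Bp n (n - k)).coeff i = (Bp n k).coeff (n - i) := by
  rw [← Bp_reflect n k hk, Polynomial.coeff_reflect, Polynomial.revAt_le hi]

/-! ### Alternatingly increasing -/

lemma AltInc.add {n : ℕ} {p q : ℝ[X]} (hp : AltInc n p) (hq : AltInc n q) : AltInc n (p + q) := by
  obtain ⟨a, b, c⟩ := hp
  obtain ⟨a', b', c'⟩ := hq
  refine ⟨?_, fun k hk => ?_, fun k hk => ?_⟩ <;> simp only [Polynomial.coeff_add]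
  · linarith
  · linarith [b k hk, b' k hk]
  · linarith [c k hk, c' k hk]

lemma AltInc.smul {n : ℕ} {p : ℝ[X]} {t : ℝ} (ht : 0 ≤ t) (hp : AltInc n p) :
    AltInc n (t • p) := by
  obtain ⟨a, b, c⟩ := hp
  refine ⟨?_, fun k hk => ?_, fun k hk => ?_⟩ <;> simp only [Polynomial.coeff_smul, smul_eq_mul]
  · positivity
  · exact mul_le_mul_of_nonneg_left (b k hk) ht
  · exact mul_le_mul_of_nonneg_left (c k hk) ht

lemma AltInc.zero' (n : ℕ) : AltInc n 0 := by
  refine ⟨?_, fun k hk => ?_, fun k hk => ?_⟩ <;> simp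

lemma AltInc.sum {n : ℕ} (s : Finset ℕ) (f : ℕ → ℝ[X]) (h : ∀ i ∈ s, AltInc n (f i)) :
    AltInc n (∑ i ∈ s, f i) := by
  induction s using Finset.induction_on with
  | empty => simpa using AltInc.zero' n
  | insert a s ha ih =>
    rw [Finset.sum_insert ha]
    exact (h a (by simp)).add (ih fun i hi => h i (by simp [hi]))

lemma AltInc.mono {n : ℕ} {q : ℝ[X]} (h : AltInc n q) (k : ℕ) (hk : 2 * k + 1 ≤ n) :
    q.coeff k ≤ q.coeff (k + 1) :=
  (h.2.1 k (by omega)).trans (h.2.2 k hk)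

/-- `q + I_n q` -/
lemma AltInc.symm_add {n : ℕ} {q q' : ℝ[X]} (h : AltInc n q)
    (hs : ∀ i, i ≤ n → q'.coeff i = q.coeff (n - i)) : AltInc n (q + q') := by
  have e : ∀ i, i ≤ n → (q + q').coeff i = q.coeff i + q.coeff (n - i) := fun i hi => by
    rw [Polynomial.coeff_add, hs i hi]
  refine ⟨?_, fun k hk => ?_, fun k hk => ?_⟩
  · rw [e 0 (by omega)]
    have := h.1
    have := h.2.1 0 (by omega)
    linarith
  · rw [e k (by omega), e (n - k) (by omega), show n - (n - k) = k by omega]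
    linarith
  · rw [e (n - k) (by omega), e (k + 1) (by omega), show n - (n - k) = k by omega]
    have h1 := h.2.2 k hk
    have h2 : q.coeff k ≤ q.coeff (n - (k + 1)) := by
      rcases Nat.lt_or_ge n (2 * k + 2) with h3 | h3
      · rw [show n - (k + 1) = k by omega]
      · exact (h.mono k hk).trans (h.2.1 (k + 1) (by omega))
    linarith

lemma AltInc.X_symm_add {n : ℕ} {q q' : ℝ[X]} (h : AltInc n q)
    (hs : ∀ i, i ≤ n → q'.coeff i = q.coeff (n - i)) : AltInc (n + 1) (X * (q + q')) := by
  have hS := h.symm_add hs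
  have e : ∀ i, i ≤ n → (q + q').coeff i = (q + q').coeff (n - i) := fun i hi => by
    rw [Polynomial.coeff_add, Polynomial.coeff_add, hs i hi, hs (n - i) (by omega),
      show n - (n - i) = i by omega]
    ring
  generalize q + q' = S at *
  refine ⟨by simp, fun k hk => ?_, fun k hk => ?_⟩
  · cases k with
    | zero =>
      rw [Nat.sub_zero, Polynomial.coeff_X_mul, Polynomial.coeff_X_mul_zero, e n le_rfl,
        Nat.sub_self]
      exact hS.1
    | succ k =>
      rw [show n + 1 - (k + 1) = (n - (k + 1)) + 1 by omega, Polynomial.coeff_X_mul,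
        Polynomial.coeff_X_mul, ← e (k + 1) (by omega)]
      exact hS.mono k (by omega)
  · rw [show n + 1 - k = (n - k) + 1 by omega, Polynomial.coeff_X_mul,
        Polynomial.coeff_X_mul, ← e k (by omega)]

lemma AltInc.add_X {n : ℕ} {q q' : ℝ[X]} (h : AltInc n q) (hd : q.natDegree ≤ n)
    (hs : ∀ i, i ≤ n → q'.coeff i = q.coeff (n - i)) : AltInc (n + 1) (q + X * q') := by
  have hz : q.coeff (n + 1) = 0 := Polynomial.coeff_eq_zero_of_natDegree_lt (by omega)
  have e : ∀ i, i ≤ n + 1 → (q + X * q').coeff i = q.coeff i + q.coeff (n + 1 - i) := by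
    intro i hi
    rw [Polynomial.coeff_add]
    cases i with
    | zero => rw [Polynomial.coeff_X_mul_zero, Nat.sub_zero, hz]
    | succ i => rw [Polynomial.coeff_X_mul, hs i (by omega), show n + 1 - (i + 1) = n - i by omega]
  refine ⟨?_, fun k hk => ?_, fun k hk => ?_⟩
  · rw [e 0 (by omega), Nat.sub_zero, hz, add_zero]; exact h.1
  · rw [e k (by omega), e (n + 1 - k) (by omega), show n + 1 - (n + 1 - k) = k by omega]
    linarith
  · rw [e (n + 1 - k) (by omega), e (k + 1) (by omega), show n + 1 - (n + 1 - k) = k by omega,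
      show n + 1 - (k + 1) = n - k by omega]
    rcases Nat.lt_or_ge n (2 * k + 1) with h3 | h3
    · rw [show n + 1 - k = k + 1 by omega, show n - k = k by omega]
    · have h1 := h.2.1 k (by omega)
      have h2 := h.mono k h3
      have h4 : q.coeff (n + 1 - k) ≤ q.coeff k := by
        cases k with
        | zero => rw [Nat.sub_zero, hz]; exact h.1
        | succ k =>
          rw [show n + 1 - (k + 1) = n - k by omega]
          exact h.2.2 k (by omega)
      linarith

lemma Bp_AltInc (n : ℕ) : ∀ k, k ≤ n → n ≤ 2 * k → AltInc n (Bp n k) := by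
  induction n with
  | zero =>
    intro k hk _
    refine ⟨by simp [Bp], fun k hk => ?_, fun k hk => by omega⟩
    rw [show k = 0 by omega]
  | succ n ih =>
    intro k hk h2
    have sym : ∀ j, j ≤ n → ∀ i, i ≤ n → (Bp n j).coeff i = (Bp n (n - j)).coeff (n - i) := by
      intro j hj i hi
      rw [← Bp_coeff_symm n (n - j) i (by omega) hi, show n - (n - j) = j by omega]
    have t1 : ∀ j ∈ Finset.range (n + 1 - k), AltInc (n + 1) (Bp n (n - j) + X * Bp n j) := by
      intro j hj
      have := Finset.mem_range.1 hj
      exact (ih (n - j) (by omega) (by omega)).add_X (Bp_deg n _ (by omega)) (sym j (by omega))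
    have t2 : ∀ j ∈ Finset.Ico (n + 1 - k) k,
        AltInc (n + 1) ((1 / 2 : ℝ) • (X * (Bp n j + Bp n (n - j)))) := by
      intro j hj
      have := Finset.mem_Ico.1 hj
      refine AltInc.smul (by norm_num) ?_
      rcases Nat.lt_or_ge (2 * j) n with h | h
      · rw [add_comm (Bp n j)]
        exact (ih (n - j) (by omega) (by omega)).X_symm_add (sym j (by omega))
      · refine (ih j (by omega) h).X_symm_add ?_
        have := sym (n - j) (by omega)
        rwa [show n - (n - j) = j by omega] at this
    have T := (AltInc.sum _ _ t1).add (AltInc.sum _ _ t2)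
    convert T using 1
    rw [Bp, Finset.sum_add_distrib, ← Finset.smul_sum, ← Finset.mul_sum, ← Finset.mul_sum,
      Finset.sum_add_distrib]
    have r1 := Finset.sum_Ico_reflect (fun i => Bp n i) k (m := n + 1) (n := n) le_rfl
    have r1' := Finset.sum_Ico_reflect (fun i => Bp n i) 0 (m := n + 1 - k) (n := n) (by omega)
    rw [Nat.sub_zero, show n + 1 - (n + 1 - k) = k by omega] at r1'
    have r2 := Finset.sum_Ico_reflect (fun i => Bp n i) (n + 1 - k) (m := k) (n := n) hk
    rw [show n + 1 - (n + 1 - k) = k by omega] at r2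
    have r3 := Finset.sum_range_add_sum_Ico (fun i => Bp n i) (show n + 1 - k ≤ k by omega)
    rw [r2, ← r3, Finset.range_eq_Ico, r1', ← two_smul ℝ (∑ i ∈ Finset.Ico (n + 1 - k) k, Bp n i),
      mul_smul_comm, smul_smul]
    norm_num
    ring

lemma AltInc_comb (n : ℕ) (c : ℕ → ℝ) (h0 : ∀ j, 0 ≤ c j)
    (hc : ∀ j, j ≤ n → n ≤ 2 * j → c (n - j) ≤ c j) :
    AltInc n (∑ j ∈ Finset.range (n + 1), c j • Bp n j) := by
  have main : ∀ j, j ≤ n → n ≤ 2 * j → AltInc n (c j • Bp n j + c (n - j) • Bp n (n - j)) := by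
    intro j hj h2
    have hB := Bp_AltInc n j hj h2
    have := ((hB.symm_add (fun i hi => Bp_coeff_symm n j i hj hi)).smul (h0 (n - j))).add
      (hB.smul (sub_nonneg.2 (hc j hj h2)))
    convert this using 1
    module
  have all : ∀ j ∈ Finset.range (n + 1),
      AltInc n (c j • Bp n j + c (n - j) • Bp n (n - j)) := by
    intro j hj
    have hj := Finset.mem_range.1 hj
    rcases Nat.lt_or_ge (2 * j) n with h | h
    · have := main (n - j) (by omega) (by omega)
      rw [show n - (n - j) = j by omega] at this
      rwa [add_comm]
    · exact main j (by omega) h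
  have T := (AltInc.sum _ _ all).smul (t := 1 / 2) (by norm_num)
  convert T using 1
  rw [Finset.sum_add_distrib]
  have r := Finset.sum_Ico_reflect (fun j => c j • Bp n j) 0 (m := n + 1) (n := n) le_rfl
  rw [Nat.sub_self, Nat.sub_zero, ← Finset.range_eq_Ico] at r
  rw [r]
  module

/-! ### Analysis at a point of the upper half plane -/

open ComplexConjugate in
/-- The arguments of `v 0, …, v n, z * v 0` are increasing. -/
def GoodSeq (z : ℂ) (n : ℕ) (v : ℕ → ℂ) : Prop :=
  (∀ i j, i ≤ j → j ≤ n → 0 ≤ (v j * conj (v i)).im) ∧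
  (∀ i j, i ≤ j → j ≤ n → 0 ≤ (z * v i * conj (v j)).im) ∧ ∀ i, i ≤ n → v i ≠ 0

open ComplexConjugate in
lemma core_im (z a b c : ℂ) (hz : 0 < z.im) (h1 : 0 ≤ (z * a * conj b).im)
    (h2 : 0 ≤ (b * conj a).im) (h3 : 0 ≤ (z * b * conj c).im) (h4 : 0 ≤ (c * conj b).im) :
    0 ≤ ((z * (a + b) + c) * conj (z * a + b + c)).im := by
  have : ((z * (a + b) + c) * conj (z * a + b + c)).im = (z * a * conj b).im
      + Complex.normSq z * (b * conj a).im + z.im * Complex.normSq b + (z * b * conj c).im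
      + (c * conj b).im := by
    simp [Complex.normSq_apply]
    ring
  rw [this]
  have := Complex.normSq_nonneg z
  have := Complex.normSq_nonneg b
  positivity

open ComplexConjugate in
lemma sum_im (z : ℂ) (s t : Finset ℕ) (f g : ℕ → ℂ)
    (h : ∀ i ∈ s, ∀ j ∈ t, 0 ≤ (z * f i * conj (g j)).im) :
    0 ≤ (z * (∑ i ∈ s, f i) * conj (∑ j ∈ t, g j)).im := by
  rw [map_sum, Finset.mul_sum s f z, Finset.sum_mul_sum, Complex.im_sum]
  refine Finset.sum_nonneg fun i hi => ?_
  rw [Complex.im_sum]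
  exact Finset.sum_nonneg fun j hj => h i hi j hj

open ComplexConjugate in
lemma cone_ne (z : ℂ) (hz : 0 < z.im) (n : ℕ) (v : ℕ → ℂ) (hv : GoodSeq z n v) (c : ℕ → ℝ)
    (hc : ∀ i, 0 ≤ c i) (h : ∑ k ∈ Finset.range (n + 1), (c k : ℂ) * v k = 0) :
    ∀ k, k ≤ n → c k = 0 := by
  obtain ⟨h1, h2, h3⟩ := hv
  have v0 := h3 0 (by omega)
  have n0 : 0 < Complex.normSq (v 0) := Complex.normSq_pos.2 v0
  have e1 : ∑ k ∈ Finset.range (n + 1), c k * (v k * conj (v 0)).im = 0 := by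
    have : (∑ k ∈ Finset.range (n + 1), (c k : ℂ) * v k) * conj (v 0) = 0 := by rw [h, zero_mul]
    have := congrArg Complex.im this
    rw [Finset.sum_mul, Complex.im_sum] at this
    simpa only [mul_assoc, Complex.im_ofReal_mul, Complex.zero_im] using this
  have e2 : ∑ k ∈ Finset.range (n + 1), c k * (v k * conj (v 0)).re = 0 := by
    have : (∑ k ∈ Finset.range (n + 1), (c k : ℂ) * v k) * conj (v 0) = 0 := by rw [h, zero_mul]
    have := congrArg Complex.re this
    rw [Finset.sum_mul, Complex.re_sum] at this
    simpa only [mul_assoc, Complex.re_ofReal_mul, Complex.zero_re] using this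
  have p1 := (Finset.sum_eq_zero_iff_of_nonneg (fun k hk => mul_nonneg (hc k)
    (h1 0 k (by omega) (by have := Finset.mem_range.1 hk; omega)))).1 e1
  have key : ∀ k, k ≤ n → (v k * conj (v 0)).im = 0 → 0 < (v k * conj (v 0)).re := by
    intro k hk him
    have a := h2 0 k (by omega) hk
    have id : (z * v 0 * conj (v k)).im = z.im * (v k * conj (v 0)).re
        - z.re * (v k * conj (v 0)).im := by
      simp; ring
    rw [id, him, mul_zero, sub_zero] at a
    have a' : 0 ≤ (v k * conj (v 0)).re := nonneg_of_mul_nonneg_right a hz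
    refine lt_of_le_of_ne a' fun hre => ?_
    have : v k * conj (v 0) = 0 := Complex.ext hre.symm him
    rcases mul_eq_zero.1 this with h | h
    · exact h3 k hk h
    · exact v0 (by simpa using h)
  have q : ∀ k ∈ Finset.range (n + 1), 0 ≤ c k * (v k * conj (v 0)).re := by
    intro k hk
    rcases mul_eq_zero.1 (p1 k hk) with h | h
    · rw [h, zero_mul]
    · exact mul_nonneg (hc k) (key k (by have := Finset.mem_range.1 hk; omega) h).le
  have p2 := (Finset.sum_eq_zero_iff_of_nonneg q).1 e2
  intro k hk
  have hk' : k ∈ Finset.range (n + 1) := Finset.mem_range.2 (by omega)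
  rcases mul_eq_zero.1 (p1 k hk') with h | h
  · exact h
  · rcases mul_eq_zero.1 (p2 k hk') with h' | h'
    · exact h'
    · exact absurd h' (key k hk h).ne'

open ComplexConjugate in
lemma GoodSeq.step (z : ℂ) (hz : 0 < z.im) (n : ℕ) (u : ℕ → ℂ) (hu : GoodSeq z n u) :
    GoodSeq z (n + 1) (fun k => z * ∑ i ∈ Finset.range k, u i
      + ∑ i ∈ Finset.Ico k (n + 1), u i) := by
  have hu' := hu
  obtain ⟨h1, h2, h3⟩ := hu
  have sub : ∀ i j, i ≤ j → j ≤ n + 1 → ∃ a b c : ℂ,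
      (z * ∑ i ∈ Finset.range i, u i + ∑ i ∈ Finset.Ico i (n + 1), u i = z * a + b + c) ∧
      (z * ∑ i ∈ Finset.range j, u i + ∑ i ∈ Finset.Ico j (n + 1), u i = z * (a + b) + c) ∧
      0 ≤ (b * conj a).im ∧ 0 ≤ (c * conj b).im ∧ 0 ≤ (c * conj a).im ∧
      0 ≤ (z * a * conj b).im ∧ 0 ≤ (z * b * conj c).im ∧ 0 ≤ (z * a * conj c).im := by
    intro i j hij hj
    refine ⟨∑ i ∈ Finset.range i, u i, ∑ i ∈ Finset.Ico i j, u i,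
      ∑ i ∈ Finset.Ico j (n + 1), u i, ?_, ?_, ?_, ?_, ?_, ?_, ?_, ?_⟩
    · rw [← Finset.sum_Ico_consecutive u hij hj]; ring
    · rw [Finset.sum_range_add_sum_Ico u hij]
    · have := sum_im 1 (Finset.Ico i j) (Finset.range i) u u (fun x hx y hy => by
        simp only [Finset.mem_Ico, Finset.mem_range] at hx hy
        rw [one_mul]; exact h1 _ _ (by omega) (by omega))
      simpa only [one_mul] using this
    · have := sum_im 1 (Finset.Ico j (n + 1)) (Finset.Ico i j) u u (fun x hx y hy => by
        simp only [Finset.mem_Ico, Finset.mem_range] at hx hy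
        rw [one_mul]; exact h1 _ _ (by omega) (by omega))
      simpa only [one_mul] using this
    · have := sum_im 1 (Finset.Ico j (n + 1)) (Finset.range i) u u (fun x hx y hy => by
        simp only [Finset.mem_Ico, Finset.mem_range] at hx hy
        rw [one_mul]; exact h1 _ _ (by omega) (by omega))
      simpa only [one_mul] using this
    · exact sum_im z _ _ u u (fun x hx y hy => by
        simp only [Finset.mem_Ico, Finset.mem_range] at hx hy
        exact h2 _ _ (by omega) (by omega))
    · exact sum_im z _ _ u u (fun x hx y hy => by
        simp only [Finset.mem_Ico, Finset.mem_range] at hx hy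
        exact h2 _ _ (by omega) (by omega))
    · exact sum_im z _ _ u u (fun x hx y hy => by
        simp only [Finset.mem_Ico, Finset.mem_range] at hx hy
        exact h2 _ _ (by omega) (by omega))
  refine ⟨fun i j hij hj => ?_, fun i j hij hj => ?_, fun k hk hzero => ?_⟩
  · obtain ⟨a, b, c, e1, e2, ba, cb, ca, zab, zbc, zac⟩ := sub i j hij hj
    simp only [e1, e2]
    exact core_im z a b c hz zab ba zbc cb
  · obtain ⟨a, b, c, e1, e2, ba, cb, ca, zab, zbc, zac⟩ := sub i j hij hj
    simp only [e1, e2]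
    have n0 := Complex.normSq_nonneg z
    have := core_im z 0 (c + z * a) (z * b) hz (by simp) (by simp) (by
      have : (z * (c + z * a) * conj (z * b)).im
          = Complex.normSq z * ((c * conj b).im + (z * a * conj b).im) := by
        simp [Complex.normSq_apply]; ring
      rw [this]
      positivity) (by
      have : (z * b * conj (c + z * a)).im
          = (z * b * conj c).im + Complex.normSq z * (b * conj a).im := by
        simp [Complex.normSq_apply]; ring
      rw [this]
      positivity)
    rw [show z * (z * a + b + c) = z * (0 + (c + z * a)) + z * b by ring,
      show z * (a + b) + c = z * 0 + (c + z * a) + z * b by ring]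
    exact this
  · set a := ∑ i ∈ Finset.range k, u i with ha
    set c := ∑ i ∈ Finset.Ico k (n + 1), u i with hc
    have ca : 0 ≤ (c * conj a).im := by
      have := sum_im 1 (Finset.Ico k (n + 1)) (Finset.range k) u u (fun x hx y hy => by
        simp only [Finset.mem_Ico, Finset.mem_range] at hx hy
        rw [one_mul]; exact h1 _ _ (by omega) (by omega))
      simpa only [one_mul] using this
    have hc' : c = - (z * a) := by linear_combination hzero
    have : (c * conj a).im = - (z.im * Complex.normSq a) := by
      rw [hc']; simp [Complex.normSq_apply]; ring
    have a0 : a = 0 := by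
      by_contra hne
      have := mul_pos hz (Complex.normSq_pos.2 hne)
      linarith
    have c0 : c = 0 := by rw [hc', a0]; simp
    have tot : ∑ i ∈ Finset.range (n + 1), u i = 0 := by
      rw [← Finset.sum_range_add_sum_Ico u hk, ← ha, ← hc, a0, c0, add_zero]
    have := cone_ne z hz n u hu' (fun _ => 1) (fun _ => zero_le_one) (by simpa using tot) 0
      (by omega)
    exact one_ne_zero this

lemma toC_add (p q : ℝ[X]) : toC (p + q) = toC p + toC q := Polynomial.map_add _
lemma toC_sum (s : Finset ℕ) (f : ℕ → ℝ[X]) : toC (∑ i ∈ s, f i) = ∑ i ∈ s, toC (f i) :=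
  Polynomial.map_sum _ _ _

lemma Bp_good (z : ℂ) (hz : 0 < z.im) (n : ℕ) : GoodSeq z n (fun k => (toC (Bp n k)).eval z) := by
  induction n with
  | zero =>
    refine ⟨fun i j _ _ => ?_, fun i j _ _ => ?_, fun i _ => ?_⟩ <;> simp [Bp, toC]
    exact hz.le
  | succ n ih =>
    have := GoodSeq.step z hz n _ ih
    convert this using 2 with k
    rw [Bp, toC_add, toC, toC, Polynomial.map_mul, ← toC, ← toC, ← toC, toC_sum, toC_sum]
    simp [toC, Polynomial.eval_finsetSum]

lemma eval_comb (z : ℂ) (n : ℕ) (c : ℕ → ℝ) (f : ℕ → ℝ[X]) :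
    (toC (∑ j ∈ Finset.range (n + 1), c j • f j)).eval z
      = ∑ j ∈ Finset.range (n + 1), (c j : ℂ) * (toC (f j)).eval z := by
  rw [toC_sum, Polynomial.eval_finsetSum]
  refine Finset.sum_congr rfl fun j _ => ?_
  simp [toC, Polynomial.smul_eq_C_mul]

lemma comb_ne (n : ℕ) (c : ℕ → ℝ) (h0 : ∀ j, 0 ≤ c j)
    (hp : ∑ j ∈ Finset.range (n + 1), c j • Bp n j ≠ 0) (z : ℂ) (hz : 0 < z.im) :
    (toC (∑ j ∈ Finset.range (n + 1), c j • Bp n j)).eval z ≠ 0 := by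
  intro h
  rw [eval_comb] at h
  have := cone_ne z hz n _ (Bp_good z hz n) c h0 h
  apply hp
  refine Finset.sum_eq_zero fun j hj => ?_
  rw [this j (by have := Finset.mem_range.1 hj; omega), zero_smul]

lemma reflect_comb (n : ℕ) (c : ℕ → ℝ) :
    Polynomial.reflect n (∑ j ∈ Finset.range (n + 1), c j • Bp n j)
      = ∑ j ∈ Finset.range (n + 1), c (n - j) • Bp n j := by
  rw [reflect_sum']
  have r := Finset.sum_Ico_reflect (fun j => c (n - j) • Bp n j) 0 (m := n + 1) (n := n) le_rfl
  rw [Nat.sub_self, Nat.sub_zero, ← Finset.range_eq_Ico] at r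
  rw [← r]
  refine Finset.sum_congr rfl fun j hj => ?_
  have hj := Finset.mem_range.1 hj
  rw [show n - (n - j) = j by omega, Polynomial.smul_eq_C_mul, Polynomial.reflect_C_mul,
    Bp_reflect n j (by omega), Polynomial.smul_eq_C_mul]

open ComplexConjugate in
/-- A bilinear form estimate with all the `2 × 2` minors nonnegative. -/
lemma minors_im (N : ℕ) (c d : ℕ → ℝ) (v : ℕ → ℂ)
    (hm : ∀ i j, i < j → j < N → d j * c i ≤ c j * d i)
    (hv : ∀ i j, i < j → j < N → 0 ≤ (v j * conj (v i)).im) :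
    0 ≤ ((∑ j ∈ Finset.range N, (c j : ℂ) * v j)
      * conj (∑ j ∈ Finset.range N, (d j : ℂ) * v j)).im := by
  have e : ((∑ j ∈ Finset.range N, (c j : ℂ) * v j)
      * conj (∑ j ∈ Finset.range N, (d j : ℂ) * v j)).im
      = ∑ j ∈ Finset.range N, ∑ i ∈ Finset.range N, c j * d i * (v j * conj (v i)).im := by
    rw [map_sum, Finset.sum_mul_sum, Complex.im_sum]
    refine Finset.sum_congr rfl fun j _ => ?_
    rw [Complex.im_sum]
    refine Finset.sum_congr rfl fun i _ => ?_
    simp; ring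
  have e' : ∑ j ∈ Finset.range N, ∑ i ∈ Finset.range N, c j * d i * (v j * conj (v i)).im
      = ∑ j ∈ Finset.range N, ∑ i ∈ Finset.range N, c i * d j * (v i * conj (v j)).im :=
    Finset.sum_comm
  have two : 0 ≤ ∑ j ∈ Finset.range N, ∑ i ∈ Finset.range N,
      (c j * d i * (v j * conj (v i)).im + c i * d j * (v i * conj (v j)).im) := by
    refine Finset.sum_nonneg fun j hj => Finset.sum_nonneg fun i hi => ?_
    have hj := Finset.mem_range.1 hj
    have hi := Finset.mem_range.1 hi
    have sk : (v i * conj (v j)).im = - (v j * conj (v i)).im := by simp; ring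
    rcases lt_trichotomy i j with h | h | h
    · have := mul_nonneg (sub_nonneg.2 (hm i j h hj)) (hv i j h hj)
      rw [sk]; linarith
    · subst h
      have : (v i * conj (v i)).im = 0 := by linarith
      simp [this]
    · have := mul_nonneg (sub_nonneg.2 (hm j i h hi)) (hv j i h hi)
      have sk' : (v j * conj (v i)).im = - (v i * conj (v j)).im := by linarith
      rw [sk']; linarith
  simp only [Finset.sum_add_distrib] at two
  rw [← e', ← e] at two
  linarith

open ComplexConjugate in
lemma main_comb (n : ℕ) (w : ℕ → ℝ) (h0 : ∀ j, 0 ≤ w j) (hw : Monotone w) (p : ℝ[X])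
    (hp : p = ∑ j ∈ Finset.range (n + 1), ((n.choose j : ℝ) * w j) • Bp n j) :
    Interlaces (Polynomial.reflect n p) p ∧ RealRooted p ∧ AltInc n p := by
  have hc0 : ∀ j, 0 ≤ (n.choose j : ℝ) * w j := fun j => mul_nonneg (by positivity) (h0 j)
  refine ⟨?_, ?_, ?_⟩
  · by_cases hpz : p = 0
    · left; simp [hpz, toC]
    right
    intro z hz h
    have ne : (toC p).eval z ≠ 0 := by
      rw [hp] at hpz ⊢
      exact comb_ne n _ hc0 hpz z hz
    have him : 0 ≤ ((toC p).eval z * conj ((toC (Polynomial.reflect n p)).eval z)).im := by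
      rw [hp, reflect_comb n (fun j => (n.choose j : ℝ) * w j), eval_comb,
        eval_comb z n (fun j => (n.choose (n - j) : ℝ) * w (n - j))]
      refine minors_im (n + 1) _ _ _ ?_ ?_
      · intro i j hij hj
        rw [Nat.choose_symm (show j ≤ n by omega), Nat.choose_symm (show i ≤ n by omega)]
        have := mul_le_mul (hw (show n - j ≤ n - i by omega)) (hw hij.le) (h0 _) (h0 _)
        have := mul_le_mul_of_nonneg_left this
          (show (0 : ℝ) ≤ (n.choose j : ℝ) * (n.choose i : ℝ) by positivity)
        linarith
      · intro i j hij hj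
        exact (Bp_good z hz n).1 i j hij.le (by omega)
    rw [Polynomial.eval_add, Polynomial.eval_mul, Polynomial.eval_C] at h
    generalize (toC p).eval z = x at *
    generalize (toC (Polynomial.reflect n p)).eval z = y at *
    have hx : x = - (Complex.I * y) := by linear_combination h
    have : (x * conj y).im = - Complex.normSq y := by
      rw [hx]; simp [Complex.normSq_apply]; ring
    have y0 : y = 0 := by
      by_contra hne
      have := Complex.normSq_pos.2 hne
      linarith
    exact ne (by rw [hx, y0]; simp)
  · by_cases hpz : p = 0
    · exact Or.inl hpz
    right
    intro z hz
    rcases lt_trichotomy z.im 0 with h | h | h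
    · exfalso
      have hcz : (toC p).eval (conj z) = 0 := by
        have : (toC p).eval (conj z) = conj ((toC p).eval z) := by
          simp only [toC, Polynomial.eval_map_algebraMap]
          exact Polynomial.aeval_conj p z
        rw [this, hz, map_zero]
      rw [hp] at hpz hcz
      exact comb_ne n _ hc0 hpz (conj z) (by simpa using h) hcz
    · exact h
    · exfalso
      rw [hp] at hpz hz
      exact comb_ne n _ hc0 hpz z h hz
  · rw [hp]
    refine AltInc_comb n (fun j => (n.choose j : ℝ) * w j) hc0 ?_
    intro j hj h2
    rw [Nat.choose_symm hj]
    exact mul_le_mul_of_nonneg_left (hw (by omega)) (by positivity)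

/-- if `p = Σ_{r≥2} Σ_{k=0}^n c_{r,k} A_{r,k}^n` with all `c_{r,k} ≥ 0`
(finitely many nonzero), where `A_{r,k}^n` is the polynomial of degree at most `n`
determined by `Σ_{m≥0} (rm)^k (rm+1)^{n-k} x^m = A_{r,k}^n(x)/(1-x)^{n+1}`, then
`I_n(p) ≺ p`; in particular `p` is real-rooted and alternatingly increasing. -/
theorem stmt10 (n : ℕ) (hn : 1 ≤ n) (R : ℕ) (A : ℕ → ℕ → ℝ[X]) (c : ℕ → ℕ → ℝ)
    (hA : ∀ r, 2 ≤ r → ∀ k, k ≤ n → (A r k).degree ≤ (n : ℕ) ∧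
      ∀ m : ℕ, ((r * m : ℕ) ^ k * ((r * m : ℕ) + 1) ^ (n - k) : ℝ) =
        ∑ j ∈ Finset.range (n + 1), (A r k).coeff j * ((m + n - j).choose n : ℝ))
    (hc : ∀ r k, 0 ≤ c r k)
    (p : ℝ[X])
    (hp : p = ∑ r ∈ Finset.Icc 2 R, ∑ k ∈ Finset.range (n + 1), c r k • A r k) :
    Interlaces (Polynomial.reflect n p) p ∧ RealRooted p ∧ AltInc n p := by
  have key : ∀ r ∈ Finset.Icc 2 R, ∀ k ∈ Finset.range (n + 1), c r k • A r k
      = ∑ j ∈ Finset.range (n + 1), ((n.choose j : ℝ) * (c r k * ((r : ℝ) ^ k *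
        ((r : ℝ) - 1) ^ (j - k) * (j.choose k : ℝ) / (n.choose k : ℝ)))) • Bp n j := by
    intro r hr k hk
    have hr := (Finset.mem_Icc.1 hr).1
    have hk : k ≤ n := by have := Finset.mem_range.1 hk; omega
    obtain ⟨hd, h⟩ := hA r hr k hk
    rw [A_eq n r k hk (A r k) hd h, Finset.smul_sum]
    refine Finset.sum_congr rfl fun j _ => ?_
    rw [smul_smul]
    congr 1
    ring
  refine main_comb n (fun j => ∑ r ∈ Finset.Icc 2 R, ∑ k ∈ Finset.range (n + 1),
    c r k * ((r : ℝ) ^ k * ((r : ℝ) - 1) ^ (j - k) * (j.choose k : ℝ) / (n.choose k : ℝ)))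
    ?_ ?_ p ?_
  · intro j
    refine Finset.sum_nonneg fun r hr => Finset.sum_nonneg fun k _ => ?_
    have hr : (2 : ℝ) ≤ r := by exact_mod_cast (Finset.mem_Icc.1 hr).1
    have : (0 : ℝ) ≤ (r : ℝ) - 1 := by linarith
    have := hc r k
    positivity
  · intro i j hij
    refine Finset.sum_le_sum fun r hr => Finset.sum_le_sum fun k _ => ?_
    have hr : (2 : ℝ) ≤ r := by exact_mod_cast (Finset.mem_Icc.1 hr).1
    have h1 : (1 : ℝ) ≤ (r : ℝ) - 1 := by linarith
    have h0 : (0 : ℝ) ≤ (r : ℝ) - 1 := by linarith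
    refine mul_le_mul_of_nonneg_left ?_ (hc r k)
    have a1 : ((r : ℝ) - 1) ^ (i - k) ≤ ((r : ℝ) - 1) ^ (j - k) :=
      pow_le_pow_right₀ h1 (by omega)
    have a2 : (i.choose k : ℝ) ≤ (j.choose k : ℝ) := by
      exact_mod_cast Nat.choose_le_choose k hij
    gcongr
  · rw [hp, Finset.sum_congr rfl fun r hr => Finset.sum_congr rfl (key r hr)]
    simp only [Finset.mul_sum, Finset.sum_smul]
    rw [Finset.sum_congr rfl fun r _ => Finset.sum_comm, Finset.sum_comm]
end

section
/- If P ∈ ℝ[x_1,…,x_n] is a stable polynomial and α_1,…,α_n are nonnegative real numbers, then Σ_{j=1}^n α_j·∂P/∂x_j ≺ P; that is, the complex polynomial P + i·Σ_{j=1}^n α_j·∂P/∂x_j is stable. -/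
open Polynomial
open scoped Classical

/-- Chain rule along the line `z + t α`. -/
theorem derivative_line {n : ℕ} (z α : Fin n → ℂ) (Q : MvPolynomial (Fin n) ℂ) :
    Polynomial.derivative (MvPolynomial.aeval (fun j => Polynomial.C (z j) + Polynomial.C (α j) * X) Q)
      = ∑ j, Polynomial.C (α j) *
        MvPolynomial.aeval (fun j => Polynomial.C (z j) + Polynomial.C (α j) * X)
          (MvPolynomial.pderiv j Q) := by
  induction Q using MvPolynomial.induction_on with
  | C a => simp
  | add p q hp hq => simp [hp, hq, mul_add, Finset.sum_add_distrib]
  | mul_X p i hp =>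
    have hX : ∀ j, MvPolynomial.pderiv j (p * MvPolynomial.X i) =
        MvPolynomial.pderiv j p * MvPolynomial.X i + p * (if i = j then 1 else 0) := by
      intro j
      rw [MvPolynomial.pderiv_mul, MvPolynomial.pderiv_X, Pi.single_apply]
    have hd : Polynomial.derivative (Polynomial.C (z i) + Polynomial.C (α i) * X)
        = Polynomial.C (α i) := by
      simp
    simp only [hX]
    rw [map_mul, Polynomial.derivative_mul, hp, MvPolynomial.aeval_X, hd]
    generalize hg : (fun j => Polynomial.C (z j) + Polynomial.C (α j) * X) = g
    have hgi : Polynomial.C (z i) + Polynomial.C (α i) * X = g i := by rw [← hg]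
    rw [hgi]
    have hterm : ∀ j, Polynomial.C (α j) * MvPolynomial.aeval g
        (MvPolynomial.pderiv j p * MvPolynomial.X i + p * (if i = j then 1 else 0)) =
        Polynomial.C (α j) * MvPolynomial.aeval g (MvPolynomial.pderiv j p) * g i +
          (if i = j then MvPolynomial.aeval g p * Polynomial.C (α j) else 0) := by
      intro j
      rw [map_add, map_mul, map_mul, MvPolynomial.aeval_X]
      split_ifs
      · rw [map_one]
        ring
      · rw [map_zero]
        ring
    rw [Finset.sum_congr rfl fun j _ => hterm j, Finset.sum_add_distrib, Finset.sum_mul,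
      Finset.sum_ite_eq]
    simp

theorem eval_line {n : ℕ} (z α : Fin n → ℂ) (Q : MvPolynomial (Fin n) ℂ) (t : ℂ) :
    Polynomial.eval t (MvPolynomial.aeval (fun j => Polynomial.C (z j) + Polynomial.C (α j) * X) Q)
      = MvPolynomial.eval (fun j => z j + α j * t) Q := by
  induction Q using MvPolynomial.induction_on with
  | C a => simp
  | add p q hp hq => simp [hp, hq]
  | mul_X p i hp => simp [hp]

theorem multiset_im_nonpos (s : Multiset ℂ) (h : ∀ w ∈ s, w.im ≤ 0) : s.sum.im ≤ 0 := by
  induction s using Multiset.induction_on with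
  | empty => simp
  | cons a s ih =>
    rw [Multiset.sum_cons, Complex.add_im]
    have h1 := h a (Multiset.mem_cons_self a s)
    have h2 := ih fun w hw => h w (Multiset.mem_cons_of_mem hw)
    linarith

/-- if `P ∈ ℝ[x_1,…,x_n]` is stable and `α_1,…,α_n ≥ 0`, then
`Σ_j α_j ∂P/∂x_j ≺ P`, i.e. `P + i·Σ_j α_j ∂P/∂x_j` is stable. -/
theorem stmt12 (n : ℕ) (P : MvPolynomial (Fin n) ℝ) (α : Fin n → ℝ)
    (hα : ∀ j, 0 ≤ α j)
    (hP : MvStable (MvPolynomial.map (algebraMap ℝ ℂ) P)) :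
    MvStable (MvPolynomial.map (algebraMap ℝ ℂ) P +
      MvPolynomial.C Complex.I *
        MvPolynomial.map (algebraMap ℝ ℂ) (∑ j, α j • MvPolynomial.pderiv j P)) := by
  set Q := MvPolynomial.map (algebraMap ℝ ℂ) P with hQ
  rcases hP with h0 | hP
  · left
    have hP0 : P = 0 := MvPolynomial.map_injective _ (algebraMap ℝ ℂ).injective (by simpa using h0)
    simp [hQ, hP0]
  right
  intro z hz heq
  set f : ℂ[X] := MvPolynomial.aeval
    (fun j => Polynomial.C (z j) + Polynomial.C ((α j : ℂ)) * X) Q with hf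
  have hroot : ∀ t : ℂ, 0 ≤ t.im → f.eval t ≠ 0 := by
    intro t ht
    rw [hf, eval_line z (fun j => (α j : ℂ)) Q t]
    apply hP
    intro j
    have h1 := hz j
    have h2 := mul_nonneg (hα j) ht
    simp
    linarith
  have hf0 : f.eval 0 = MvPolynomial.eval z Q := by
    rw [hf, eval_line z (fun j => (α j : ℂ)) Q 0]
    simp
  have hf1 : (Polynomial.derivative f).eval 0 = MvPolynomial.eval z
      (MvPolynomial.map (algebraMap ℝ ℂ) (∑ j, α j • MvPolynomial.pderiv j P)) := by
    rw [hf, derivative_line z (fun j => (α j : ℂ)) Q, Polynomial.eval_finsetSum, map_sum, map_sum]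
    refine Finset.sum_congr rfl fun j _ => ?_
    rw [Polynomial.eval_mul, eval_line z (fun j => (α j : ℂ)) _ 0, hQ, MvPolynomial.pderiv_map,
      MvPolynomial.smul_eq_C_mul]
    simp
  have hne := hroot 0 (by simp)
  have hlog := (IsAlgClosed.splits f).eval_derivative_div_eval_of_ne_zero hne
  rw [map_add, map_mul, MvPolynomial.eval_C, ← hf0, ← hf1] at heq
  have hI : (Polynomial.derivative f).eval 0 / f.eval 0 = Complex.I := by
    rw [div_eq_iff hne]
    linear_combination (-Complex.I) * heq + (Polynomial.derivative f).eval 0 * Complex.I_mul_I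
  rw [hI] at hlog
  have him := multiset_im_nonpos (f.roots.map fun r => 1 / (0 - r)) (by
    intro w hw
    obtain ⟨r, hr, rfl⟩ := Multiset.mem_map.1 hw
    have hr0 : f.eval r = 0 := (Polynomial.mem_roots'.1 hr).2
    have him : r.im < 0 := by
      by_contra hcon
      exact hroot r (not_lt.1 hcon) hr0
    rw [one_div, Complex.inv_im]
    apply div_nonpos_of_nonpos_of_nonneg
    · simp
      exact him.le
    · exact Complex.normSq_nonneg _)
  rw [← hlog, Complex.I_im] at him
  linarith
end
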